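/- arXiv:1804.00439 — 2 statements merged into one kernel-verified Lean document; each statement's English description precedes it below -/
import Mathlib

section
/- Assume the limits ω₋ and ω₊ of q at −∞ and +∞ exist in [−∞,+∞), and that there exists u₀ ∈ ℝ such that 0 ≥ q(u₀) > max{ω₋,ω₊} and ā·max{ω₋,ω₊} < ‖a‖_∞·q(u₀) − ‖e⁺‖_∞, where e⁺ denotes the positive part of e. Then there exists s₀ ∈ (ā·ω₋, +∞) such that: for s > s₀, equation (WE_s) has no T-periodic solutions; for s = s₀, it has at least one T-periodic solution; for ā·ω₋ < s < s₀, it has at least one T-periodic solution; and for ā·max{ω₋,ω₊} < s < s₀, it has at least two T-periodic solutions. -/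
open MeasureTheory Set Filter

noncomputable section

/-- The Lebesgue measure restricted to the interval `[0,T]`. -/
def muT (T : ℝ) : Measure ℝ := volume.restrict (Icc 0 T)

/-- `u` is a `C¹` function on `[0,T]` with derivative `u'` there, satisfying the
`T`-periodic boundary conditions `u 0 = u T` and `u' 0 = u' T`. -/
def IsC1Periodic (T : ℝ) (u u' : ℝ → ℝ) : Prop :=
  (∀ t ∈ Icc (0:ℝ) T, HasDerivWithinAt u (u' t) (Icc (0:ℝ) T) t) ∧
    ContinuousOn u' (Icc (0:ℝ) T) ∧ u 0 = u T ∧ u' 0 = u' T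

/-- `φ ∘ u'` is absolutely continuous on `[0,T]`, being the indefinite integral of the
integrable function `w` (which is then its a.e. derivative). -/
def IsACPhiDeriv (T : ℝ) (φ : ℝ → ℝ) (u' w : ℝ → ℝ) : Prop :=
  IntegrableOn w (Icc (0:ℝ) T) ∧
    ∀ t ∈ Icc (0:ℝ) T, φ (u' t) = φ (u' 0) + ∫ τ in (0:ℝ)..t, w τ

/-- `u` is a `T`-periodic solution of `(φ(u'))' + f(u)u' + a(t) q(u) = s + e(t)`. -/
def IsSolWE (T : ℝ) (φ f q a e : ℝ → ℝ) (s : ℝ) (u : ℝ → ℝ) : Prop :=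
  ∃ u' w : ℝ → ℝ, IsC1Periodic T u u' ∧ IsACPhiDeriv T φ u' w ∧
    ∀ᵐ t ∂(muT T), w t + f (u t) * u' t + a t * q (u t) = s + e t

section Brouwer

variable {E : Type*} [NormedAddCommGroup E] [NormedSpace ℝ E] [FiniteDimensional ℝ E]

lemma det_smul_id_add_pos {L : E →L[ℝ] E} {c : ℝ} (h : ‖L‖ < c) :
    0 < (c • ContinuousLinearMap.id ℝ E + L).det := by
  have hc : 0 < c := (norm_nonneg L).trans_lt h
  have : CompleteSpace E := FiniteDimensional.complete ℝ E
  have hcont : Continuous fun t : ℝ => (c • ContinuousLinearMap.id ℝ E + t • L).det :=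
    ContinuousLinearMap.continuous_det.comp (by fun_prop)
  have hne : ∀ t ∈ Icc (0:ℝ) 1, (c • ContinuousLinearMap.id ℝ E + t • L).det ≠ 0 := by
    intro t ht
    have hu : IsUnit (1 - (-(t / c)) • L) := by
      apply isUnit_one_sub_of_norm_lt_one
      rw [norm_smul, norm_neg, Real.norm_eq_abs, abs_of_nonneg (div_nonneg ht.1 hc.le)]
      have : t / c * ‖L‖ ≤ 1 / c * ‖L‖ := by gcongr; exact ht.2
      refine this.trans_lt ?_
      rw [one_div, inv_mul_lt_iff₀ hc]; simpa using h
    have heq : c • ContinuousLinearMap.id ℝ E + t • L = c • (1 - (-(t / c)) • L) := by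
      ext x
      simp [smul_smul, mul_div_cancel₀ _ hc.ne']
    rw [heq, ContinuousLinearMap.det, ContinuousLinearMap.toLinearMap_smul, LinearMap.det_smul]
    refine mul_ne_zero (pow_ne_zero _ hc.ne') ?_
    have h2 : IsUnit ((1 - (-(t / c)) • L : E →L[ℝ] E) : E →ₗ[ℝ] E) :=
      hu.map (ContinuousLinearMap.toLinearMapRingHom (R₁ := ℝ) (M₁ := E))
    exact (LinearMap.isUnit_iff_isUnit_det _ |>.1 h2).ne_zero
  by_contra hle
  push Not at hle
  have h0 : 0 < (c • ContinuousLinearMap.id ℝ E + (0:ℝ) • L).det := by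
    simp only [zero_smul, add_zero, ContinuousLinearMap.det, ContinuousLinearMap.toLinearMap_smul,
      LinearMap.det_smul]
    simp; positivity
  have h1 : (c • ContinuousLinearMap.id ℝ E + (1:ℝ) • L).det ≤ 0 := by simpa using hle
  obtain ⟨t, ht, hz⟩ := intermediate_value_Icc' (zero_le_one) hcont.continuousOn ⟨h1, h0.le⟩
  exact hne t ht hz

lemma exists_det_eq_sum (v : Fin (Module.finrank ℝ E + 1) → ℝ) (hv : Function.Injective v) :
    ∃ w : Fin (Module.finrank ℝ E + 1) → ℝ, ∀ L : E →L[ℝ] E,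
      L.det = ∑ j, w j * (v j • ContinuousLinearMap.id ℝ E + L).det := by
  classical
  refine ⟨fun j => (Lagrange.basis Finset.univ v j).eval 0, fun L => ?_⟩
  have heval : ∀ t : ℝ, (LinearMap.charpoly (-(L : E →ₗ[ℝ] E))).eval t
      = (t • ContinuousLinearMap.id ℝ E + L).det := by
    intro t
    rw [LinearMap.eval_charpoly, ContinuousLinearMap.det]
    congr 1
    ext x
    simp
  have hdeg : (LinearMap.charpoly (-(L : E →ₗ[ℝ] E))).degree <
      ((Finset.univ : Finset (Fin (Module.finrank ℝ E + 1))).card : WithBot ℕ) := by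
    refine Polynomial.degree_le_natDegree.trans_lt ?_
    rw [LinearMap.charpoly_natDegree]
    simp only [Finset.card_univ, Fintype.card_fin]
    exact_mod_cast Nat.lt_succ_self _
  have h := Lagrange.eq_interpolate (s := Finset.univ) hv.injOn hdeg
  have h0 := congrArg (Polynomial.eval (0:ℝ)) h
  rw [heval, Lagrange.interpolate_apply, Polynomial.eval_finsetSum] at h0
  simp only [zero_smul, zero_add] at h0
  rw [h0]
  refine Finset.sum_congr rfl fun j _ => ?_
  simp only [heval, Polynomial.eval_mul, Polynomial.eval_C]
  ring

lemma bijective_smul_add {A : E → E} {C : NNReal} (hA : LipschitzWith C A) {c : ℝ}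
    (hc : (C:ℝ) < c) : Function.Bijective fun x => c • x + A x := by
  have hc0 : 0 < c := C.coe_nonneg.trans_lt hc
  have : CompleteSpace E := FiniteDimensional.complete ℝ E
  constructor
  · intro x y hxy
    have h1 : c • (x - y) = A y - A x := by
      simp only at hxy
      rw [smul_sub, sub_eq_sub_iff_add_eq_add, hxy, add_comm]
    have h2 := hA.dist_le_mul y x
    rw [dist_eq_norm, dist_eq_norm, ← h1, norm_smul, Real.norm_eq_abs, abs_of_pos hc0,
      norm_sub_rev y x] at h2
    by_contra hne
    have : 0 < ‖x - y‖ := norm_pos_iff.2 (sub_ne_zero.2 hne)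
    nlinarith
  · intro y
    have hK : LipschitzWith (Real.toNNReal c⁻¹ * C) fun x => c⁻¹ • (y - A x) := by
      refine LipschitzWith.of_dist_le_mul fun x z => ?_
      rw [dist_eq_norm, ← smul_sub, norm_smul, Real.norm_eq_abs, abs_of_pos (inv_pos.2 hc0),
        sub_sub_sub_cancel_left, ← dist_eq_norm, dist_comm, NNReal.coe_mul,
        Real.coe_toNNReal _ (inv_pos.2 hc0).le, mul_assoc]
      exact mul_le_mul_of_nonneg_left (hA.dist_le_mul x z) (inv_pos.2 hc0).le
    have hcon : ContractingWith (Real.toNNReal c⁻¹ * C) fun x => c⁻¹ • (y - A x) := by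
      refine ⟨?_, hK⟩
      rw [← NNReal.coe_lt_coe, NNReal.coe_mul, NNReal.coe_one,
        Real.coe_toNNReal _ (inv_pos.2 hc0).le, inv_mul_lt_iff₀ hc0]
      simpa using hc
    have hfix := hcon.fixedPoint_isFixedPt
    refine ⟨hcon.fixedPoint, ?_⟩
    have h3 : hcon.fixedPoint = c⁻¹ • (y - A hcon.fixedPoint) := hfix.symm
    have h4 : c • hcon.fixedPoint = y - A hcon.fixedPoint := by
      conv_lhs => rw [h3]
      rw [smul_smul, mul_inv_cancel₀ hc0.ne', one_smul]
    simp only [h4, sub_add_cancel]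

variable [MeasurableSpace E] [BorelSpace E]

lemma setIntegral_det_smul_id_add {A : E → E} {C : NNReal} (hA : LipschitzWith C A)
    (hA1 : ContDiff ℝ 1 A) {c : ℝ} (hc : (C:ℝ) < c) (μ : Measure E) [μ.IsAddHaarMeasure] (K : ℝ) :
    ∫ x in Metric.closedBall (0:E) K, (c • ContinuousLinearMap.id ℝ E + fderiv ℝ A x).det ∂μ =
      μ.real ((fun x => c • x + A x) '' Metric.closedBall (0:E) K) := by
  have hder : ∀ x, HasFDerivAt (fun x => c • x + A x)
      (c • ContinuousLinearMap.id ℝ E + fderiv ℝ A x) x := fun x =>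
    ((hasFDerivAt_id x).const_smul c).add
      ((hA1.differentiable (by norm_num)) x).hasFDerivAt
  have h := integral_image_eq_integral_abs_det_fderiv_smul μ
    (measurableSet_closedBall (x := (0:E)) (ε := K))
    (fun x _ => (hder x).hasFDerivWithinAt) (bijective_smul_add hA hc).1.injOn (fun _ => (1:ℝ))
  simp only [smul_eq_mul, mul_one] at h
  rw [setIntegral_const, smul_eq_mul, mul_one] at h
  rw [h]
  refine integral_congr_ae (Eventually.of_forall fun x => ?_)
  exact (abs_of_pos (det_smul_id_add_pos
    ((norm_fderiv_le_of_lipschitz ℝ hA).trans_lt hc))).symm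

/-- The integral of the Jacobian determinant over a ball only depends on the values of the map
outside the ball. -/
lemma setIntegral_det_fderiv_congr {A B : E → E} {C D : NNReal} (hA : LipschitzWith C A)
    (hB : LipschitzWith D B) (hA1 : ContDiff ℝ 1 A) (hB1 : ContDiff ℝ 1 B) (μ : Measure E)
    [μ.IsAddHaarMeasure] (K : ℝ) (hAB : ∀ x ∉ Metric.closedBall (0:E) K, A x = B x) :
    ∫ x in Metric.closedBall (0:E) K, (fderiv ℝ A x).det ∂μ =
      ∫ x in Metric.closedBall (0:E) K, (fderiv ℝ B x).det ∂μ := by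
  let v : Fin (Module.finrank ℝ E + 1) → ℝ := fun j => C + D + 1 + (j : ℕ)
  have hv : Function.Injective v := fun i j h => by
    simp only [v, add_right_inj, Nat.cast_inj] at h
    exact Fin.ext h
  have hvC : ∀ j, (C:ℝ) < v j := fun j => by
    have := D.coe_nonneg; have : (0:ℝ) ≤ (j:ℕ) := Nat.cast_nonneg _; simp only [v]; linarith
  have hvD : ∀ j, (D:ℝ) < v j := fun j => by
    have := C.coe_nonneg; have : (0:ℝ) ≤ (j:ℕ) := Nat.cast_nonneg _; simp only [v]; linarith
  obtain ⟨w, hw⟩ := exists_det_eq_sum (E := E) v hv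
  have hint : ∀ G : E → E, ContDiff ℝ 1 G → ∀ j, IntegrableOn
      (fun x => w j * (v j • ContinuousLinearMap.id ℝ E + fderiv ℝ G x).det)
      (Metric.closedBall (0:E) K) μ := by
    intro G hG j
    have : Continuous (fderiv ℝ G) := hG.continuous_fderiv (by norm_num)
    have h2 : Continuous fun x => w j * (v j • ContinuousLinearMap.id ℝ E + fderiv ℝ G x).det :=
      continuous_const.mul (ContinuousLinearMap.continuous_det.comp (by fun_prop))
    have : ProperSpace E := FiniteDimensional.proper ℝ E
    exact h2.continuousOn.integrableOn_compact (isCompact_closedBall _ _)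
  have himg : ∀ j, (fun x => v j • x + A x) '' Metric.closedBall (0:E) K =
      (fun x => v j • x + B x) '' Metric.closedBall (0:E) K := by
    intro j
    have h1 := image_compl_eq (s := Metric.closedBall (0:E) K) (bijective_smul_add hA (hvC j))
    have h2 := image_compl_eq (s := Metric.closedBall (0:E) K) (bijective_smul_add hB (hvD j))
    rw [← compl_inj_iff, ← h1, ← h2]
    exact image_congr fun x hx => by rw [hAB x hx]
  rw [integral_congr_ae (ae_of_all _ fun x => hw (fderiv ℝ A x)),
    integral_congr_ae (ae_of_all _ fun x => hw (fderiv ℝ B x)),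
    integral_finsetSum _ fun j _ => hint A hA1 j, integral_finsetSum _ fun j _ => hint B hB1 j]
  refine Finset.sum_congr rfl fun j _ => ?_
  rw [integral_const_mul, integral_const_mul, setIntegral_det_smul_id_add hA hA1 (hvC j),
    setIntegral_det_smul_id_add hB hB1 (hvD j), himg]

/-- The primitive of the tent function `max 0 (1 - |y|)`. -/
def tentPrimitive (x : ℝ) : ℝ := ∫ y in (0:ℝ)..x, max 0 (1 - |y|)

lemma hasDerivAt_tentPrimitive (x : ℝ) : HasDerivAt tentPrimitive (max 0 (1 - |x|)) x := by
  have hc : Continuous fun y : ℝ => max 0 (1 - |y|) := by fun_prop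
  exact intervalIntegral.integral_hasDerivAt_right (hc.intervalIntegrable _ _)
    (hc.stronglyMeasurableAtFilter _ _) hc.continuousAt

lemma contDiff_tentPrimitive : ContDiff ℝ 1 tentPrimitive := by
  rw [contDiff_one_iff_deriv]
  refine ⟨fun x => (hasDerivAt_tentPrimitive x).differentiableAt, ?_⟩
  have : deriv tentPrimitive = fun x => max 0 (1 - |x|) :=
    funext fun x => (hasDerivAt_tentPrimitive x).deriv
  rw [this]
  fun_prop

lemma lipschitzWith_tentPrimitive : LipschitzWith 1 tentPrimitive := by
  refine lipschitzWith_of_nnnorm_deriv_le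
    (fun x => (hasDerivAt_tentPrimitive x).differentiableAt) fun x => ?_
  rw [(hasDerivAt_tentPrimitive x).deriv, ← NNReal.coe_le_coe, coe_nnnorm, Real.norm_eq_abs,
    abs_of_nonneg (le_max_left _ _)]
  simp

/-- The map acting on every coordinate by the rescaled `tentPrimitive`; its Jacobian determinant
is supported in the ball of radius `ε`. -/
def tentMap {n : ℕ} (ε : ℝ) (x : Fin n → ℝ) : Fin n → ℝ := fun i => tentPrimitive (ε⁻¹ * x i)

lemma contDiff_tentMap {n : ℕ} (ε : ℝ) : ContDiff ℝ 1 (tentMap (n := n) ε) :=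
  contDiff_pi.2 fun i => contDiff_tentPrimitive.comp (contDiff_const.mul (contDiff_apply ℝ ℝ i))

lemma lipschitzWith_tentMap {n : ℕ} {ε : ℝ} (hε : 0 < ε) :
    LipschitzWith (Real.toNNReal ε⁻¹) (tentMap (n := n) ε) := by
  refine LipschitzWith.of_dist_le_mul fun x y => ?_
  rw [Real.coe_toNNReal _ (inv_pos.2 hε).le]
  refine (dist_pi_le_iff (by positivity)).2 fun i => ?_
  refine (lipschitzWith_tentPrimitive.dist_le_mul _ _).trans ?_
  rw [NNReal.coe_one, one_mul, Real.dist_eq, ← mul_sub, abs_mul, abs_of_pos (inv_pos.2 hε),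
    ← Real.dist_eq]
  exact mul_le_mul_of_nonneg_left (dist_le_pi_dist x y i) (inv_pos.2 hε).le

lemma det_fderiv_tentMap {n : ℕ} (ε : ℝ) (x : Fin n → ℝ) :
    (fderiv ℝ (tentMap ε) x).det = ∏ i, (max 0 (1 - |ε⁻¹ * x i|) * ε⁻¹) := by
  have h : HasFDerivAt (tentMap (n := n) ε) (ContinuousLinearMap.pi fun i =>
      ((max 0 (1 - |ε⁻¹ * x i|) * ε⁻¹) • ContinuousLinearMap.id ℝ ℝ).comp
        (ContinuousLinearMap.proj (R := ℝ) (φ := fun _ : Fin n => ℝ) i)) x := by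
    rw [hasFDerivAt_pi]
    intro i
    have h1 : HasDerivAt (fun y : ℝ => tentPrimitive (ε⁻¹ * y))
        (max 0 (1 - |ε⁻¹ * x i|) * ε⁻¹) (x i) := by
      have := (hasDerivAt_tentPrimitive (ε⁻¹ * x i)).comp (x i)
        ((hasDerivAt_id (x i)).const_mul ε⁻¹)
      rw [mul_one] at this
      exact this
    have h2 := h1.hasFDerivAt.comp x
      (ContinuousLinearMap.proj (R := ℝ) (φ := fun _ : Fin n => ℝ) i).hasFDerivAt
    refine h2.congr_fderiv ?_
    congr 1
    ext
    simp
  rw [h.fderiv, ContinuousLinearMap.det]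
  have := LinearMap.det_pi (R := ℝ) (M := ℝ) (ι := Fin n)
    (fun i => (max 0 (1 - |ε⁻¹ * x i|) * ε⁻¹) • LinearMap.id)
  simp only [LinearMap.det_smul, Module.finrank_self, pow_one, LinearMap.det_id, mul_one] at this
  exact this

/-- **Brouwer's fixed point theorem** for maps into the unit cube. -/
theorem exists_fixedPoint_of_norm_le_one {n : ℕ} (F : (Fin n → ℝ) → Fin n → ℝ)
    (hF : Continuous F) (hF1 : ∀ x, ‖F x‖ ≤ 1) : ∃ x, F x = x := by
  by_contra! hne
  let χ : (Fin n → ℝ) → ℝ := fun x => min 1 (max 0 (2 - ‖x‖))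
  have hχ : Continuous χ := by fun_prop
  let G : (Fin n → ℝ) → Fin n → ℝ := fun x => χ x • F x
  have hG : Continuous G := hχ.smul hF
  have hG0 : ∀ x, 2 < ‖x‖ → G x = 0 := by
    intro x hx
    have : χ x = 0 := by simp only [χ]; rw [max_eq_left (by linarith)]; simp
    simp only [G, this, zero_smul]
  have hxG : ∀ x, x - G x ≠ 0 := by
    intro x hx
    have hx' : x = G x := sub_eq_zero.1 hx
    have hχ0 : 0 ≤ χ x := le_min zero_le_one (le_max_left _ _)
    have hχ1 : χ x ≤ 1 := min_le_left _ _
    have hn : ‖x‖ ≤ 1 := by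
      rw [hx', norm_smul, Real.norm_eq_abs, abs_of_nonneg hχ0]
      exact mul_le_one₀ hχ1 (norm_nonneg _) (hF1 x)
    have : χ x = 1 := by
      simp only [χ]; rw [max_eq_right (by linarith)]; exact min_eq_left (by linarith)
    simp only [G, this, one_smul] at hx'
    exact hne x hx'.symm
  obtain ⟨ε, hε, hεG⟩ : ∃ ε > 0, ∀ x, 2 * ε ≤ ‖x - G x‖ := by
    obtain ⟨x₀, -, hx₀⟩ := (isCompact_closedBall (0 : Fin n → ℝ) 2).exists_isMinOn
      ⟨0, by simp⟩ (f := fun x => ‖x - G x‖) (by fun_prop)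
    have hpos : 0 < ‖x₀ - G x₀‖ := norm_pos_iff.2 (hxG x₀)
    refine ⟨min (‖x₀ - G x₀‖ / 2) 1, lt_min (by linarith) one_pos, fun x => ?_⟩
    by_cases hx : ‖x‖ ≤ 2
    · have h1 : ‖x₀ - G x₀‖ ≤ ‖x - G x‖ := hx₀ (by simpa using hx)
      have := min_le_left (‖x₀ - G x₀‖ / 2) 1
      linarith
    · have h1 := hG0 x (by linarith)
      have := min_le_right (‖x₀ - G x₀‖ / 2) 1
      rw [h1, sub_zero]
      linarith
  obtain ⟨g, hg, hgG, hgs⟩ := hG.exists_contDiff_approx 1 (ε := fun _ => ε) continuous_const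
    fun _ => hε
  have hg0 : ∀ x, 2 < ‖x‖ → g x = 0 := by
    intro x hx
    by_contra h
    exact hgs (Function.mem_support.2 h) (hG0 x hx)
  have hgc : HasCompactSupport g := HasCompactSupport.intro (isCompact_closedBall 0 2)
    fun x hx => hg0 x (by simpa using hx)
  have hh : ∀ x, ε < ‖x - g x‖ := by
    intro x
    have h1 := hgG x
    rw [dist_eq_norm] at h1
    have h2 : ‖x - G x‖ ≤ ‖x - g x‖ + ‖g x - G x‖ := by
      simpa using norm_add_le (x - g x) (g x - G x)
    linarith [hεG x]
  obtain ⟨D, hD⟩ := hg.lipschitzWith_of_hasCompactSupport hgc (by norm_num)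
  have hh1 : ContDiff ℝ 1 fun x => x - g x := contDiff_id.sub hg
  have key := setIntegral_det_fderiv_congr
    ((lipschitzWith_tentMap hε).comp (LipschitzWith.id.sub hD)) (lipschitzWith_tentMap hε)
    ((contDiff_tentMap ε).comp hh1) (contDiff_tentMap (n := n) ε) volume 2
    (fun x hx => by simp [hg0 x (by simpa using hx)])
  have hzero : ∀ x, (fderiv ℝ (tentMap ε ∘ fun x => x - g x) x).det = 0 := by
    intro x
    rw [fderiv_comp x ((contDiff_tentMap ε).differentiable (by norm_num) _)
      (hh1.differentiable (by norm_num) _), ContinuousLinearMap.det,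
      ContinuousLinearMap.toLinearMap_comp, LinearMap.det_comp]
    refine mul_eq_zero_of_left ?_ _
    change (fderiv ℝ (tentMap ε) (x - g x)).det = 0
    rw [det_fderiv_tentMap]
    have : ∃ i, ε < |(x - g x) i| := by
      by_contra! hcon
      exact absurd ((pi_norm_le_iff_of_nonneg hε.le).2 hcon) (not_le.2 (hh x))
    obtain ⟨i, hi⟩ := this
    refine Finset.prod_eq_zero (Finset.mem_univ i) ?_
    rw [max_eq_left, zero_mul]
    rw [abs_mul, abs_of_pos (inv_pos.2 hε), sub_nonpos, ← div_eq_inv_mul, one_le_div hε]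
    exact hi.le
  have hpos : 0 < ∫ x in Metric.closedBall (0 : Fin n → ℝ) 2, (fderiv ℝ (tentMap ε) x).det := by
    simp_rw [det_fderiv_tentMap]
    have hcont : Continuous fun x : Fin n → ℝ => ∏ i, (max 0 (1 - |ε⁻¹ * x i|) * ε⁻¹) := by
      fun_prop
    have hnn : ∀ x : Fin n → ℝ, 0 ≤ ∏ i, (max 0 (1 - |ε⁻¹ * x i|) * ε⁻¹) := fun x =>
      Finset.prod_nonneg fun i _ => mul_nonneg (le_max_left _ _) (inv_pos.2 hε).le
    rw [setIntegral_pos_iff_support_of_nonneg_ae (ae_of_all _ hnn)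
      (hcont.continuousOn.integrableOn_compact (isCompact_closedBall _ _))]
    have hopen := hcont.isOpen_support.inter
      (Metric.isOpen_ball (x := (0 : Fin n → ℝ)) (ε := 2))
    refine (hopen.measure_pos volume ⟨0, ?_, by simp⟩).trans_le
      (measure_mono (inter_subset_inter_right _ Metric.ball_subset_closedBall))
    rw [Function.mem_support]
    simp [hε.ne', Finset.prod_const]
  rw [← key] at hpos
  simp [hzero] at hpos

/-- **Schauder's fixed point theorem** for continuous self-maps with relatively compact range. -/
theorem exists_fixedPoint_of_isCompact {X : Type*} [NormedAddCommGroup X] [NormedSpace ℝ X]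
    {Φ : X → X} (hΦ : Continuous Φ) {K : Set X} (hK : IsCompact K) (hΦK : ∀ x, Φ x ∈ K) :
    ∃ x, Φ x = x := by
  have happrox : ∀ ε > 0, ∃ x, ‖x - Φ x‖ ≤ ε := by
    intro ε hε
    obtain ⟨t, -, hfin, hcov⟩ := hK.finite_cover_balls hε
    obtain ⟨n, y, hy⟩ := hfin.fin_embedding
    let m : Fin n → X → ℝ := fun i x => max 0 (ε - ‖x - y i‖)
    have hm : ∀ i, Continuous (m i) := fun i => by fun_prop
    have hm0 : ∀ i x, 0 ≤ m i x := fun i x => le_max_left _ _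
    have hsum : ∀ x ∈ K, 0 < ∑ i, m i x := by
      intro x hx
      obtain ⟨z, hz, hxz⟩ := mem_iUnion₂.1 (hcov hx)
      rw [← hy] at hz
      obtain ⟨i, rfl⟩ := hz
      refine Finset.sum_pos' (fun i _ => hm0 i x) ⟨i, Finset.mem_univ _, ?_⟩
      rw [Metric.mem_ball, dist_eq_norm] at hxz
      exact lt_max_of_lt_right (by linarith)
    let F : (Fin n → ℝ) → Fin n → ℝ := fun w i =>
      m i (Φ (∑ j, w j • y j)) / ∑ k, m k (Φ (∑ j, w j • y j))
    have hF : Continuous F := by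
      refine continuous_pi fun i => Continuous.div ?_ ?_ fun w => (hsum _ (hΦK _)).ne'
      · exact (hm i).comp (hΦ.comp (by fun_prop))
      · exact continuous_finsetSum _ fun k _ => (hm k).comp (hΦ.comp (by fun_prop))
    have hF1 : ∀ w, ‖F w‖ ≤ 1 := by
      intro w
      refine (pi_norm_le_iff_of_nonneg zero_le_one).2 fun i => ?_
      rw [Real.norm_eq_abs, abs_of_nonneg (div_nonneg (hm0 _ _) (hsum _ (hΦK _)).le),
        div_le_one (hsum _ (hΦK _))]
      exact Finset.single_le_sum (fun k _ => hm0 k _) (Finset.mem_univ i)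
    obtain ⟨w, hw⟩ := exists_fixedPoint_of_norm_le_one F hF hF1
    set x := ∑ j, w j • y j with hx
    refine ⟨x, ?_⟩
    have hwi : ∀ i, w i = m i (Φ x) / ∑ k, m k (Φ x) := fun i => (congrFun hw i).symm
    have hS := hsum _ (hΦK x)
    have hw0 : ∀ i, 0 ≤ w i := fun i => by rw [hwi]; exact div_nonneg (hm0 _ _) hS.le
    have hw1 : ∑ i, w i = 1 := by
      simp_rw [hwi]; rw [← Finset.sum_div, div_self hS.ne']
    have hsub : x - Φ x = ∑ i, w i • (y i - Φ x) := by
      simp_rw [smul_sub]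
      rw [Finset.sum_sub_distrib, ← Finset.sum_smul, hw1, one_smul]
    rw [hsub]
    calc ‖∑ i, w i • (y i - Φ x)‖ ≤ ∑ i, ‖w i • (y i - Φ x)‖ := norm_sum_le _ _
      _ ≤ ∑ i, w i * ε := by
        refine Finset.sum_le_sum fun i _ => ?_
        rw [norm_smul, Real.norm_eq_abs, abs_of_nonneg (hw0 i)]
        by_cases hd : ‖Φ x - y i‖ ≤ ε
        · rw [norm_sub_rev]; exact mul_le_mul_of_nonneg_left hd (hw0 i)
        · have : w i = 0 := by
            rw [hwi]; simp only [m]; rw [max_eq_left (by linarith), zero_div]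
          simp [this]
      _ = ε := by rw [← Finset.sum_mul, hw1, one_mul]
  choose x hx using fun n : ℕ => happrox (1 / ((n:ℝ) + 1)) (by positivity)
  obtain ⟨z, -, k, hk, hlim⟩ := hK.tendsto_subseq fun n => hΦK (x n)
  have hd : Tendsto (fun n => x (k n) - Φ (x (k n))) atTop (nhds 0) :=
    squeeze_zero_norm (fun n => hx (k n))
      (tendsto_one_div_add_atTop_nhds_zero_nat.comp hk.tendsto_atTop)
  have hxz : Tendsto (fun n => x (k n)) atTop (nhds z) := by
    simpa using hd.add hlim
  exact ⟨z, tendsto_nhds_unique ((hΦ.tendsto z).comp hxz) hlim⟩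

end Brouwer

section Primitive

lemma intervalIntegrable_of_bounded {k : ℝ → ℝ} (hk : AEStronglyMeasurable k volume) {B : ℝ}
    (hB : ∀ t, |k t| ≤ B) (x y : ℝ) : IntervalIntegrable k volume x y :=
  (intervalIntegrable_const (c := B)).mono_fun hk.restrict
    (ae_of_all _ fun t => (hB t).trans (le_abs_self B))

lemma continuous_parametric_primitive {X : Type*} [TopologicalSpace X] [FirstCountableTopology X]
    {k : X → ℝ → ℝ} (hm : ∀ x, AEStronglyMeasurable (k x) volume)
    (hb : ∀ x₀, ∃ B : ℝ, ∀ᶠ x in nhds x₀, ∀ t, |k x t| ≤ B)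
    (hc : ∀ t, Continuous fun x => k x t) :
    Continuous fun p : X × ℝ => ∫ t in (0:ℝ)..p.2, k p.1 t := by
  rw [continuous_iff_continuousAt]
  rintro ⟨x₀, b₀⟩
  obtain ⟨B, hB⟩ := hb x₀
  exact intervalIntegral.continuousAt_parametric_primitive_of_dominated (fun _ => B)
    (-(|b₀| + 1)) (|b₀| + 1) (fun x => (hm x).restrict)
    (hB.mono fun x hx => ae_of_all _ hx) intervalIntegrable_const
    (ae_of_all _ fun t => (hc t).continuousAt)
    ⟨by linarith [abs_nonneg b₀], by linarith [abs_nonneg b₀]⟩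
    ⟨by linarith [neg_abs_le b₀], by linarith [le_abs_self b₀]⟩ (by simp)

lemma isCompact_lipschitz_continuousMap {Y : Type*} [PseudoMetricSpace Y] [CompactSpace Y]
    (M L : ℝ) : IsCompact {w : C(Y, ℝ) | (∀ t, |w t| ≤ M) ∧
      ∀ s t, |w s - w t| ≤ L * dist s t} := by
  refine ArzelaAscoli.isCompact_of_equicontinuous _ ?_ ?_
  · have himg : ContinuousMap.toFun '' {w : C(Y, ℝ) | (∀ t, |w t| ≤ M) ∧
        ∀ s t, |w s - w t| ≤ L * dist s t} =
        (univ.pi fun _ : Y => Icc (-M) M) ∩ {g | ∀ s t, |g s - g t| ≤ L * dist s t} := by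
      ext g
      constructor
      · rintro ⟨w, ⟨h1, h2⟩, rfl⟩
        exact ⟨fun t _ => abs_le.1 (h1 t), h2⟩
      · rintro ⟨h1, h2⟩
        have hg : LipschitzWith (Real.toNNReal L) g := LipschitzWith.of_dist_le_mul fun s t =>
          (h2 s t).trans (mul_le_mul_of_nonneg_right (Real.le_coe_toNNReal L) dist_nonneg)
        exact ⟨⟨g, hg.continuous⟩, ⟨fun t => abs_le.2 (h1 t (mem_univ t)), h2⟩, rfl⟩
    rw [himg]
    refine (isCompact_univ_pi fun _ => isCompact_Icc).inter_right ?_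
    simp only [ofPred_forall]
    refine isClosed_iInter fun s => isClosed_iInter fun t => isClosed_le ?_ continuous_const
    exact ((continuous_apply s).sub (continuous_apply t)).abs
  · intro x₀
    rw [Metric.equicontinuousAt_iff]
    intro ε hε
    refine ⟨ε / (|L| + 1), by positivity, fun x hx w => ?_⟩
    rw [dist_comm, Real.dist_eq, abs_sub_comm]
    refine (abs_sub_comm _ _).trans_le (w.2.2 _ _) |>.trans_lt ?_
    have h1 : dist x₀ x < ε / (|L| + 1) := by rw [dist_comm]; exact hx
    rw [lt_div_iff₀ (by positivity)] at h1
    have h2 := le_abs_self L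
    have h3 : 0 ≤ dist x₀ x := dist_nonneg
    rw [dist_comm]
    nlinarith

end Primitive

/-- The data of a periodic `φ`-Laplacian problem whose coefficients are bounded everywhere. -/
structure LienardData where
  T : ℝ
  φ : ℝ → ℝ
  ψ : ℝ → ℝ
  a : ℝ → ℝ
  e : ℝ → ℝ
  C : ℝ
  T_pos : 0 < T
  φ_mono : StrictMono φ
  φ_zero : φ 0 = 0
  φ_ψ : ∀ y, φ (ψ y) = y
  a_meas : Measurable a
  a_nonneg : ∀ t, 0 ≤ a t
  a_le : ∀ t, a t ≤ C
  e_meas : Measurable e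
  e_le : ∀ t, |e t| ≤ C
  e_mean : ∫ τ in (0:ℝ)..T, e τ = 0

namespace LienardData

variable (D : LienardData)

lemma C_nonneg : 0 ≤ D.C := (D.a_nonneg 0).trans (D.a_le 0)

lemma ψ_φ (x : ℝ) : D.ψ (D.φ x) = x := D.φ_mono.injective (D.φ_ψ _)

lemma ψ_mono : StrictMono D.ψ := fun x y h => by
  rw [← D.φ_mono.lt_iff_lt, D.φ_ψ, D.φ_ψ]; exact h

lemma ψ_cont : Continuous D.ψ :=
  D.ψ_mono.monotone.continuous_of_surjective fun x => ⟨D.φ x, D.ψ_φ x⟩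

lemma ψ_zero : D.ψ 0 = 0 := by simpa [D.φ_zero] using D.ψ_φ 0

/-- Continuous functions on `[0,T]`. -/
abbrev Space := C(Icc (0:ℝ) D.T, ℝ)

/-- The projection of `ℝ` onto `[0,T]`. -/
def pr (t : ℝ) : Icc (0:ℝ) D.T := projIcc 0 D.T D.T_pos.le t

/-- Extension to `ℝ` by constants. -/
def ext (u : D.Space) (t : ℝ) : ℝ := u (D.pr t)

lemma continuous_pr : Continuous D.pr :=
  continuous_projIcc (h := D.T_pos.le)

lemma pr_of_mem {t : ℝ} (ht : t ∈ Icc (0:ℝ) D.T) : D.pr t = ⟨t, ht⟩ := projIcc_of_mem _ ht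

lemma continuous_ext_uncurry : Continuous fun p : D.Space × ℝ => D.ext p.1 p.2 :=
  continuous_eval.comp (continuous_fst.prodMk (D.continuous_pr.comp continuous_snd))

lemma continuous_ext (u : D.Space) : Continuous (D.ext u) :=
  u.continuous.comp D.continuous_pr

lemma abs_ext_le (u : D.Space) (t : ℝ) : |D.ext u t| ≤ ‖u‖ := u.norm_coe_le_norm _

/-- The mean value over `[0,T]` of `a q(u)`. -/
def mean (q : ℝ → ℝ) (u : D.Space) : ℝ := (∫ τ in (0:ℝ)..D.T, D.a τ * q (D.ext u τ)) / D.T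

/-- The primitive of `s + e - a q(u)`, where `s` is the mean value of `a q(u)`. -/
def forcing (q : ℝ → ℝ) (u : D.Space) (t : ℝ) : ℝ :=
  ∫ τ in (0:ℝ)..t, (D.mean q u + D.e τ - D.a τ * q (D.ext u τ))

/-- The velocity `ψ (d - F(u) + ∫₀ᵗ (s + e - a q(u)))`, where `F` is the primitive of `f`. -/
def vel (f q : ℝ → ℝ) (d : ℝ) (u : D.Space) (t : ℝ) : ℝ :=
  D.ψ (d - (∫ y in (0:ℝ)..D.ext u t, f y) + D.forcing q u (D.pr t))

/-- The displacement obtained by integrating the velocity. -/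
def disp (f q : ℝ → ℝ) (d : ℝ) (u : D.Space) (t : ℝ) : ℝ := ∫ τ in (0:ℝ)..t, D.vel f q d u τ

/-- The integrated form of the periodic problem. -/
def IsCore (f q : ℝ → ℝ) (d : ℝ) (u : D.Space) : Prop :=
  (∀ t ∈ Icc (0:ℝ) D.T, D.ext u t = D.ext u 0 + D.disp f q d u t) ∧ D.disp f q d u D.T = 0

variable {D} {f q : ℝ → ℝ}

lemma aestronglyMeasurable_aq (hq : Continuous q) (u : D.Space) :
    AEStronglyMeasurable (fun τ => D.a τ * q (D.ext u τ)) volume :=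
  (D.a_meas.mul (hq.comp (D.continuous_ext u)).measurable).aestronglyMeasurable

lemma exists_bound_aq (hq : Continuous q) (u₀ : D.Space) :
    ∃ B : ℝ, ∀ᶠ u in nhds u₀, ∀ t, |D.a t * q (D.ext u t)| ≤ B := by
  obtain ⟨B, hB⟩ := (isCompact_Icc (a := -(‖u₀‖ + 1)) (b := ‖u₀‖ + 1)).exists_bound_of_continuousOn
    hq.continuousOn
  refine ⟨D.C * B, ?_⟩
  filter_upwards [Metric.ball_mem_nhds u₀ one_pos] with u hu t
  rw [abs_mul, abs_of_nonneg (D.a_nonneg t)]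
  have h1 : ‖u‖ ≤ ‖u₀‖ + 1 := by
    have := norm_le_norm_add_norm_sub' u u₀
    rw [Metric.mem_ball, dist_eq_norm] at hu
    linarith
  exact mul_le_mul (D.a_le t) (hB _ (abs_le.1 ((D.abs_ext_le u t).trans h1))) (abs_nonneg _)
    D.C_nonneg

lemma continuous_aq (hq : Continuous q) (t : ℝ) :
    Continuous fun u : D.Space => D.a t * q (D.ext u t) :=
  continuous_const.mul (hq.comp (continuous_eval_const (D.pr t)))

lemma continuous_mean (hq : Continuous q) : Continuous (D.mean q) := by
  have h := continuous_parametric_primitive (X := D.Space) (fun u => aestronglyMeasurable_aq hq u)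
    (exists_bound_aq hq) (continuous_aq hq)
  exact (h.comp (continuous_id.prodMk continuous_const)).div_const _

lemma aestronglyMeasurable_forcing_integrand (hq : Continuous q) (s : ℝ) (u : D.Space) :
    AEStronglyMeasurable (fun τ => s + D.e τ - D.a τ * q (D.ext u τ)) volume :=
  (aestronglyMeasurable_const.add D.e_meas.aestronglyMeasurable).sub (aestronglyMeasurable_aq hq u)

lemma exists_bound_forcing_integrand (hq : Continuous q) (u₀ : D.Space) :
    ∃ B : ℝ, ∀ᶠ u in nhds u₀, ∀ t, |D.mean q u + D.e t - D.a t * q (D.ext u t)| ≤ B := by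
  obtain ⟨B, hB⟩ := exists_bound_aq (D := D) hq u₀
  refine ⟨|D.mean q u₀| + 1 + D.C + B, ?_⟩
  have hm : ∀ᶠ u in nhds u₀, |D.mean q u| < |D.mean q u₀| + 1 :=
    (continuous_mean hq).abs.continuousAt.eventually_lt continuousAt_const (by simp)
  filter_upwards [hB, hm] with u h1 h2 t
  have h3 := abs_sub (D.mean q u + D.e t) (D.a t * q (D.ext u t))
  have h4 := abs_add_le (D.mean q u) (D.e t)
  linarith [h1 t, D.e_le t]

lemma continuous_forcing_uncurry (hq : Continuous q) :
    Continuous fun p : D.Space × ℝ => D.forcing q p.1 p.2 :=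
  continuous_parametric_primitive (X := D.Space)
    (fun u => aestronglyMeasurable_forcing_integrand hq _ u)
    (exists_bound_forcing_integrand hq)
    (fun t => ((continuous_mean hq).add continuous_const).sub (continuous_aq hq t))

lemma continuous_vel_uncurry (hf : Continuous f) (hq : Continuous q) :
    Continuous fun p : (ℝ × D.Space) × ℝ => D.vel f q p.1.1 p.1.2 p.2 := by
  refine D.ψ_cont.comp (((continuous_fst.comp continuous_fst).sub ?_).add ?_)
  · exact (intervalIntegral.continuous_primitive (fun _ _ => hf.intervalIntegrable _ _) 0).comp
      (D.continuous_ext_uncurry.comp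
        ((continuous_snd.comp continuous_fst).prodMk continuous_snd))
  · exact (continuous_forcing_uncurry hq).comp ((continuous_snd.comp continuous_fst).prodMk
      (continuous_subtype_val.comp (D.continuous_pr.comp continuous_snd)))

lemma continuous_vel (hf : Continuous f) (hq : Continuous q) (d : ℝ) (u : D.Space) :
    Continuous (D.vel f q d u) :=
  (continuous_vel_uncurry hf hq).comp (Continuous.prodMk_right (d, u))

lemma vel_pr (d : ℝ) (u : D.Space) (t : ℝ) : D.vel f q d u (D.pr t) = D.vel f q d u t := by
  have : D.pr (D.pr t) = D.pr t := projIcc_val _ _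
  simp only [vel, ext, this]

lemma continuous_disp_uncurry (hf : Continuous f) (hq : Continuous q) :
    Continuous fun p : (ℝ × D.Space) × ℝ => D.disp f q p.1.1 p.1.2 p.2 := by
  refine continuous_parametric_primitive (X := ℝ × D.Space)
    (fun p => (continuous_vel hf hq p.1 p.2).aestronglyMeasurable) (fun p₀ => ?_)
    (fun t => (continuous_vel_uncurry hf hq).comp (continuous_id.prodMk continuous_const))
  have hc : Continuous fun p : ℝ × D.Space =>
      sSup ((fun t : ℝ => |D.vel f q p.1 p.2 t|) '' Icc 0 D.T) :=
    isCompact_Icc.continuous_sSup (continuous_vel_uncurry hf hq).abs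
  refine ⟨sSup ((fun t : ℝ => |D.vel f q p₀.1 p₀.2 t|) '' Icc 0 D.T) + 1, ?_⟩
  filter_upwards [hc.continuousAt.eventually_lt continuousAt_const (lt_add_one _)] with p hp t
  refine le_trans ?_ hp.le
  rw [← vel_pr]
  exact le_csSup (isCompact_Icc.image (continuous_vel hf hq p.1 p.2).abs).bddAbove
    ⟨_, (D.pr t).2, rfl⟩

lemma hasDerivAt_disp (hf : Continuous f) (hq : Continuous q) (d : ℝ) (u : D.Space) (t : ℝ) :
    HasDerivAt (D.disp f q d u) (D.vel f q d u t) t :=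
  intervalIntegral.integral_hasDerivAt_right ((continuous_vel hf hq d u).intervalIntegrable _ _)
    ((continuous_vel hf hq d u).stronglyMeasurableAtFilter _ _)
    (continuous_vel hf hq d u).continuousAt

end LienardData

namespace IsC1Periodic

variable {T : ℝ} {u u' : ℝ → ℝ}

lemma continuousOn (h : IsC1Periodic T u u') : ContinuousOn u (Icc 0 T) :=
  fun t ht => (h.1 t ht).continuousWithinAt

lemma hasDerivAt (h : IsC1Periodic T u u') {t : ℝ} (ht : t ∈ Ioo 0 T) : HasDerivAt u (u' t) t :=
  (h.1 t (Ioo_subset_Icc_self ht)).hasDerivAt (Icc_mem_nhds ht.1 ht.2)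

lemma integral_comp_mul_deriv (h : IsC1Periodic T u u') {g : ℝ → ℝ} (hg : Continuous g) {t : ℝ}
    (ht : t ∈ Icc 0 T) : ∫ τ in (0:ℝ)..t, g (u τ) * u' τ = ∫ y in u 0..u t, g y := by
  have hsub : uIcc 0 t ⊆ Icc 0 T := by
    rw [uIcc_of_le ht.1]; exact Icc_subset_Icc_right ht.2
  refine intervalIntegral.integral_comp_mul_deriv'' (h.continuousOn.mono hsub) (fun x hx => ?_)
    (h.2.1.mono hsub) hg.continuousOn
  rw [min_eq_left ht.1, max_eq_right ht.1] at hx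
  exact (h.hasDerivAt ⟨hx.1, hx.2.trans_le ht.2⟩).hasDerivWithinAt

lemma integral_deriv (h : IsC1Periodic T u u') {t : ℝ} (ht : t ∈ Icc 0 T) :
    ∫ τ in (0:ℝ)..t, u' τ = u t - u 0 := by
  simpa using h.integral_comp_mul_deriv (g := fun _ => 1) continuous_const ht

end IsC1Periodic

namespace LienardData

variable {D : LienardData} {f q : ℝ → ℝ}

lemma zero_mem : (0:ℝ) ∈ Icc 0 D.T := ⟨le_rfl, D.T_pos.le⟩

lemma T_mem : D.T ∈ Icc 0 D.T := ⟨D.T_pos.le, le_rfl⟩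

lemma exists_bound_aq_self (hq : Continuous q) (u : D.Space) :
    ∃ B : ℝ, ∀ t, |D.a t * q (D.ext u t)| ≤ B :=
  (exists_bound_aq hq u).imp fun _ h => h.self_of_nhds

lemma intervalIntegrable_aq (hq : Continuous q) (u : D.Space) (x y : ℝ) :
    IntervalIntegrable (fun τ => D.a τ * q (D.ext u τ)) volume x y := by
  obtain ⟨B, hB⟩ := exists_bound_aq_self hq u
  exact intervalIntegrable_of_bounded (aestronglyMeasurable_aq hq u) hB x y

lemma intervalIntegrable_e (x y : ℝ) : IntervalIntegrable D.e volume x y :=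
  intervalIntegrable_of_bounded D.e_meas.aestronglyMeasurable D.e_le x y

lemma intervalIntegrable_a (x y : ℝ) : IntervalIntegrable D.a volume x y :=
  intervalIntegrable_of_bounded D.a_meas.aestronglyMeasurable
    (fun t => (abs_of_nonneg (D.a_nonneg t)).trans_le (D.a_le t)) x y

lemma intervalIntegrable_forcing_integrand (hq : Continuous q) (u : D.Space) (x y : ℝ) :
    IntervalIntegrable (fun τ => D.mean q u + D.e τ - D.a τ * q (D.ext u τ)) volume x y :=
  (intervalIntegrable_const.add (intervalIntegrable_e x y)).sub (intervalIntegrable_aq hq u x y)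

lemma mean_mul_T (q : ℝ → ℝ) (u : D.Space) :
    D.mean q u * D.T = ∫ τ in (0:ℝ)..D.T, D.a τ * q (D.ext u τ) :=
  div_mul_cancel₀ _ D.T_pos.ne'

lemma forcing_zero (u : D.Space) : D.forcing q u 0 = 0 := intervalIntegral.integral_same

lemma forcing_T (hq : Continuous q) (u : D.Space) : D.forcing q u D.T = 0 := by
  rw [forcing, intervalIntegral.integral_sub
    (intervalIntegrable_const.add (intervalIntegrable_e _ _)) (intervalIntegrable_aq hq u _ _),
    intervalIntegral.integral_add intervalIntegrable_const (intervalIntegrable_e _ _), D.e_mean,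
    ← mean_mul_T]
  simp [mul_comm]

lemma φ_vel (d : ℝ) (u : D.Space) {t : ℝ} (ht : t ∈ Icc 0 D.T) :
    D.φ (D.vel f q d u t) = d - (∫ y in (0:ℝ)..D.ext u t, f y) + D.forcing q u t := by
  rw [vel, D.φ_ψ, D.pr_of_mem ht]

namespace IsCore

variable {d : ℝ} {u : D.Space}

lemma isC1Periodic (hf : Continuous f) (hq : Continuous q) (h : D.IsCore f q d u) :
    IsC1Periodic D.T (D.ext u) (D.vel f q d u) := by
  have hu : D.ext u 0 = D.ext u D.T := by rw [h.1 _ T_mem, h.2, add_zero]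
  refine ⟨fun t ht => ?_, (continuous_vel hf hq d u).continuousOn, hu, ?_⟩
  · exact ((hasDerivAt_disp hf hq d u t).const_add (D.ext u 0)).hasDerivWithinAt.congr
      (fun x hx => h.1 x hx) (h.1 t ht)
  · apply D.φ_mono.injective
    rw [φ_vel d u zero_mem, φ_vel d u T_mem, hu, forcing_zero, forcing_T hq]

lemma isSolWE (hf : Continuous f) (hq : Continuous q) (h : D.IsCore f q d u) :
    IsSolWE D.T D.φ f q D.a D.e (D.mean q u) (D.ext u) := by
  have hper := h.isC1Periodic hf hq
  have hcont : Continuous fun t => f (D.ext u t) * D.vel f q d u t :=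
    (hf.comp (D.continuous_ext u)).mul (continuous_vel hf hq d u)
  refine ⟨_, fun t => D.mean q u + D.e t - D.a t * q (D.ext u t) -
    f (D.ext u t) * D.vel f q d u t, hper, ⟨?_, fun t ht => ?_⟩, ae_of_all _ fun t => by ring⟩
  · rw [← intervalIntegrable_iff_integrableOn_Icc_of_le D.T_pos.le]
    exact (intervalIntegrable_forcing_integrand hq u _ _).sub (hcont.intervalIntegrable _ _)
  · rw [intervalIntegral.integral_sub (intervalIntegrable_forcing_integrand hq u _ _)
      (hcont.intervalIntegrable _ _), hper.integral_comp_mul_deriv hf ht, φ_vel d u ht,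
      φ_vel d u zero_mem, forcing_zero, ← forcing]
    have := intervalIntegral.integral_interval_sub_left (hf.intervalIntegrable (μ := volume) 0
      (D.ext u t)) (hf.intervalIntegrable 0 (D.ext u 0))
    linarith

end IsCore

lemma exists_isCore_of_isSolWE (hf : Continuous f) (hq : Continuous q) {s : ℝ} {u : ℝ → ℝ}
    (h : IsSolWE D.T D.φ f q D.a D.e s u) :
    ∃ (U : D.Space) (d : ℝ), (∀ t ∈ Icc 0 D.T, D.ext U t = u t) ∧ D.IsCore f q d U ∧
      D.mean q U = s := by
  obtain ⟨u', w, hper, ⟨hwi, hw⟩, hae⟩ := h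
  let U : D.Space := ⟨(Icc 0 D.T).domRestrict u, hper.continuousOn.domRestrict⟩
  have hU : ∀ t ∈ Icc 0 D.T, D.ext U t = u t := fun t ht => by
    rw [ext, D.pr_of_mem ht]; rfl
  have hfc : ContinuousOn (fun t => f (u t) * u' t) (Icc 0 D.T) :=
    (hf.comp_continuousOn hper.continuousOn).mul hper.2.1
  have hwint : ∀ t ∈ Icc 0 D.T, ∫ τ in (0:ℝ)..t, w τ =
      (∫ τ in (0:ℝ)..t, (s + D.e τ - D.a τ * q (D.ext U τ))) - ∫ y in u 0..u t, f y := by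
    intro t ht
    have hsub : uIcc 0 t ⊆ Icc 0 D.T := by
      rw [uIcc_of_le ht.1]; exact Icc_subset_Icc_right ht.2
    rw [← hper.integral_comp_mul_deriv hf ht, ← intervalIntegral.integral_sub
      ((intervalIntegrable_const.add (intervalIntegrable_e _ _)).sub
        (intervalIntegrable_aq hq U _ _)) (hfc.mono hsub).intervalIntegrable]
    refine intervalIntegral.integral_congr_ae ?_
    rw [muT, ae_restrict_iff' measurableSet_Icc] at hae
    filter_upwards [hae] with τ hτ hmem
    have hτT := hsub (uIoc_subset_uIcc hmem)
    have := hτ hτT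
    rw [hU τ hτT]
    linarith
  have hmean : D.mean q U = s := by
    have h1 := hwint _ T_mem
    have h2 := hw _ T_mem
    rw [intervalIntegral.integral_sub
      (intervalIntegrable_const.add (intervalIntegrable_e _ _)) (intervalIntegrable_aq hq U _ _),
      intervalIntegral.integral_add intervalIntegrable_const (intervalIntegrable_e _ _), D.e_mean,
      ← mean_mul_T, ← hper.2.2.1, intervalIntegral.integral_same] at h1
    rw [← hper.2.2.2] at h2
    simp only [intervalIntegral.integral_const, smul_eq_mul] at h1
    have h3 : (D.mean q U - s) * D.T = 0 := by linarith
    have := (mul_eq_zero.1 h3).resolve_right D.T_pos.ne'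
    linarith
  refine ⟨U, D.φ (u' 0) + ∫ y in (0:ℝ)..u 0, f y, hU, ?_, hmean⟩
  have hvel : ∀ t ∈ Icc 0 D.T, D.vel f q (D.φ (u' 0) + ∫ y in (0:ℝ)..u 0, f y) U t = u' t := by
    intro t ht
    apply D.φ_mono.injective
    rw [φ_vel _ _ ht, hw t ht, hwint t ht, hU t ht, forcing, hmean]
    have := intervalIntegral.integral_interval_sub_left (hf.intervalIntegrable (μ := volume) 0
      (u t)) (hf.intervalIntegrable 0 (u 0))
    linarith
  have hdisp : ∀ t ∈ Icc 0 D.T,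
      D.disp f q (D.φ (u' 0) + ∫ y in (0:ℝ)..u 0, f y) U t = u t - u 0 := by
    intro t ht
    rw [← hper.integral_deriv ht, disp]
    refine intervalIntegral.integral_congr fun τ hτ => hvel τ ?_
    rw [uIcc_of_le ht.1] at hτ
    exact Icc_subset_Icc_right ht.2 hτ
  refine ⟨fun t ht => ?_, ?_⟩
  · rw [hdisp t ht, hU t ht, hU 0 zero_mem]; ring
  · rw [hdisp _ T_mem, hper.2.2.1, sub_self]

lemma mean_le (hq : Continuous q) (u : D.Space) {r : ℝ}
    (hr : ∀ t ∈ Icc 0 D.T, q (D.ext u t) ≤ r) :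
    D.mean q u ≤ (∫ τ in (0:ℝ)..D.T, D.a τ) / D.T * r := by
  rw [mean, div_mul_eq_mul_div, ← intervalIntegral.integral_mul_const]
  refine div_le_div_of_nonneg_right ?_ D.T_pos.le
  exact intervalIntegral.integral_mono_on D.T_pos.le (intervalIntegrable_aq hq u _ _)
    ((intervalIntegrable_a _ _).mul_const r)
    fun t ht => mul_le_mul_of_nonneg_left (hr t ht) (D.a_nonneg t)

lemma abs_forcing_le (hq : Continuous q) {Q s : ℝ} (hQ : 0 ≤ Q) (hqQ : ∀ x, q x ≤ Q) (u : D.Space)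
    (hs : s ≤ D.mean q u) {t : ℝ} (ht : t ∈ Icc 0 D.T) :
    |D.forcing q u t| ≤ (2 * |s| + 3 * (D.C * Q) + D.C) * D.T := by
  have hT := D.T_pos
  have haq : ∀ τ, D.a τ * q (D.ext u τ) ≤ D.C * Q := fun τ =>
    (mul_le_mul_of_nonneg_left (hqQ _) (D.a_nonneg τ)).trans
      (mul_le_mul_of_nonneg_right (D.a_le τ) hQ)
  have hCQ : 0 ≤ D.C * Q := mul_nonneg D.C_nonneg hQ
  have hm : D.mean q u ≤ D.C * Q := by
    rw [mean, div_le_iff₀ hT]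
    have := intervalIntegral.integral_mono_on hT.le (intervalIntegrable_aq hq u _ _)
      intervalIntegrable_const (fun τ _ => haq τ)
    simp only [intervalIntegral.integral_const, smul_eq_mul] at this
    linarith
  have habs : |D.mean q u| ≤ |s| + D.C * Q :=
    abs_le.2 ⟨by linarith [neg_abs_le s], by linarith [abs_nonneg s]⟩
  have hint := intervalIntegrable_forcing_integrand hq u 0 D.T
  have hint' := (intervalIntegrable_const (c := |s| + D.C * Q + D.C + 2 * (D.C * Q))
    (μ := volume) (a := 0) (b := D.T)).sub (intervalIntegrable_aq hq u 0 D.T)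
  have h1 : |D.forcing q u t| ≤
      ∫ τ in (0:ℝ)..D.T, |D.mean q u + D.e τ - D.a τ * q (D.ext u τ)| := by
    refine (intervalIntegral.abs_integral_le_integral_abs ht.1).trans ?_
    exact intervalIntegral.integral_mono_interval le_rfl ht.1 ht.2
      (ae_of_all _ fun _ => abs_nonneg _) hint.abs
  have h2 : ∫ τ in (0:ℝ)..D.T, |D.mean q u + D.e τ - D.a τ * q (D.ext u τ)| ≤
      ∫ τ in (0:ℝ)..D.T, ((|s| + D.C * Q + D.C + 2 * (D.C * Q)) - D.a τ * q (D.ext u τ)) := by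
    refine intervalIntegral.integral_mono_on hT.le hint.abs hint' fun τ _ => ?_
    have he := abs_le.1 (D.e_le τ)
    have hm' := abs_le.1 habs
    have hb := haq τ
    rw [abs_le]
    constructor <;> linarith
  rw [intervalIntegral.integral_sub intervalIntegrable_const (intervalIntegrable_aq hq u 0 D.T),
    ← mean_mul_T] at h2
  simp only [intervalIntegral.integral_const, smul_eq_mul] at h2
  have h3 : -|s| * D.T ≤ D.mean q u * D.T :=
    mul_le_mul_of_nonneg_right ((neg_abs_le s).trans hs) hT.le
  nlinarith

lemma exists_coercive (K : ℝ) (hK : 0 ≤ K) : ∃ c, ∀ x, K * |x| - c ≤ D.φ x * x := by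
  have h1 : 0 ≤ D.ψ K := by rw [← D.ψ_zero]; exact D.ψ_mono.monotone hK
  have h2 : D.ψ (-K) ≤ 0 := by rw [← D.ψ_zero]; exact D.ψ_mono.monotone (by linarith)
  refine ⟨K * (D.ψ K - D.ψ (-K)), fun x => ?_⟩
  rcases le_total 0 x with hx | hx
  · rw [abs_of_nonneg hx]
    have h0 : 0 ≤ D.φ x := by rw [← D.φ_zero]; exact D.φ_mono.monotone hx
    rcases le_total x (D.ψ K) with h | h
    · nlinarith [mul_nonneg h0 hx, mul_le_mul_of_nonneg_left h hK]
    · have := D.φ_mono.monotone h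
      rw [D.φ_ψ] at this
      nlinarith [mul_le_mul_of_nonneg_right this hx]
  · rw [abs_of_nonpos hx]
    have h0 : D.φ x ≤ 0 := by rw [← D.φ_zero]; exact D.φ_mono.monotone hx
    rcases le_total (D.ψ (-K)) x with h | h
    · nlinarith [mul_nonneg_of_nonpos_of_nonpos h0 hx, mul_le_mul_of_nonneg_left h hK]
    · have := D.φ_mono.monotone h
      rw [D.φ_ψ] at this
      nlinarith [mul_le_mul_of_nonpos_right this hx]

/-- Solutions whose mean forcing is bounded below have uniformly bounded oscillation. -/
lemma exists_oscillation_bound (D : LienardData) {Q : ℝ} (hQ : 0 ≤ Q) (s : ℝ) :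
    ∃ ρ : ℝ, ∀ f q : ℝ → ℝ, Continuous f → Continuous q → (∀ x, q x ≤ Q) →
      ∀ (d : ℝ) (u : D.Space), D.IsCore f q d u → s ≤ D.mean q u →
        ∀ t ∈ Icc 0 D.T, ∀ t' ∈ Icc 0 D.T, |D.ext u t - D.ext u t'| ≤ ρ := by
  set K := (2 * |s| + 3 * (D.C * Q) + D.C) * D.T with hK
  have hK0 : 0 ≤ K := mul_nonneg (by nlinarith [abs_nonneg s, mul_nonneg D.C_nonneg hQ,
    D.C_nonneg]) D.T_pos.le
  obtain ⟨c, hc⟩ := D.exists_coercive (K + 1) (by linarith)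
  refine ⟨D.T * c, fun f q hf hq hqQ d u h hs t ht t' ht' => ?_⟩
  have hper := h.isC1Periodic hf hq
  have hv := continuous_vel hf hq d u
  set v := D.vel f q d u with hvdef
  have hF : Continuous fun x => d - ∫ y in (0:ℝ)..x, f y :=
    continuous_const.sub (intervalIntegral.continuous_primitive
      (fun _ _ => hf.intervalIntegrable _ _) 0)
  have hzero : ∫ τ in (0:ℝ)..D.T, (d - ∫ y in (0:ℝ)..D.ext u τ, f y) * v τ = 0 := by
    rw [hper.integral_comp_mul_deriv hF T_mem, hper.2.2.1, intervalIntegral.integral_same]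
  have hFv : Continuous fun τ => (d - ∫ y in (0:ℝ)..D.ext u τ, f y) * v τ :=
    (hF.comp (D.continuous_ext u)).mul hv
  have hle : ∫ τ in (0:ℝ)..D.T, (|v τ| - c) ≤
      ∫ τ in (0:ℝ)..D.T, (d - ∫ y in (0:ℝ)..D.ext u τ, f y) * v τ := by
    refine intervalIntegral.integral_mono_on D.T_pos.le
      ((hv.abs.sub continuous_const).intervalIntegrable _ _) (hFv.intervalIntegrable _ _)
      fun τ hτ => ?_
    have h1 := hc (v τ)
    rw [hvdef, φ_vel d u hτ, ← hvdef] at h1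
    have h2 := abs_forcing_le hq hQ hqQ u hs hτ
    have h3 : D.forcing q u τ * v τ ≤ K * |v τ| :=
      (le_abs_self _).trans (by
        rw [abs_mul]; exact mul_le_mul_of_nonneg_right h2 (abs_nonneg _))
    nlinarith
  rw [hzero, intervalIntegral.integral_sub (hv.abs.intervalIntegrable _ _)
    intervalIntegrable_const] at hle
  simp only [intervalIntegral.integral_const, smul_eq_mul, sub_zero] at hle
  have hvi : ∀ x y, IntervalIntegrable v volume x y := fun x y => hv.intervalIntegrable x y
  have hdiff : D.ext u t - D.ext u t' = ∫ τ in t'..t, v τ := by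
    rw [← intervalIntegral.integral_interval_sub_left (hvi 0 t) (hvi 0 t'),
      hper.integral_deriv ht, hper.integral_deriv ht']
    ring
  rw [hdiff]
  have h4 := intervalIntegral.norm_integral_le_abs_integral_norm (f := v) (a := t') (b := t)
    (μ := volume)
  have h5 : |∫ τ in t'..t, ‖v τ‖| ≤ |∫ τ in (0:ℝ)..D.T, ‖v τ‖| := by
    refine intervalIntegral.abs_integral_mono_interval ?_ (ae_of_all _ fun _ => norm_nonneg _)
      (hvi _ _).norm
    rw [uIoc_of_le D.T_pos.le]
    exact Ioc_subset_Ioc (le_min ht'.1 ht.1) (max_le ht'.2 ht.2)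
  have h6 : |∫ τ in (0:ℝ)..D.T, ‖v τ‖| = ∫ τ in (0:ℝ)..D.T, |v τ| :=
    abs_of_nonneg (intervalIntegral.integral_nonneg D.T_pos.le fun _ _ => norm_nonneg _)
  rw [Real.norm_eq_abs] at h4
  linarith

end LienardData

section Touching

variable {T : ℝ} {α α' u u' : ℝ → ℝ}

/-- Periodic `C¹` functions have the same derivative where they touch. -/
lemma IsC1Periodic.deriv_eq_of_touching (hα : IsC1Periodic T α α') (hu : IsC1Periodic T u u')
    (hT : 0 < T) (hle : ∀ t ∈ Icc 0 T, α t ≤ u t) {t₀ : ℝ} (ht₀ : t₀ ∈ Icc 0 T)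
    (heq : α t₀ = u t₀) : α' t₀ = u' t₀ := by
  have key : ∀ t ∈ Icc 0 T, α t = u t → ∀ x ∈ Icc 0 T, 0 ≤ (x - t) * (u' t - α' t) := by
    intro t ht h x hx
    have hmin : IsMinOn (fun y => u y - α y) (Icc 0 T) t := fun y hy => by
      have := hle y hy
      simp only [mem_ofPred_eq]
      linarith
    have := hmin.localize.hasFDerivWithinAt_nonneg ((hu.1 t ht).sub (hα.1 t ht)).hasFDerivWithinAt
      (sub_mem_posTangentConeAt_of_segment_subset ((convex_Icc 0 T).segment_subset ht hx))
    simpa using this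
  have h0 : (0:ℝ) ∈ Icc 0 T := ⟨le_rfl, hT.le⟩
  have h1 : T ∈ Icc 0 T := ⟨hT.le, le_rfl⟩
  have hends : α 0 = u 0 → α' 0 = u' 0 := by
    intro h
    have k1 := key 0 h0 h T h1
    have k2 := key T h1 (by rw [← hα.2.2.1, ← hu.2.2.1, h]) 0 h0
    rw [← hα.2.2.2, ← hu.2.2.2] at k2
    nlinarith
  rcases eq_or_lt_of_le ht₀.1 with h | h
  · subst h; exact hends heq
  rcases eq_or_lt_of_le ht₀.2 with h' | h'
  · subst h'
    rw [← hα.2.2.2, ← hu.2.2.2]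
    exact hends (by rw [hα.2.2.1, hu.2.2.1, heq])
  have k1 := key t₀ ht₀ heq 0 h0
  have k2 := key t₀ ht₀ heq T h1
  nlinarith

variable {φ f q a e w w' : ℝ → ℝ} {s s' C : ℝ}

/-- A strict lower solution cannot touch a solution from below. -/
lemma not_touching_of_lt (hT : 0 < T) (hφ : StrictMono φ) (hf : Continuous f) (hq : Continuous q)
    (ha : ∀ t, |a t| ≤ C)
    (hα : IsC1Periodic T α α') (hw : IsACPhiDeriv T φ α' w)
    (hlow : ∀ᵐ t ∂(muT T), s + e t ≤ w t + f (α t) * α' t + a t * q (α t))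
    (hu : IsC1Periodic T u u') (hw' : IsACPhiDeriv T φ u' w')
    (hsol : ∀ᵐ t ∂(muT T), w' t + f (u t) * u' t + a t * q (u t) = s' + e t)
    (hs : s' < s) (hle : ∀ t ∈ Icc 0 T, α t ≤ u t) : ∀ t ∈ Icc 0 T, α t ≠ u t := by
  suffices h : ∀ t ∈ Ico 0 T, α t ≠ u t by
    intro t ht
    rcases eq_or_lt_of_le ht.2 with h' | h'
    · subst h'
      rw [← hα.2.2.1, ← hu.2.2.1]
      exact h 0 ⟨le_rfl, hT⟩
    · exact h t ⟨ht.1, h'⟩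
  intro t₀ ht₀ heq
  have ht₀' := Ico_subset_Icc_self ht₀
  have hder := hα.deriv_eq_of_touching hu hT hle ht₀' heq
  have hC : 0 ≤ C := (abs_nonneg _).trans (ha 0)
  have hcont : ContinuousOn (fun t => f (α t) * α' t - f (u t) * u' t + C * |q (α t) - q (u t)|)
      (Icc 0 T) :=
    (((hf.comp_continuousOn hα.continuousOn).mul hα.2.1).sub
      ((hf.comp_continuousOn hu.continuousOn).mul hu.2.1)).add
      (continuousOn_const.mul ((hq.comp_continuousOn hα.continuousOn).sub
        (hq.comp_continuousOn hu.continuousOn)).abs)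
  have hev := (hcont t₀ ht₀').eventually_lt continuousWithinAt_const
    (show f (α t₀) * α' t₀ - f (u t₀) * u' t₀ + C * |q (α t₀) - q (u t₀)| < (s - s') / 2 by
      rw [heq, hder]; simpa using hs)
  obtain ⟨δ, hδ, hball⟩ := Metric.mem_nhdsWithin_iff.1 hev
  set b := min T (t₀ + δ / 2) with hb
  have htb : t₀ < b := lt_min ht₀.2 (by linarith)
  have hbT : b ≤ T := min_le_left _ _
  have hIcc : Icc t₀ b ⊆ Icc 0 T := Icc_subset_Icc ht₀.1 hbT
  have hsmall : ∀ t ∈ Icc t₀ b,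
      f (α t) * α' t - f (u t) * u' t + C * |q (α t) - q (u t)| < (s - s') / 2 := by
    intro t ht
    refine hball ⟨?_, hIcc ht⟩
    rw [Metric.mem_ball, Real.dist_eq, abs_of_nonneg (by linarith [ht.1])]
    have := ht.2.trans (min_le_right _ _)
    linarith
  have hneg : ∀ t ∈ Ioc t₀ b, u' t - α' t < 0 := by
    intro t ht
    have htT : t ∈ Icc 0 T := hIcc ⟨ht.1.le, ht.2⟩
    have hi : ∀ {g : ℝ → ℝ}, IntegrableOn g (Icc 0 T) → ∀ x ∈ Icc 0 T, ∀ y ∈ Icc 0 T,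
        IntervalIntegrable g volume x y := by
      intro g hg x hx y hy
      rw [← intervalIntegrable_iff_integrableOn_Icc_of_le hT.le] at hg
      refine hg.mono_set ?_
      rw [uIcc_of_le hT.le]
      exact uIcc_subset_Icc hx hy
    have h0 : (0:ℝ) ∈ Icc 0 T := ⟨le_rfl, hT.le⟩
    have e1 := intervalIntegral.integral_interval_sub_left (hi hw.1 0 h0 t htT)
      (hi hw.1 0 h0 t₀ ht₀')
    have e2 := intervalIntegral.integral_interval_sub_left (hi hw'.1 0 h0 t htT)
      (hi hw'.1 0 h0 t₀ ht₀')
    have hmono : ∫ τ in t₀..t, w' τ ≤ ∫ τ in t₀..t, (w τ - (s - s') / 2) := by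
      refine intervalIntegral.integral_mono_ae_restrict ht.1.le (hi hw'.1 _ ht₀' _ htT)
        ((hi hw.1 _ ht₀' _ htT).sub intervalIntegrable_const) ?_
      have hsub : Icc t₀ t ⊆ Icc 0 T := Icc_subset_Icc ht₀.1 htT.2
      have hlow' := ae_restrict_of_ae_restrict_of_subset hsub hlow
      have hsol' := ae_restrict_of_ae_restrict_of_subset hsub hsol
      filter_upwards [hlow', hsol', ae_restrict_mem measurableSet_Icc] with τ k1 k2 k3
      have k4 := hsmall τ ⟨k3.1, k3.2.trans ht.2⟩
      have k5 : a τ * q (α τ) - a τ * q (u τ) ≤ C * |q (α τ) - q (u τ)| := by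
        rw [← mul_sub]
        exact (le_abs_self _).trans (by
          rw [abs_mul]; exact mul_le_mul_of_nonneg_right (ha τ) (abs_nonneg _))
      linarith
    rw [intervalIntegral.integral_sub (hi hw.1 _ ht₀' _ htT) intervalIntegrable_const] at hmono
    simp only [intervalIntegral.integral_const, smul_eq_mul] at hmono
    have hpos : 0 < (t - t₀) * ((s - s') / 2) :=
      mul_pos (by linarith [ht.1]) (by linarith)
    have p1 := hw.2 t htT
    have p2 := hw'.2 t htT
    have p3 := hw.2 t₀ ht₀'
    have p4 := hw'.2 t₀ ht₀'
    rw [hder] at p3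
    have : φ (u' t) < φ (α' t) := by linarith
    linarith [hφ.lt_iff_lt.1 this]
  have hanti : StrictAntiOn (fun t => u t - α t) (Icc t₀ b) := by
    refine strictAntiOn_of_hasDerivWithinAt_neg (convex_Icc _ _)
      ((hu.continuousOn.sub hα.continuousOn).mono hIcc) (f' := fun t => u' t - α' t)
      (fun x hx => ?_) fun x hx => ?_
    · rw [interior_Icc] at hx ⊢
      have hx' : x ∈ Ioo 0 T := ⟨ht₀.1.trans_lt hx.1, hx.2.trans_le hbT⟩
      exact ((hu.hasDerivAt hx').sub (hα.hasDerivAt hx')).hasDerivWithinAt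
    · rw [interior_Icc] at hx
      exact hneg x ⟨hx.1, hx.2.le⟩
  have := hanti (left_mem_Icc.2 htb.le) (right_mem_Icc.2 htb.le) htb
  have := hle b (hIcc (right_mem_Icc.2 htb.le))
  simp only at *
  linarith

end Touching

namespace LienardData

variable {D : LienardData} {f q : ℝ → ℝ}

lemma abs_mean_le {b : ℝ} (hqb : ∀ x, |q x| ≤ b) (u : D.Space) :
    |D.mean q u| ≤ D.C * b := by
  have h : ‖∫ τ in (0:ℝ)..D.T, D.a τ * q (D.ext u τ)‖ ≤ D.C * b * |D.T - 0| := by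
    refine intervalIntegral.norm_integral_le_of_norm_le_const fun τ _ => ?_
    rw [Real.norm_eq_abs, abs_mul, abs_of_nonneg (D.a_nonneg τ)]
    exact mul_le_mul (D.a_le τ) (hqb _) (abs_nonneg _) D.C_nonneg
  rw [mean, abs_div, abs_of_pos D.T_pos, div_le_iff₀ D.T_pos]
  simpa [abs_of_pos D.T_pos] using h

lemma abs_forcing_le_of_bounded {b : ℝ} (hqb : ∀ x, |q x| ≤ b) (u : D.Space) {t : ℝ}
    (ht : t ∈ Icc 0 D.T) : |D.forcing q u t| ≤ (2 * (D.C * b) + D.C) * D.T := by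
  have hb : 0 ≤ b := (abs_nonneg _).trans (hqb 0)
  have h : ‖D.forcing q u t‖ ≤ (2 * (D.C * b) + D.C) * |t - 0| := by
    refine intervalIntegral.norm_integral_le_of_norm_le_const fun τ _ => ?_
    have h1 : |D.a τ * q (D.ext u τ)| ≤ D.C * b := by
      rw [abs_mul, abs_of_nonneg (D.a_nonneg τ)]
      exact mul_le_mul (D.a_le τ) (hqb _) (abs_nonneg _) D.C_nonneg
    have h2 := abs_le.1 (abs_mean_le hqb u)
    have h3 := abs_le.1 (D.e_le τ)
    have h4 := abs_le.1 h1
    rw [Real.norm_eq_abs, abs_le]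
    constructor <;> linarith
  rw [sub_zero, abs_of_nonneg ht.1] at h
  refine h.trans (mul_le_mul_of_nonneg_left ht.2 ?_)
  have := D.C_nonneg
  positivity

lemma abs_vel_argument_le {b c : ℝ} (hqb : ∀ x, |q x| ≤ b)
    (hfc : ∀ x, |∫ y in (0:ℝ)..x, f y| ≤ c) (u : D.Space) (t : ℝ) :
    |-(∫ y in (0:ℝ)..D.ext u t, f y) + D.forcing q u (D.pr t)| ≤
      c + (2 * (D.C * b) + D.C) * D.T := by
  have h1 := abs_le.1 (hfc (D.ext u t))
  have h2 := abs_le.1 (abs_forcing_le_of_bounded hqb u (D.pr t).2)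
  rw [abs_le]
  constructor <;> linarith

lemma exists_vel_bound {b c : ℝ} (hqb : ∀ x, |q x| ≤ b)
    (hfc : ∀ x, |∫ y in (0:ℝ)..x, f y| ≤ c) (B : ℝ) :
    ∃ V, 0 ≤ V ∧ ∀ d, |d| ≤ B → ∀ (u : D.Space) (t : ℝ), |D.vel f q d u t| ≤ V := by
  set E := B + (c + (2 * (D.C * b) + D.C) * D.T)
  refine ⟨max |D.ψ E| |D.ψ (-E)|, le_max_of_le_left (abs_nonneg _), fun d hd u t => ?_⟩
  have h1 := abs_le.1 (D.abs_vel_argument_le hqb hfc u t)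
  have h2 := abs_le.1 hd
  have hu : D.vel f q d u t ≤ D.ψ E := D.ψ_mono.monotone (by simp only [E]; linarith)
  have hl : D.ψ (-E) ≤ D.vel f q d u t := D.ψ_mono.monotone (by simp only [E]; linarith)
  rw [abs_le]
  exact ⟨by linarith [neg_abs_le (D.ψ (-E)), le_max_right |D.ψ E| |D.ψ (-E)|],
    by linarith [le_abs_self (D.ψ E), le_max_left |D.ψ E| |D.ψ (-E)|]⟩

lemma abs_disp_sub_le (hf : Continuous f) (hq : Continuous q) {d V : ℝ} {u : D.Space}
    (hV : ∀ t, |D.vel f q d u t| ≤ V) (x y : ℝ) :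
    |D.disp f q d u x - D.disp f q d u y| ≤ V * |x - y| := by
  rw [disp, disp, intervalIntegral.integral_interval_sub_left
    ((continuous_vel hf hq d u).intervalIntegrable _ _)
    ((continuous_vel hf hq d u).intervalIntegrable _ _)]
  exact intervalIntegral.norm_integral_le_of_norm_le_const (f := D.vel f q d u) fun τ _ => hV τ

lemma disp_zero (d : ℝ) (u : D.Space) : D.disp f q d u 0 = 0 := intervalIntegral.integral_same

lemma disp_T_pos (hf : Continuous f) (hq : Continuous q) {b c : ℝ} (hqb : ∀ x, |q x| ≤ b)
    (hfc : ∀ x, |∫ y in (0:ℝ)..x, f y| ≤ c) {d : ℝ} (u : D.Space)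
    (hd : c + (2 * (D.C * b) + D.C) * D.T < d) : 0 < D.disp f q d u D.T := by
  refine intervalIntegral.intervalIntegral_pos_of_pos
    ((continuous_vel hf hq d u).intervalIntegrable _ _) (fun t => ?_) D.T_pos
  rw [← D.ψ_zero]
  have := abs_le.1 (D.abs_vel_argument_le hqb hfc u t)
  exact D.ψ_mono (by linarith)

lemma disp_T_neg (hf : Continuous f) (hq : Continuous q) {b c : ℝ} (hqb : ∀ x, |q x| ≤ b)
    (hfc : ∀ x, |∫ y in (0:ℝ)..x, f y| ≤ c) {d : ℝ} (u : D.Space)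
    (hd : d < -(c + (2 * (D.C * b) + D.C) * D.T)) : D.disp f q d u D.T < 0 := by
  have : 0 < ∫ τ in (0:ℝ)..D.T, -D.vel f q d u τ := by
    refine intervalIntegral.intervalIntegral_pos_of_pos
      ((continuous_vel hf hq d u).neg.intervalIntegrable _ _) (fun t => ?_) D.T_pos
    have := abs_le.1 (D.abs_vel_argument_le hqb hfc u t)
    have h : D.vel f q d u t < 0 := by
      rw [← D.ψ_zero]
      exact D.ψ_mono (by linarith)
    linarith
  rw [intervalIntegral.integral_neg] at this
  exact neg_pos.1 this

lemma ext_coe (u : D.Space) (t : Icc 0 D.T) : D.ext u t = u t := by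
  rw [ext, D.pr_of_mem t.2]

/-- The least value of `disp - α` over `[0,T]`. -/
def gap (f q : ℝ → ℝ) (α : D.Space) (p : ℝ × D.Space) : ℝ :=
  sInf ((fun t : ℝ => D.disp f q p.1 p.2 t - D.ext α t) '' Icc 0 D.T)

lemma continuous_gap (hf : Continuous f) (hq : Continuous q) (α : D.Space) :
    Continuous (gap f q α) :=
  isCompact_Icc.continuous_sInf (f := fun (p : ℝ × D.Space) (t : ℝ) =>
    D.disp f q p.1 p.2 t - D.ext α t)
    ((continuous_disp_uncurry hf hq).sub ((D.continuous_ext α).comp continuous_snd))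

lemma exists_gap_eq (hf : Continuous f) (hq : Continuous q) (α : D.Space) (p : ℝ × D.Space) :
    ∃ t₀ ∈ Icc 0 D.T, gap f q α p = D.disp f q p.1 p.2 t₀ - D.ext α t₀ ∧
      ∀ t ∈ Icc 0 D.T, D.disp f q p.1 p.2 t₀ - D.ext α t₀ ≤ D.disp f q p.1 p.2 t - D.ext α t :=
  isCompact_Icc.exists_sInf_image_eq_and_le ⟨0, zero_mem⟩
    (((continuous_disp_uncurry hf hq).comp (Continuous.prodMk_right p)).sub
      (D.continuous_ext α)).continuousOn

/-- The displacement, shifted so that it lies above `α + c` and touches it. -/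
def lift (hf : Continuous f) (hq : Continuous q) (α : D.Space) (c d : ℝ) (u : D.Space) : D.Space :=
  ⟨fun t => D.disp f q d u t - gap f q α (d, u) + c,
    (((continuous_disp_uncurry hf hq).comp ((Continuous.prodMk_right (d, u)).comp
      continuous_subtype_val)).sub continuous_const).add continuous_const⟩

lemma continuous_lift (hf : Continuous f) (hq : Continuous q) (α : D.Space) :
    Continuous fun p : ℝ × ℝ × D.Space => lift hf hq α p.1 p.2.1 p.2.2 := by
  refine ContinuousMap.continuous_of_continuous_uncurry _ ?_
  have h1 : Continuous fun p : (ℝ × ℝ × D.Space) × Icc 0 D.T => p.1.2 :=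
    continuous_snd.comp continuous_fst
  exact (((continuous_disp_uncurry hf hq).comp
    (h1.prodMk (continuous_subtype_val.comp continuous_snd))).sub
    ((continuous_gap hf hq α).comp h1)).add (continuous_fst.comp continuous_fst)

lemma exists_lift_touching (hf : Continuous f) (hq : Continuous q) (α : D.Space) (c d : ℝ)
    (u : D.Space) :
    (∀ t ∈ Icc 0 D.T, D.ext α t + c ≤ D.ext (lift hf hq α c d u) t) ∧
      ∃ t ∈ Icc 0 D.T, D.ext α t + c = D.ext (lift hf hq α c d u) t := by
  obtain ⟨t₀, ht₀, h1, h2⟩ := exists_gap_eq hf hq α (d, u)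
  have hlift : ∀ t ∈ Icc 0 D.T, D.ext (lift hf hq α c d u) t =
      D.disp f q d u t - gap f q α (d, u) + c := fun t ht => by
    rw [ext, D.pr_of_mem ht]; rfl
  refine ⟨fun t ht => ?_, t₀, ht₀, ?_⟩
  · rw [hlift t ht, h1]
    have := h2 t ht
    simp only at this ⊢
    linarith
  · rw [hlift t₀ ht₀, h1]
    ring

/-- For bounded nonlinearities, the periodic problem has a solution which touches `α + σ κ` from
above for some `κ ∈ [0, R]`, with prescribed mean `s` unless `κ` is an endpoint. -/
lemma exists_isCore_touching (hf : Continuous f) (hq : Continuous q) {b c : ℝ}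
    (hqb : ∀ x, |q x| ≤ b) (hfc : ∀ x, |∫ y in (0:ℝ)..x, f y| ≤ c) (α : D.Space) {R : ℝ}
    (hR : 0 ≤ R) (σ s : ℝ) :
    ∃ (κ d : ℝ) (u : D.Space), κ ∈ Icc 0 R ∧ D.IsCore f q d u ∧
      (∀ t ∈ Icc 0 D.T, D.ext α t + σ * κ ≤ D.ext u t) ∧
      (∃ t ∈ Icc 0 D.T, D.ext α t + σ * κ = D.ext u t) ∧
      (κ < R → D.mean q u ≤ s) ∧ (0 < κ → s ≤ D.mean q u) := by
  have hb : 0 ≤ b := (abs_nonneg _).trans (hqb 0)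
  have hc : 0 ≤ c := (abs_nonneg _).trans (hfc 0)
  have hC := D.C_nonneg
  have hT := D.T_pos
  set B := c + (2 * (D.C * b) + D.C) * D.T + 1 with hB
  have hB0 : 0 ≤ B := by positivity
  obtain ⟨V, hV0, hV⟩ := D.exists_vel_bound hqb hfc B
  let cR : ℝ → ℝ := fun x => max 0 (min R x)
  let cB : ℝ → ℝ := fun x => max (-B) (min B x)
  have hcR : ∀ x, cR x ∈ Icc 0 R := fun x => ⟨le_max_left _ _, max_le hR (min_le_left _ _)⟩
  have hcB : ∀ x, cB x ∈ Icc (-B) B := fun x =>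
    ⟨le_max_left _ _, max_le (by linarith) (min_le_left _ _)⟩
  have hcRc : Continuous cR := continuous_const.max (continuous_const.min continuous_id)
  have hcBc : Continuous cB := continuous_const.max (continuous_const.min continuous_id)
  let Φ : ℝ × ℝ × D.Space → ℝ × ℝ × D.Space := fun p =>
    (cR (p.1 + D.mean q p.2.2 - s), cB (p.2.1 - D.disp f q (cB p.2.1) p.2.2 D.T),
      lift hf hq α (σ * cR p.1) (cB p.2.1) p.2.2)
  have hd : Continuous fun p : ℝ × ℝ × D.Space => p.2.1 := continuous_fst.comp continuous_snd
  have hu : Continuous fun p : ℝ × ℝ × D.Space => p.2.2 := continuous_snd.comp continuous_snd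
  have hΦ : Continuous Φ := by
    refine (hcRc.comp ((continuous_fst.add ((continuous_mean hq).comp hu)).sub
      continuous_const)).prodMk ((hcBc.comp (hd.sub ?_)).prodMk ?_)
    · exact (continuous_disp_uncurry hf hq).comp
        (((hcBc.comp hd).prodMk hu).prodMk continuous_const)
    · exact (continuous_lift hf hq α).comp
        ((continuous_const.mul (hcRc.comp continuous_fst)).prodMk ((hcBc.comp hd).prodMk hu))
  obtain ⟨⟨κ, d, u⟩, hfix⟩ := exists_fixedPoint_of_isCompact hΦ
    ((isCompact_Icc (a := 0) (b := R)).prod ((isCompact_Icc (a := -B) (b := B)).prod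
      (isCompact_lipschitz_continuousMap (Y := Icc 0 D.T)
        (2 * (V * D.T) + ‖α‖ + |σ| * R) V))) (by
    rintro ⟨κ, d, u⟩
    refine ⟨hcR _, hcB _, fun t => ?_, fun x y => ?_⟩
    · have hV' := hV (cB d) (abs_le.2 (hcB d)) u
      have hdisp : ∀ t ∈ Icc 0 D.T, |D.disp f q (cB d) u t| ≤ V * D.T := fun t ht => by
        have := abs_disp_sub_le hf hq hV' t 0
        rw [disp_zero, sub_zero, sub_zero, abs_of_nonneg ht.1] at this
        exact this.trans (mul_le_mul_of_nonneg_left ht.2 hV0)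
      obtain ⟨t₀, ht₀, h1, -⟩ := exists_gap_eq hf hq α (cB d, u)
      change |D.disp f q (cB d) u t - gap f q α (cB d, u) + σ * cR κ| ≤ _
      rw [h1]
      have k1 := abs_le.1 (hdisp t t.2)
      have k2 := abs_le.1 (hdisp t₀ ht₀)
      have k3 := abs_le.1 (D.abs_ext_le α t₀)
      have k4 : |σ * cR κ| ≤ |σ| * R := by
        rw [abs_mul, abs_of_nonneg (hcR κ).1]
        exact mul_le_mul_of_nonneg_left (hcR κ).2 (abs_nonneg _)
      have k5 := abs_le.1 k4
      simp only
      rw [abs_le]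
      constructor <;> linarith
    · have := abs_disp_sub_le hf hq (hV (cB d) (abs_le.2 (hcB d)) u) x y
      change |D.disp f q (cB d) u x - gap f q α (cB d, u) + σ * cR κ -
        (D.disp f q (cB d) u y - gap f q α (cB d, u) + σ * cR κ)| ≤ V * |(x:ℝ) - y|
      convert this using 2
      ring)
  simp only [Φ, Prod.mk.injEq] at hfix
  obtain ⟨h1, h2, h3⟩ := hfix
  have hκ : κ ∈ Icc 0 R := h1 ▸ hcR _
  have hdB : d ∈ Icc (-B) B := h2 ▸ hcB _
  have e1 : cR κ = κ := by simp only [cR]; rw [min_eq_right hκ.2, max_eq_right hκ.1]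
  have e2 : cB d = d := by simp only [cB]; rw [min_eq_right hdB.2, max_eq_right hdB.1]
  rw [e2] at h2
  rw [e1, e2] at h3
  have hdT : D.disp f q d u D.T = 0 := by
    simp only [cB] at h2
    rcases lt_trichotomy (D.disp f q d u D.T) 0 with h | h | h
    · exfalso
      have hlt : d < B := by
        by_contra hcon
        have := disp_T_pos hf hq hqb hfc u (d := d) (by linarith)
        linarith
      have : d < max (-B) (min B (d - D.disp f q d u D.T)) :=
        lt_max_of_lt_right (lt_min hlt (by linarith))
      linarith
    · exact h
    · exfalso
      have hlt : -B < d := by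
        by_contra hcon
        have := disp_T_neg hf hq hqb hfc u (d := d) (by linarith)
        linarith
      have : max (-B) (min B (d - D.disp f q d u D.T)) < d :=
        max_lt hlt ((min_le_right _ _).trans_lt (by linarith))
      linarith
  have htouch := exists_lift_touching hf hq α (σ * κ) d u
  have hlift : ∀ t ∈ Icc 0 D.T, D.ext (lift hf hq α (σ * κ) d u) t =
      D.disp f q d u t - gap f q α (d, u) + σ * κ := fun t ht => by
    rw [ext, D.pr_of_mem ht]; rfl
  rw [h3] at htouch hlift
  refine ⟨κ, d, u, hκ, ⟨fun t ht => ?_, hdT⟩, htouch.1, htouch.2, fun h => ?_, fun h => ?_⟩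
  · rw [hlift t ht, hlift 0 zero_mem, disp_zero]
    ring
  · by_contra hcon
    have : κ < cR (κ + D.mean q u - s) := lt_max_of_lt_right (lt_min h (by linarith))
    linarith
  · by_contra hcon
    have : cR (κ + D.mean q u - s) < κ := max_lt h ((min_le_right _ _).trans_lt (by linarith))
    linarith

end LienardData

section Truncation

lemma exists_truncated_damping {f : ℝ → ℝ} (hf : Continuous f) (M : ℝ) :
    ∃ g : ℝ → ℝ, Continuous g ∧ (∀ x, |x| ≤ M → g x = f x) ∧
      ∃ c, ∀ x, |∫ y in (0:ℝ)..x, g y| ≤ c := by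
  have hg : Continuous fun x => f x * max 0 (min 1 (M + 1 - |x|)) :=
    hf.mul (continuous_const.max (continuous_const.min (continuous_const.sub continuous_abs)))
  refine ⟨_, hg, fun x hx => ?_, ∫ x, |f x * max 0 (min 1 (M + 1 - |x|))|, fun x => ?_⟩
  · rw [min_eq_left (by linarith), max_eq_right zero_le_one, mul_one]
  · have hint : Integrable fun x => f x * max 0 (min 1 (M + 1 - |x|)) := by
      refine hg.integrable_of_hasCompactSupport
        (HasCompactSupport.intro (isCompact_Icc (a := -(M + 1)) (b := M + 1)) fun y hy => ?_)
      have h : M + 1 < |y| := by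
        by_contra hcon
        exact hy (abs_le.1 (not_lt.1 hcon))
      rw [max_eq_left ((min_le_right _ _).trans (by linarith)), mul_zero]
    exact intervalIntegral.norm_integral_le_integral_norm_uIoc.trans
      (setIntegral_le_integral hint.norm (ae_of_all _ fun _ => norm_nonneg _))

lemma exists_truncated_restoring {q : ℝ → ℝ} (hq : Continuous q) {M Q : ℝ} (hM : 0 ≤ M)
    (hQ : ∀ x, q x ≤ Q) :
    ∃ g : ℝ → ℝ, Continuous g ∧ (∀ x, |x| ≤ M → g x = q x) ∧ (∀ x, g x ≤ Q) ∧
      ∃ b, ∀ x, |g x| ≤ b := by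
  obtain ⟨b, hb⟩ := (isCompact_Icc (a := -M) (b := M)).exists_bound_of_continuousOn
    hq.continuousOn
  refine ⟨fun x => q (max (-M) (min M x)),
    hq.comp (continuous_const.max (continuous_const.min continuous_id)), fun x hx => ?_,
    fun x => hQ _, b, fun x => hb _ ⟨le_max_left _ _, max_le (by linarith) (min_le_left _ _)⟩⟩
  have := abs_le.1 hx
  beta_reduce
  rw [min_eq_right this.2, max_eq_right this.1]

end Truncation

namespace LienardData

variable {D : LienardData} {f q f₁ q₁ : ℝ → ℝ} {M : ℝ}

lemma forall_ext {P : ℝ → Prop} {u : D.Space} (h : ∀ t ∈ Icc 0 D.T, P (D.ext u t)) (t : ℝ) :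
    P (D.ext u t) := by
  have := h _ (D.pr t).2
  rwa [ext_coe] at this

lemma mean_congr (hqq : ∀ x, |x| ≤ M → q₁ x = q x) {u : D.Space} (hu : ∀ t, |D.ext u t| ≤ M) :
    D.mean q₁ u = D.mean q u := by
  simp only [mean, hqq _ (hu _)]

lemma vel_congr (hff : ∀ x, |x| ≤ M → f₁ x = f x) (hqq : ∀ x, |x| ≤ M → q₁ x = q x)
    {u : D.Space} (hu : ∀ t, |D.ext u t| ≤ M) (d : ℝ) : D.vel f₁ q₁ d u = D.vel f q d u := by
  have hF : ∀ t, ∫ y in (0:ℝ)..D.ext u t, f₁ y = ∫ y in (0:ℝ)..D.ext u t, f y := fun t => by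
    refine intervalIntegral.integral_congr fun y hy => hff y ?_
    have := abs_sub_left_of_mem_uIcc hy
    simp only [sub_zero] at this
    exact this.trans (hu t)
  funext t
  simp only [vel, forcing, mean_congr hqq hu, hqq _ (hu _), hF]

lemma isCore_congr (hff : ∀ x, |x| ≤ M → f₁ x = f x) (hqq : ∀ x, |x| ≤ M → q₁ x = q x)
    {u : D.Space} (hu : ∀ t, |D.ext u t| ≤ M) (d : ℝ) : D.IsCore f₁ q₁ d u ↔ D.IsCore f q d u := by
  simp only [IsCore, disp, vel_congr hff hqq hu]

/-- `α` is a periodic lower solution at level `s`. -/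
def IsLower (D : LienardData) (f q : ℝ → ℝ) (s : ℝ) (α : D.Space) : Prop :=
  ∃ α' w : ℝ → ℝ, IsC1Periodic D.T (D.ext α) α' ∧ IsACPhiDeriv D.T D.φ α' w ∧
    ∀ᵐ t ∂(muT D.T), s + D.e t ≤ w t + f (D.ext α t) * α' t + D.a t * q (D.ext α t)

lemma IsCore.isLower (hf : Continuous f) (hq : Continuous q) {d : ℝ} {u : D.Space}
    (h : D.IsCore f q d u) : D.IsLower f q (D.mean q u) u := by
  obtain ⟨u', w, h1, h2, h3⟩ := h.isSolWE hf hq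
  exact ⟨u', w, h1, h2, h3.mono fun t ht => ht.ge⟩

lemma isLower_congr (hff : ∀ x, |x| ≤ M → f₁ x = f x) (hqq : ∀ x, |x| ≤ M → q₁ x = q x)
    {α : D.Space} (hα : ∀ t, |D.ext α t| ≤ M) (s : ℝ) :
    D.IsLower f₁ q₁ s α ↔ D.IsLower f q s α := by
  simp only [IsLower, hff _ (hα _), hqq _ (hα _)]

/-- Below the level of a lower solution `α`, and above the mean of `a q` far away in the direction
`σ`, there is a solution which touches `α + σ κ` from above for some `κ > 0`. -/
lemma exists_isCore_of_isLower (hf : Continuous f) (hq : Continuous q) {Q r N s s' σ : ℝ}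
    (hQ : 0 ≤ Q) (hqQ : ∀ x, q x ≤ Q) {α : D.Space} (hα : D.IsLower f q s' α) (hs : s < s')
    (hσ : |σ| = 1) (hr : (∫ τ in (0:ℝ)..D.T, D.a τ) / D.T * r < s)
    (hN : ∀ x, N ≤ σ * x → q x ≤ r) :
    ∃ κ > 0, ∃ (d : ℝ) (u : D.Space), D.IsCore f q d u ∧ D.mean q u = s ∧
      (∀ t ∈ Icc 0 D.T, D.ext α t + σ * κ ≤ D.ext u t) ∧
      ∃ t ∈ Icc 0 D.T, D.ext α t + σ * κ = D.ext u t := by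
  obtain ⟨ρ, hρ⟩ := D.exists_oscillation_bound hQ s
  set R := |N| + ‖α‖ + |ρ| + 1 with hRdef
  have hR : 0 < R := by positivity
  set M := R + ‖α‖ + |ρ| with hMdef
  have hM : 0 ≤ M := by positivity
  obtain ⟨f₁, hf₁, hff, c, hc⟩ := exists_truncated_damping hf M
  obtain ⟨q₁, hq₁, hqq, hqQ₁, b, hb⟩ := exists_truncated_restoring hq hM hqQ
  have hαM : ∀ t, |D.ext α t| ≤ M := fun t =>
    (D.abs_ext_le α t).trans (by linarith [abs_nonneg ρ])
  obtain ⟨κ, d, u, hκ, hcore, hge, ⟨t₁, ht₁, htouch⟩, hlt, hpos⟩ :=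
    exists_isCore_touching hf₁ hq₁ hb hc α hR.le σ s
  have hκ0 : 0 < κ := by
    rcases eq_or_lt_of_le hκ.1 with h | h
    · exfalso
      subst h
      simp only [mul_zero, add_zero] at hge htouch
      obtain ⟨α', w, k1, k2, k3⟩ := (isLower_congr hff hqq hαM s').2 hα
      obtain ⟨u', w', l1, l2, l3⟩ := hcore.isSolWE hf₁ hq₁
      exact not_touching_of_lt D.T_pos D.φ_mono hf₁ hq₁
        (fun t => (abs_of_nonneg (D.a_nonneg t)).trans_le (D.a_le t)) k1 k2 k3 l1 l2 l3
        ((hlt hR).trans_lt hs) hge t₁ ht₁ htouch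
    · exact h
  have hosc := hρ f₁ q₁ hf₁ hq₁ hqQ₁ d u hcore (hpos hκ0)
  have hσκ : |σ * κ| = κ := by rw [abs_mul, hσ, one_mul, abs_of_pos hκ0]
  have hσ2 : σ * σ = 1 := by rw [← abs_mul_abs_self, hσ, one_mul]
  have huM : ∀ t, |D.ext u t| ≤ M := by
    refine forall_ext (P := fun x => |x| ≤ M) fun t ht => ?_
    have h1 := abs_le.1 ((hosc t ht t₁ ht₁).trans (le_abs_self ρ))
    have h2 := abs_le.1 (D.abs_ext_le α t₁)
    have h3 := abs_le.1 hσκ.le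
    have h4 := hκ.2
    rw [abs_le]
    constructor <;> linarith
  have hcore' := (isCore_congr hff hqq huM d).1 hcore
  have hmean := mean_congr hqq huM
  rw [hmean] at hlt hpos
  have hκR : κ < R := by
    refine lt_of_le_of_ne hκ.2 fun h => ?_
    have : D.mean q u ≤ _ := mean_le hq u (r := r) fun t ht => hN _ (by
      have h1 : |σ * (D.ext u t - D.ext u t₁)| ≤ |ρ| := by
        rw [abs_mul, hσ, one_mul]; exact (hosc t ht t₁ ht₁).trans (le_abs_self ρ)
      have h2 : |σ * D.ext α t₁| ≤ ‖α‖ := by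
        rw [abs_mul, hσ, one_mul]; exact D.abs_ext_le α t₁
      have h3 : σ * D.ext u t₁ = σ * D.ext α t₁ + κ := by
        rw [← htouch, mul_add, ← mul_assoc, hσ2, one_mul]
      have h4 := abs_le.1 h1
      have h5 := abs_le.1 h2
      linarith [le_abs_self N])
    linarith [hpos hκ0]
  exact ⟨κ, hκ0, d, u, hcore', le_antisymm (hlt hκR) (hpos hκ0), hge, t₁, ht₁, htouch⟩

lemma isClosed_isCore (hf : Continuous f) (hq : Continuous q) :
    IsClosed {p : ℝ × D.Space | D.IsCore f q p.1 p.2} := by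
  have hext : ∀ t, Continuous fun p : ℝ × D.Space => D.ext p.2 t := fun t =>
    (continuous_eval_const (D.pr t)).comp continuous_snd
  have hdisp : ∀ t, Continuous fun p : ℝ × D.Space => D.disp f q p.1 p.2 t := fun t =>
    (continuous_disp_uncurry hf hq).comp (continuous_id.prodMk continuous_const)
  simp only [IsCore, ofPred_and, ofPred_forall]
  refine IsClosed.inter (isClosed_iInter fun t => isClosed_iInter fun _ => ?_) ?_
  · exact isClosed_eq (hext t) ((hext 0).add (hdisp t))
  · exact isClosed_eq (hdisp _) continuous_const

/-- If `q` is small far away, then the largest mean among the solutions is attained. -/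
lemma exists_isCore_max (hf : Continuous f) (hq : Continuous q) {Q r N s : ℝ}
    (hQ : 0 ≤ Q) (hqQ : ∀ x, q x ≤ Q) (hr : (∫ τ in (0:ℝ)..D.T, D.a τ) / D.T * r < s)
    (hN : ∀ x, N ≤ |x| → q x ≤ r) (hne : ∃ d u, D.IsCore f q d u ∧ s ≤ D.mean q u) :
    ∃ d u, D.IsCore f q d u ∧ s ≤ D.mean q u ∧
      ∀ d' u', D.IsCore f q d' u' → D.mean q u' ≤ D.mean q u := by
  obtain ⟨ρ, hρ⟩ := D.exists_oscillation_bound hQ s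
  set M := |N| + |ρ| with hMdef
  have hM : 0 ≤ M := by positivity
  have hbound : ∀ d u, D.IsCore f q d u → s ≤ D.mean q u → ∀ t, |D.ext u t| ≤ M := by
    intro d u h hs
    have hex : ∃ t₁ ∈ Icc 0 D.T, |D.ext u t₁| < N := by
      by_contra! hcon
      have := mean_le hq u (r := r) fun t ht => hN _ (hcon t ht)
      linarith
    obtain ⟨t₁, ht₁, hlt⟩ := hex
    refine forall_ext (P := fun x => |x| ≤ M) fun t ht => ?_
    have h1 := abs_le.1 ((hρ f q hf hq hqQ d u h hs t ht t₁ ht₁).trans (le_abs_self ρ))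
    have h2 := abs_lt.1 (hlt.trans_le (le_abs_self N))
    rw [abs_le]
    constructor <;> linarith
  obtain ⟨f₁, hf₁, hff, c, hc⟩ := exists_truncated_damping hf M
  obtain ⟨q₁, hq₁, hqq, hqQ₁, b, hb⟩ := exists_truncated_restoring hq hM hqQ
  set B := c + (2 * (D.C * b) + D.C) * D.T with hB
  obtain ⟨V, hV0, hV⟩ := D.exists_vel_bound hb hc B
  let S : Set (ℝ × D.Space) := (Icc (-B) B ×ˢ {w : D.Space | (∀ t, |w t| ≤ M) ∧
    ∀ x y, |w x - w y| ≤ V * dist x y}) ∩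
      ({p | D.IsCore f₁ q₁ p.1 p.2} ∩ {p | s ≤ D.mean q₁ p.2})
  have hmc : Continuous fun p : ℝ × D.Space => D.mean q₁ p.2 :=
    (continuous_mean hq₁).comp continuous_snd
  have hS : IsCompact S := (isCompact_Icc.prod (isCompact_lipschitz_continuousMap M V)).inter_right
    ((isClosed_isCore hf₁ hq₁).inter (isClosed_le continuous_const hmc))
  have hmem : ∀ d u, D.IsCore f q d u → s ≤ D.mean q u → (d, u) ∈ S := by
    intro d u h hs
    have hu := hbound d u h hs
    have hcore := (isCore_congr hff hqq hu d).2 h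
    have hd : d ∈ Icc (-B) B := by
      constructor
      · by_contra hcon
        exact (disp_T_neg hf₁ hq₁ hb hc u (not_le.1 hcon)).ne hcore.2
      · by_contra hcon
        exact (disp_T_pos hf₁ hq₁ hb hc u (not_le.1 hcon)).ne' hcore.2
    refine ⟨⟨hd, fun t => ?_, fun x y => ?_⟩, hcore, ?_⟩
    · have := hu t
      rwa [ext_coe] at this
    · have := abs_disp_sub_le hf₁ hq₁ (hV d (abs_le.2 hd) u) x y
      have hx := hcore.1 x x.2
      have hy := hcore.1 y y.2
      rw [ext_coe] at hx hy
      rw [hx, hy, add_sub_add_left_eq_sub]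
      exact this
    · change s ≤ D.mean q₁ u
      rwa [mean_congr hqq hu]
  obtain ⟨d₀, u₀, hcore₀, hs₀⟩ := hne
  obtain ⟨⟨d, u⟩, hdu, hmax⟩ := hS.exists_isMaxOn ⟨_, hmem d₀ u₀ hcore₀ hs₀⟩ hmc.continuousOn
  have hu : ∀ t, |D.ext u t| ≤ M := fun t => hdu.1.2.1 _
  have hmean : D.mean q₁ u = D.mean q u := mean_congr hqq hu
  have hs : s ≤ D.mean q u := hmean ▸ hdu.2.2
  refine ⟨d, u, (isCore_congr hff hqq hu d).1 hdu.2.1, hs, fun d' u' h' => ?_⟩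
  rcases le_total (D.mean q u') s with h | h
  · exact h.trans hs
  · have := hmax (hmem d' u' h' h)
    simp only [mem_ofPred_eq] at this
    rwa [mean_congr hqq (hbound d' u' h' h), hmean] at this

lemma isLower_const (x s : ℝ) (h : ∀ᵐ t ∂(muT D.T), s + D.e t ≤ D.a t * q x) :
    D.IsLower f q s (ContinuousMap.const _ x) := by
  have hext : D.ext (ContinuousMap.const _ x) = fun _ => x := rfl
  refine ⟨fun _ => 0, fun _ => 0, ⟨fun t _ => ?_, continuousOn_const, rfl, rfl⟩,
    ⟨integrableOn_zero, fun t _ => by simp⟩, ?_⟩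
  · rw [hext]; exact hasDerivWithinAt_const _ _ _
  · simpa [hext] using h

end LienardData

section Limits

lemma exists_real_between_of_coe_mul_lt {c s : ℝ} (hc : 0 < c) {ω : EReal}
    (h : (c : EReal) * ω < (s : EReal)) : ∃ r : ℝ, ω < (r : EReal) ∧ c * r < s := by
  induction ω with
  | bot =>
    refine ⟨s / c - 1, EReal.bot_lt_coe _, ?_⟩
    rw [mul_sub, mul_div_cancel₀ _ hc.ne']
    linarith
  | top => rw [EReal.coe_mul_top_of_pos hc] at h; exact absurd h not_top_lt
  | coe x =>
    rw [← EReal.coe_mul, EReal.coe_lt_coe_iff] at h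
    have h1 : x < s / c := by rw [lt_div_iff₀ hc]; linarith
    obtain ⟨r, hr1, hr2⟩ := exists_between h1
    exact ⟨r, EReal.coe_lt_coe_iff.2 hr1, by rw [lt_div_iff₀ hc] at hr2; linarith⟩

lemma exists_forall_ge_le_of_tendsto {q : ℝ → ℝ} {ω : EReal}
    (h : Tendsto (fun u : ℝ => ((q u : ℝ) : EReal)) atTop (nhds ω)) {r : ℝ}
    (hr : ω < (r : EReal)) : ∃ N, ∀ x, N ≤ x → q x ≤ r := by
  obtain ⟨N, hN⟩ := eventually_atTop.1 (h.eventually_lt_const hr)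
  exact ⟨N, fun x hx => (EReal.coe_lt_coe_iff.1 (hN x hx)).le⟩

lemma exists_forall_le_le_of_tendsto {q : ℝ → ℝ} {ω : EReal}
    (h : Tendsto (fun u : ℝ => ((q u : ℝ) : EReal)) atBot (nhds ω)) {r : ℝ}
    (hr : ω < (r : EReal)) : ∃ N, ∀ x, x ≤ N → q x ≤ r := by
  obtain ⟨N, hN⟩ := eventually_atBot.1 (h.eventually_lt_const hr)
  exact ⟨N, fun x hx => (EReal.coe_lt_coe_iff.1 (hN x hx)).le⟩

lemma exists_upper_bound_of_tendsto {q : ℝ → ℝ} (hq : Continuous q) {ωm ωp : EReal}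
    (hm : Tendsto (fun u : ℝ => ((q u : ℝ) : EReal)) atBot (nhds ωm))
    (hp : Tendsto (fun u : ℝ => ((q u : ℝ) : EReal)) atTop (nhds ωp))
    (hωm : ωm ≠ ⊤) (hωp : ωp ≠ ⊤) : ∃ Q, 0 ≤ Q ∧ ∀ x, q x ≤ Q := by
  obtain ⟨r₁, hr₁, -⟩ := EReal.lt_iff_exists_real_btwn.1 (lt_top_iff_ne_top.2 hωm)
  obtain ⟨r₂, hr₂, -⟩ := EReal.lt_iff_exists_real_btwn.1 (lt_top_iff_ne_top.2 hωp)
  obtain ⟨N₁, hN₁⟩ := exists_forall_le_le_of_tendsto hm hr₁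
  obtain ⟨N₂, hN₂⟩ := exists_forall_ge_le_of_tendsto hp hr₂
  obtain ⟨b, hb⟩ := (isCompact_Icc (a := N₁) (b := N₂)).exists_bound_of_continuousOn hq.continuousOn
  refine ⟨|r₁| + |r₂| + |b|, by positivity, fun x => ?_⟩
  have k₁ := le_abs_self r₁
  have k₂ := le_abs_self r₂
  have k₃ := le_abs_self b
  have l₁ := abs_nonneg r₁
  have l₂ := abs_nonneg r₂
  have l₃ := abs_nonneg b
  rcases le_total x N₁ with h | h
  · linarith [hN₁ x h]
  rcases le_total N₂ x with h' | h'
  · linarith [hN₂ x h']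
  · linarith [(le_abs_self _).trans (hb x ⟨h, h'⟩)]

end Limits

lemma isSolWE_congr {T : ℝ} {φ f q a e a₁ e₁ : ℝ → ℝ} (ha : ∀ᵐ t ∂(muT T), a₁ t = a t)
    (he : ∀ᵐ t ∂(muT T), e₁ t = e t) (s : ℝ) (u : ℝ → ℝ) :
    IsSolWE T φ f q a₁ e₁ s u ↔ IsSolWE T φ f q a e s u := by
  have : ∀ u' w : ℝ → ℝ, (∀ᵐ t ∂(muT T), w t + f (u t) * u' t + a₁ t * q (u t) = s + e₁ t) ↔
      ∀ᵐ t ∂(muT T), w t + f (u t) * u' t + a t * q (u t) = s + e t := fun u' w => by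
    refine eventually_congr ?_
    filter_upwards [ha, he] with t h1 h2
    rw [h1, h2]
  simp only [IsSolWE, this]

/-- After modification on null sets, the coefficients of the problem are bounded everywhere. -/
lemma exists_lienardData {T : ℝ} (hT : 0 < T) {φ a e : ℝ → ℝ}
    (hφmono : StrictMono φ) (hφsurj : Function.Surjective φ) (hφ0 : φ 0 = 0)
    (ha_meas : Measurable a) (ha_bdd : ∃ C : ℝ, ∀ᵐ t ∂(muT T), |a t| ≤ C)
    (ha_nonneg : ∀ᵐ t ∂(muT T), 0 ≤ a t)
    (he_meas : Measurable e) (he_bdd : ∃ C : ℝ, ∀ᵐ t ∂(muT T), |e t| ≤ C)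
    (he_mean : ∫ t in Icc (0:ℝ) T, e t = 0) :
    ∃ D : LienardData, D.T = T ∧ D.φ = φ ∧ (∀ᵐ t ∂(muT T), D.a t = a t) ∧
      ∀ᵐ t ∂(muT T), D.e t = e t := by
  obtain ⟨A, hA⟩ := ha_bdd
  obtain ⟨E, hE⟩ := he_bdd
  obtain ⟨ψ, hψ⟩ := hφsurj.hasRightInverse
  set C := |A| + |E| with hCdef
  have hC : 0 ≤ C := by positivity
  have hae : ∀ᵐ t ∂(muT T), max 0 (min C (a t)) = a t := by
    filter_upwards [hA, ha_nonneg] with t h1 h2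
    have : a t ≤ C := by
      linarith [le_abs_self (a t), le_abs_self A, abs_nonneg E]
    rw [min_eq_right this, max_eq_right h2]
  have hee : ∀ᵐ t ∂(muT T), max (-C) (min C (e t)) = e t := by
    filter_upwards [hE] with t h1
    have := abs_le.1 (h1.trans (show E ≤ C by linarith [le_abs_self E, abs_nonneg A]))
    rw [min_eq_right this.2, max_eq_right this.1]
  refine ⟨{
    T := T
    φ := φ
    ψ := ψ
    a := fun t => max 0 (min C (a t))
    e := fun t => max (-C) (min C (e t))
    C := C
    T_pos := hT
    φ_mono := hφmono
    φ_zero := hφ0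
    φ_ψ := hψ
    a_meas := measurable_const.max (measurable_const.min ha_meas)
    a_nonneg := fun t => le_max_left _ _
    a_le := fun t => max_le hC (min_le_left _ _)
    e_meas := measurable_const.max (measurable_const.min he_meas)
    e_le := fun t => abs_le.2 ⟨le_max_left _ _, max_le (by linarith) (min_le_left _ _)⟩
    e_mean := ?_ }, rfl, rfl, hae, hee⟩
  rw [intervalIntegral.integral_of_le hT.le, ← integral_Icc_eq_integral_Ioc]
  exact (integral_congr_ae hee).trans he_mean

namespace LienardData

variable {D : LienardData} {f q : ℝ → ℝ}

/-- The zero/one/two alternative for the periodic problem, given a constant lower solution. -/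
lemma exists_threshold (hf : Continuous f) (hq : Continuous q) {c : ℝ} (hc : 0 < c)
    (hcD : (∫ τ in (0:ℝ)..D.T, D.a τ) / D.T = c) {ωm ωp : EReal}
    (hq_bot : Tendsto (fun u : ℝ => ((q u : ℝ) : EReal)) atBot (nhds ωm))
    (hq_top : Tendsto (fun u : ℝ => ((q u : ℝ) : EReal)) atTop (nhds ωp))
    (hωm : ωm ≠ ⊤) (hωp : ωp ≠ ⊤) {x₀ s₁ : ℝ}
    (hlow : ∀ᵐ t ∂(muT D.T), s₁ + D.e t ≤ D.a t * q x₀)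
    (hs₁ : (c : EReal) * max ωm ωp < (s₁ : EReal)) :
    ∃ s₀ : ℝ, (c : EReal) * ωm < ((s₀ : ℝ) : EReal) ∧
      (∀ s : ℝ, s₀ < s → ¬∃ u : ℝ → ℝ, IsSolWE D.T D.φ f q D.a D.e s u) ∧
      (∃ u : ℝ → ℝ, IsSolWE D.T D.φ f q D.a D.e s₀ u) ∧
      (∀ s : ℝ, (c : EReal) * ωm < ((s : ℝ) : EReal) → s < s₀ →
        ∃ u : ℝ → ℝ, IsSolWE D.T D.φ f q D.a D.e s u) ∧
      (∀ s : ℝ, (c : EReal) * max ωm ωp < ((s : ℝ) : EReal) → s < s₀ →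
        ∃ u₁ u₂ : ℝ → ℝ, IsSolWE D.T D.φ f q D.a D.e s u₁ ∧ IsSolWE D.T D.φ f q D.a D.e s u₂ ∧
          ∃ t ∈ Icc (0:ℝ) D.T, u₁ t ≠ u₂ t) := by
  obtain ⟨Q, hQ, hqQ⟩ := exists_upper_bound_of_tendsto hq hq_bot hq_top hωm hωp
  have hmono : ∀ {ω : EReal}, ω ≤ max ωm ωp → (c : EReal) * ω ≤ c * max ωm ωp := fun h =>
    mul_le_mul_of_nonneg_left h (EReal.coe_nonneg.2 hc.le)
  have below : ∀ {s s' : ℝ} {α : D.Space}, D.IsLower f q s' α → s < s' →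
      (c : EReal) * ωm < (s : EReal) → ∃ κ > 0, ∃ (d : ℝ) (u : D.Space), D.IsCore f q d u ∧
        D.mean q u = s ∧ ∃ t ∈ Icc 0 D.T, D.ext α t + -1 * κ = D.ext u t := by
    intro s s' α hα hs hω
    obtain ⟨r, hr, hrs⟩ := exists_real_between_of_coe_mul_lt hc hω
    obtain ⟨N, hN⟩ := exists_forall_le_le_of_tendsto hq_bot hr
    obtain ⟨κ, hκ, d, u, h1, h2, -, h3⟩ := exists_isCore_of_isLower (σ := -1) (N := -N) hf hq hQ
      hqQ hα hs (by simp) (by rwa [hcD]) fun x hx => hN x (by linarith)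
    exact ⟨κ, hκ, d, u, h1, h2, h3⟩
  have above : ∀ {s s' : ℝ} {α : D.Space}, D.IsLower f q s' α → s < s' →
      (c : EReal) * ωp < (s : EReal) → ∃ κ > 0, ∃ (d : ℝ) (u : D.Space), D.IsCore f q d u ∧
        D.mean q u = s ∧ ∀ t ∈ Icc 0 D.T, D.ext α t + 1 * κ ≤ D.ext u t := by
    intro s s' α hα hs hω
    obtain ⟨r, hr, hrs⟩ := exists_real_between_of_coe_mul_lt hc hω
    obtain ⟨N, hN⟩ := exists_forall_ge_le_of_tendsto hq_top hr
    obtain ⟨κ, hκ, d, u, h1, h2, h3, -⟩ := exists_isCore_of_isLower (σ := 1) (N := N) hf hq hQ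
      hqQ hα hs (by simp) (by rwa [hcD]) fun x hx => hN x (by linarith)
    exact ⟨κ, hκ, d, u, h1, h2, h3⟩
  obtain ⟨s₂, h2, h21⟩ := EReal.lt_iff_exists_real_btwn.1 hs₁
  rw [EReal.coe_lt_coe_iff] at h21
  obtain ⟨-, -, d₂, u₂, hu₂, hm₂, -⟩ := above (isLower_const x₀ s₁ hlow) h21
    ((hmono (le_max_right _ _)).trans_lt h2)
  obtain ⟨r, hr, hrs⟩ := exists_real_between_of_coe_mul_lt hc h2
  obtain ⟨N₁, hN₁⟩ := exists_forall_le_le_of_tendsto hq_bot ((le_max_left _ _).trans_lt hr)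
  obtain ⟨N₂, hN₂⟩ := exists_forall_ge_le_of_tendsto hq_top ((le_max_right _ _).trans_lt hr)
  obtain ⟨d, α, hα, hsα, hmax⟩ := exists_isCore_max (N := max N₂ (-N₁)) hf hq hQ hqQ
    (by rwa [hcD]) (fun x hx => by
      have h3 := (le_max_left _ _).trans hx
      have h4 := (le_max_right _ _).trans hx
      rcases le_total 0 x with h | h
      · rw [abs_of_nonneg h] at h3
        exact hN₂ x h3
      · rw [abs_of_nonpos h] at h4
        exact hN₁ x (by linarith)) ⟨d₂, u₂, hu₂, hm₂.ge⟩
  have hlowα := hα.isLower hf hq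
  refine ⟨D.mean q α, ?_, ?_, ⟨_, hα.isSolWE hf hq⟩, ?_, ?_⟩
  · exact ((hmono (le_max_left _ _)).trans_lt h2).trans_le (EReal.coe_le_coe_iff.2 hsα)
  · rintro s hs ⟨u, hu⟩
    obtain ⟨U, d', -, hU, rfl⟩ := exists_isCore_of_isSolWE hf hq hu
    exact absurd (hmax d' U hU) (not_le.2 hs)
  · intro s hω hs
    obtain ⟨-, -, d', u, hu, rfl, -⟩ := below hlowα hs hω
    exact ⟨_, hu.isSolWE hf hq⟩
  · intro s hω hs
    obtain ⟨κ, hκ, d₁, v₁, hv₁, hm₁, t, ht, htouch⟩ := below hlowα hs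
      ((hmono (le_max_left _ _)).trans_lt hω)
    obtain ⟨κ', hκ', d₂, v₂, hv₂, hm₂, hge⟩ := above hlowα hs
      ((hmono (le_max_right _ _)).trans_lt hω)
    refine ⟨_, _, hm₁ ▸ hv₁.isSolWE hf hq, hm₂ ▸ hv₂.isSolWE hf hq, t, ht, ?_⟩
    have := hge t ht
    exact ne_of_lt (by linarith)

end LienardData

/-- Theorem for type-II nonlinearities with limits `ω₋, ω₊ ∈ [−∞,+∞)` (as extended reals):
if `0 ≥ q(u₀) > max{ω₋,ω₊}` and `ā·max{ω₋,ω₊} < ‖a‖_∞ q(u₀) − ‖e⁺‖_∞`, then there is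
`s₀ > ā·ω₋` realizing the zero/one/two alternative described below. -/
theorem statement16
    (T : ℝ) (hT : 0 < T)
    (φ f q a e : ℝ → ℝ)
    (hφmono : StrictMono φ) (hφcont : Continuous φ)
    (hφsurj : Function.Surjective φ) (hφ0 : φ 0 = 0)
    (hf : Continuous f) (hq : Continuous q)
    (ha_meas : Measurable a) (ha_bdd : ∃ C : ℝ, ∀ᵐ t ∂(muT T), |a t| ≤ C)
    (ha_nonneg : ∀ᵐ t ∂(muT T), 0 ≤ a t)
    (abar : ℝ) (habar_def : (1 / T) * ∫ t in Icc (0:ℝ) T, a t = abar)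
    (habar_pos : 0 < abar)
    (he_meas : Measurable e) (he_bdd : ∃ C : ℝ, ∀ᵐ t ∂(muT T), |e t| ≤ C)
    (he_mean : (1 / T) * ∫ t in Icc (0:ℝ) T, e t = 0)
    (ωm ωp : EReal)
    (hq_bot : Tendsto (fun u : ℝ => ((q u : ℝ) : EReal)) atBot (nhds ωm))
    (hq_top : Tendsto (fun u : ℝ => ((q u : ℝ) : EReal)) atTop (nhds ωp))
    (hωm : ωm ≠ ⊤) (hωp : ωp ≠ ⊤)
    (u₀ : ℝ) (hqu₀ : q u₀ ≤ 0) (hqu₀gt : max ωm ωp < ((q u₀ : ℝ) : EReal))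
    (hnorm : (abar : EReal) * max ωm ωp <
      ((essSup (fun t => |a t|) (muT T) * q u₀ -
        essSup (fun t => max (e t) 0) (muT T) : ℝ) : EReal)) :
    ∃ s₀ : ℝ, (abar : EReal) * ωm < ((s₀ : ℝ) : EReal) ∧
      (∀ s : ℝ, s₀ < s → ¬∃ u : ℝ → ℝ, IsSolWE T φ f q a e s u) ∧
      (∃ u : ℝ → ℝ, IsSolWE T φ f q a e s₀ u) ∧
      (∀ s : ℝ, (abar : EReal) * ωm < ((s : ℝ) : EReal) → s < s₀ →
        ∃ u : ℝ → ℝ, IsSolWE T φ f q a e s u) ∧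
      (∀ s : ℝ, (abar : EReal) * max ωm ωp < ((s : ℝ) : EReal) → s < s₀ →
        ∃ u₁ u₂ : ℝ → ℝ, IsSolWE T φ f q a e s u₁ ∧ IsSolWE T φ f q a e s u₂ ∧
          ∃ t ∈ Icc (0:ℝ) T, u₁ t ≠ u₂ t) := by
  obtain ⟨D, rfl, rfl, ha, he⟩ := exists_lienardData hT hφmono hφsurj hφ0 ha_meas ha_bdd
    ha_nonneg he_meas he_bdd
    ((mul_eq_zero.1 he_mean).resolve_left (one_div_pos.2 hT).ne')
  simp only [← isSolWE_congr ha he]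
  refine LienardData.exists_threshold hf hq habar_pos ?_ hq_bot hq_top hωm hωp (x₀ := u₀) ?_ hnorm
  · rw [← habar_def, intervalIntegral.integral_of_le hT.le, ← integral_Icc_eq_integral_Ioc,
      div_eq_inv_mul, one_div]
    congr 1
    exact integral_congr_ae ha
  · have hA : ∀ᵐ t ∂(muT D.T), |a t| ≤ essSup (fun t => |a t|) (muT D.T) := by
      obtain ⟨C, hC⟩ := ha_bdd
      exact ae_le_essSup ⟨C, eventually_map.2 hC⟩
    have hE : ∀ᵐ t ∂(muT D.T), max (e t) 0 ≤ essSup (fun t => max (e t) 0) (muT D.T) := by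
      obtain ⟨C, hC⟩ := he_bdd
      refine ae_le_essSup ⟨C, eventually_map.2 (hC.mono fun t ht => ?_)⟩
      exact max_le ((le_abs_self _).trans ht) ((abs_nonneg _).trans ht)
    filter_upwards [ha, he, hA, hE] with t h1 h2 h3 h4
    rw [h1, h2]
    have h5 := mul_le_mul_of_nonpos_right ((le_abs_self _).trans h3) hqu₀
    have h6 := (le_max_left _ _).trans h4
    linarith
end
end

section
/- Let a ∈ C([R_i,R_e],[0,+∞)) be such that a(ξ₀) > 0 for some ξ₀ ∈ [R_i,R_e], and let q : ℝ → ℝ be continuous with q(u) → +∞ as |u| → +∞. Set G(|x|,u) := a(|x|)q(u). Then there exists s₀ ∈ ℝ such that: for s < s₀ the Neumann problem ∇·(A(|∇u|)∇u) + a(|x|)q(u) = s in 𝔄, ∂u/∂ν = 0 on ∂𝔄, has no radially symmetric solutions; for s = s₀ it has at least one radially symmetric solution; and for s > s₀ it has at least two radially symmetric solutions. -/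
open MeasureTheory Set Filter

noncomputable section

/-- `v : [R_i,R_e] → ℝ` is the radial profile of a radially symmetric solution
`u(x) = v(|x|)` of the Neumann problem `∇·(A(|∇u|)∇u) + G(|x|,u) = s` on the annulus,
with `∂u/∂ν = 0` on the boundary: `v` is `C¹` on `[R_i,R_e]`, `v'(R_i) = v'(R_e) = 0`,
`r ↦ r^(N−1) φ(v'(r))` is absolutely continuous (the indefinite integral of an integrable
`w`), and `(r^(N−1) φ(v'))' + r^(N−1) G(r,v) = r^(N−1) s` a.e. on `[R_i,R_e]`. -/
def IsRadialSol (N : ℕ) (Ri Re : ℝ) (φ : ℝ → ℝ) (G : ℝ → ℝ → ℝ) (s : ℝ)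
    (v : ℝ → ℝ) : Prop :=
  ∃ v' w : ℝ → ℝ,
    (∀ r ∈ Icc Ri Re, HasDerivWithinAt v (v' r) (Icc Ri Re) r) ∧
    ContinuousOn v' (Icc Ri Re) ∧ v' Ri = 0 ∧ v' Re = 0 ∧
    IntegrableOn w (Icc Ri Re) ∧
    (∀ r ∈ Icc Ri Re,
      r ^ (N - 1) * φ (v' r) = Ri ^ (N - 1) * φ (v' Ri) + ∫ τ in Ri..r, w τ) ∧
    ∀ᵐ r ∂(volume.restrict (Icc Ri Re)),
      w r + r ^ (N - 1) * G r (v r) = r ^ (N - 1) * s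

open scoped Topology

/-- The flux `∫ₗᵗ ρ h` generated by the forcing `h`. -/
def flux (l : ℝ) (ρ h : ℝ → ℝ) (t : ℝ) : ℝ := ∫ τ in l..t, ρ τ * h τ

/-- The solution of `(ρ ψ⁻¹(v'))' = ρ h`, `v(l) = c`, `v'(l) = 0`. -/
def profile (l : ℝ) (ψ ρ : ℝ → ℝ) (c : ℝ) (h : ℝ → ℝ) (r : ℝ) : ℝ :=
  c + ∫ t in l..r, ψ (flux l ρ h t / ρ t)

section Basic

variable {l R c : ℝ} {ψ ρ h h' : ℝ → ℝ}

@[simp] lemma flux_self : flux l ρ h l = 0 := by simp [flux]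

@[simp] lemma profile_self : profile l ψ ρ c h l = c := by simp [profile]

lemma hasDerivAt_flux (hρ : Continuous ρ) (hh : Continuous h) (t : ℝ) :
    HasDerivAt (flux l ρ h) (ρ t * h t) t :=
  (hρ.mul hh).integral_hasStrictDerivAt l t |>.hasDerivAt

lemma continuous_flux (hρ : Continuous ρ) (hh : Continuous h) : Continuous (flux l ρ h) :=
  continuous_iff_continuousAt.2 fun t => (hasDerivAt_flux hρ hh t).continuousAt

lemma continuous_slope (hψ : Continuous ψ) (hρ : Continuous ρ) (hρpos : ∀ t, 0 < ρ t)
    (hh : Continuous h) : Continuous fun t => ψ (flux l ρ h t / ρ t) :=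
  hψ.comp ((continuous_flux hρ hh).div hρ fun t => (hρpos t).ne')

lemma hasDerivAt_profile (hψ : Continuous ψ) (hρ : Continuous ρ) (hρpos : ∀ t, 0 < ρ t)
    (hh : Continuous h) (r : ℝ) :
    HasDerivAt (profile l ψ ρ c h) (ψ (flux l ρ h r / ρ r)) r :=
  ((continuous_slope hψ hρ hρpos hh).integral_hasStrictDerivAt l r).hasDerivAt.const_add c

lemma continuous_profile (hψ : Continuous ψ) (hρ : Continuous ρ) (hρpos : ∀ t, 0 < ρ t)
    (hh : Continuous h) : Continuous (profile l ψ ρ c h) :=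
  continuous_iff_continuousAt.2 fun t => (hasDerivAt_profile hψ hρ hρpos hh t).continuousAt

lemma flux_congr {r : ℝ} (hr : l ≤ r) (hEq : EqOn h h' (Icc l r)) :
    flux l ρ h r = flux l ρ h' r := by
  refine intervalIntegral.integral_congr fun t ht => ?_
  rw [uIcc_of_le hr] at ht
  simp [hEq ht]

lemma profile_congr {r : ℝ} (hr : l ≤ r) (hEq : EqOn h h' (Icc l r)) :
    profile l ψ ρ c h r = profile l ψ ρ c h' r := by
  unfold profile
  congr 1
  refine intervalIntegral.integral_congr fun t ht => ?_
  rw [uIcc_of_le hr] at ht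
  rw [flux_congr ht.1 (hEq.mono (Icc_subset_Icc_right ht.2))]

lemma flux_mono (hρ : Continuous ρ) (hρpos : ∀ t, 0 < ρ t) (hh : Continuous h)
    (hh' : Continuous h') {r : ℝ} (hr : l ≤ r) (hle : ∀ t ∈ Icc l r, h t ≤ h' t) :
    flux l ρ h r ≤ flux l ρ h' r :=
  intervalIntegral.integral_mono_on hr ((hρ.mul hh).intervalIntegrable _ _)
    ((hρ.mul hh').intervalIntegrable _ _)
    fun t ht => mul_le_mul_of_nonneg_left (hle t ht) (hρpos t).le

lemma flux_lt_flux (hρ : Continuous ρ) (hρpos : ∀ t, 0 < ρ t) (hh : Continuous h)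
    (hh' : Continuous h') {r : ℝ} (hr : l < r) (hlt : ∀ t ∈ Icc l r, h t < h' t) :
    flux l ρ h r < flux l ρ h' r :=
  intervalIntegral.integral_lt_integral_of_continuousOn_of_le_of_exists_lt hr
    (hρ.mul hh).continuousOn (hρ.mul hh').continuousOn
    (fun t ht => mul_le_mul_of_nonneg_left (hlt t (Ioc_subset_Icc_self ht)).le (hρpos t).le)
    ⟨l, left_mem_Icc.2 hr.le,
      mul_lt_mul_of_pos_left (hlt l (left_mem_Icc.2 hr.le)) (hρpos l)⟩

lemma flux_sub_flux (hρ : Continuous ρ) (hh : Continuous h) (s t : ℝ) :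
    flux l ρ h t - flux l ρ h s = flux s ρ h t :=
  intervalIntegral.integral_interval_sub_left ((hρ.mul hh).intervalIntegrable _ _)
    ((hρ.mul hh).intervalIntegrable _ _)

/-- A forcing bounded above whose total flux is nonnegative has a bounded flux. -/
lemma abs_flux_le_of_le (hρ : Continuous ρ) (hρpos : ∀ t, 0 < ρ t) (hh : Continuous h)
    {K : ℝ} (hK : 0 ≤ K) (hle : ∀ t ∈ Icc l R, h t ≤ K) (hR : 0 ≤ flux l ρ h R) :
    ∀ t ∈ Icc l R, |flux l ρ h t| ≤ flux l ρ (fun _ => K) R := by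
  intro t ht
  have h0 (s t : ℝ) (hst : s ≤ t) : 0 ≤ flux s ρ (fun _ => K) t :=
    intervalIntegral.integral_nonneg hst fun u _ => mul_nonneg (hρpos u).le hK
  have h1 := flux_mono (l := l) hρ hρpos hh (continuous_const (y := K)) ht.1
    fun u hu => hle u ⟨hu.1, hu.2.trans ht.2⟩
  have h2 := flux_mono (l := t) hρ hρpos hh (continuous_const (y := K)) ht.2
    fun u hu => hle u ⟨ht.1.trans hu.1, hu.2⟩
  have h3 := flux_sub_flux (l := l) hρ hh t R
  have h4 := flux_sub_flux (l := l) hρ (continuous_const (y := K)) t R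
  have h5 := h0 l t ht.1
  have h6 := h0 t R ht.2
  rw [abs_le]
  constructor <;> linarith

lemma abs_flux_le_of_abs_le (hρ : Continuous ρ) (hρpos : ∀ t, 0 < ρ t) (hh : Continuous h)
    {K : ℝ} (hK : 0 ≤ K) (hle : ∀ t ∈ Icc l R, |h t| ≤ K) :
    ∀ t ∈ Icc l R, |flux l ρ h t| ≤ flux l ρ (fun _ => K) R := by
  intro t ht
  have h0 : 0 ≤ flux t ρ (fun _ => K) R :=
    intervalIntegral.integral_nonneg ht.2 fun u _ => mul_nonneg (hρpos u).le hK
  have h1 := flux_mono (l := l) hρ hρpos hh (continuous_const (y := K)) ht.1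
    fun u hu => (abs_le.1 (hle u ⟨hu.1, hu.2.trans ht.2⟩)).2
  have h2 := flux_mono (l := l) hρ hρpos (continuous_const (y := -K)) hh ht.1
    fun u hu => (abs_le.1 (hle u ⟨hu.1, hu.2.trans ht.2⟩)).1
  have h4 := flux_sub_flux (l := l) hρ (continuous_const (y := K)) t R
  have h5 : flux l ρ (fun _ => -K) t = - flux l ρ (fun _ => K) t := by
    simp [flux]
  rw [abs_le]
  constructor <;> linarith

/-- Profiles with uniformly bounded flux are uniformly Lipschitz. -/
lemma exists_lipschitz_profile (hlR : l ≤ R) (hψ : Continuous ψ) (hψm : StrictMono ψ)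
    (hρ : Continuous ρ) (hρpos : ∀ t, 0 < ρ t) (F : ℝ) :
    ∃ D, 0 ≤ D ∧ ∀ c h, Continuous h → (∀ t ∈ Icc l R, |flux l ρ h t| ≤ F) →
      ∀ r ∈ Icc l R, ∀ r' ∈ Icc l R,
        |profile l ψ ρ c h r - profile l ψ ρ c h r'| ≤ D * |r - r'| := by
  obtain ⟨x, hx, hmin⟩ := isCompact_Icc.exists_isMinOn (nonempty_Icc.2 hlR) hρ.continuousOn
  refine ⟨max |ψ (F / ρ x)| |ψ (-(F / ρ x))|, le_max_of_le_left (abs_nonneg _), ?_⟩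
  intro c h hh hF r hr r' hr'
  have hder (t : ℝ) (ht : t ∈ Icc l R) :
      ‖ψ (flux l ρ h t / ρ t)‖ ≤ max |ψ (F / ρ x)| |ψ (-(F / ρ x))| := by
    have hFt := hF t ht
    have hF0 : 0 ≤ F := (abs_nonneg _).trans hFt
    have h1 : |flux l ρ h t / ρ t| ≤ F / ρ x := by
      rw [abs_div, abs_of_pos (hρpos t)]
      exact div_le_div₀ hF0 hFt (hρpos x) (hmin ht)
    rw [abs_le] at h1
    rw [Real.norm_eq_abs]
    rw [max_comm]
    exact abs_le_max_abs_abs (hψm.monotone h1.1) (hψm.monotone h1.2)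
  have := (convex_Icc l R).norm_image_sub_le_of_norm_hasDerivWithin_le
    (fun t _ => (hasDerivAt_profile (l := l) (c := c) hψ hρ hρpos hh t).hasDerivWithinAt)
    hder hr' hr
  simpa [Real.norm_eq_abs] using this

/-- A profile that is forced strictly more than `β` wherever it is above `β`, both having
vanishing total flux, stays strictly below `β`. -/
lemma profile_lt_of_forcing_lt {d : ℝ} (hlR : l < R) (hψ : Continuous ψ) (hψm : StrictMono ψ)
    (hρ : Continuous ρ) (hρpos : ∀ t, 0 < ρ t) (hh : Continuous h) (hh' : Continuous h')
    (hR : flux l ρ h R = 0) (hR' : flux l ρ h' R = 0)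
    (hlt : ∀ r ∈ Icc l R, profile l ψ ρ d h' r ≤ profile l ψ ρ c h r → h' r < h r) :
    ∀ r ∈ Icc l R, profile l ψ ρ c h r < profile l ψ ρ d h' r := by
  set g : ℝ → ℝ := fun r => profile l ψ ρ c h r - profile l ψ ρ d h' r with hg
  have hgd (r : ℝ) : HasDerivAt g (ψ (flux l ρ h r / ρ r) - ψ (flux l ρ h' r / ρ r)) r :=
    (hasDerivAt_profile hψ hρ hρpos hh r).sub (hasDerivAt_profile hψ hρ hρpos hh' r)
  have hgc : Continuous g := continuous_iff_continuousAt.2 fun r => (hgd r).continuousAt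
  obtain ⟨x, hx, hmax⟩ := isCompact_Icc.exists_isMaxOn (nonempty_Icc.2 hlR.le) hgc.continuousOn
  suffices hgx : g x < 0 by
    intro r hr
    exact sub_neg.1 ((hmax hr).trans_lt hgx)
  by_contra! hgx
  have hpos : 0 < h x - h' x := sub_pos.2 (hlt x hx (sub_nonneg.1 hgx))
  obtain ⟨ε, hε, hball⟩ := Metric.eventually_nhds_iff.1
    ((hh.sub hh').continuousAt.eventually (lt_mem_nhds hpos))
  have hflux : flux l ρ h x = flux l ρ h' x := by
    rcases eq_or_lt_of_le hx.1 with rfl | hlx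
    · simp
    rcases eq_or_lt_of_le hx.2 with rfl | hxR
    · rw [hR, hR']
    have h1 := (hmax.isLocalMax (Icc_mem_nhds hlx hxR)).hasDerivAt_eq_zero (hgd x)
    exact (div_left_inj' (hρpos x).ne').1 (hψm.injective (sub_eq_zero.1 h1))
  rcases eq_or_lt_of_le hx.2 with rfl | hxR
  · -- the maximum is attained at the right endpoint
    set y := max l (x - ε / 2) with hy
    have hyx : y < x := max_lt hlR (by linarith)
    have hyl : l ≤ y := le_max_left _ _
    have hyε : x - ε / 2 ≤ y := le_max_right _ _
    have hanti : StrictAntiOn g (Icc y x) := by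
      refine strictAntiOn_of_deriv_neg (convex_Icc _ _) hgc.continuousOn fun t ht => ?_
      rw [interior_Icc] at ht
      rw [(hgd t).deriv, sub_neg]
      apply hψm
      gcongr
      · exact hρpos t
      have h1 := flux_lt_flux (l := t) hρ hρpos hh' hh ht.2 fun u hu => by
        have := @hball u (by rw [Real.dist_eq, abs_lt]; constructor <;> linarith [hu.1, hu.2, ht.1])
        exact sub_pos.1 this
      have h2 := flux_sub_flux (l := l) hρ hh t x
      have h3 := flux_sub_flux (l := l) hρ hh' t x
      linarith
    have h4 := hanti (left_mem_Icc.2 hyx.le) (right_mem_Icc.2 hyx.le) hyx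
    exact absurd (hmax (show y ∈ Icc l x from ⟨hyl, hyx.le⟩)) (not_le.2 h4)
  · set y := min R (x + ε / 2) with hy
    have hyx : x < y := lt_min hxR (by linarith)
    have hyl : y ≤ R := min_le_left _ _
    have hyε : y ≤ x + ε / 2 := min_le_right _ _
    have hmono : StrictMonoOn g (Icc x y) := by
      refine strictMonoOn_of_deriv_pos (convex_Icc _ _) hgc.continuousOn fun t ht => ?_
      rw [interior_Icc] at ht
      rw [(hgd t).deriv, sub_pos]
      apply hψm
      gcongr
      · exact hρpos t
      have h1 := flux_lt_flux (l := x) hρ hρpos hh' hh ht.1 fun u hu => by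
        have := @hball u (by rw [Real.dist_eq, abs_lt]; constructor <;> linarith [hu.1, hu.2, ht.2])
        exact sub_pos.1 this
      have h2 := flux_sub_flux (l := l) hρ hh x t
      have h3 := flux_sub_flux (l := l) hρ hh' x t
      linarith
    have h4 := hmono (left_mem_Icc.2 hyx.le) (right_mem_Icc.2 hyx.le) hyx
    exact absurd (hmax (show y ∈ Icc l R from ⟨hx.1.trans hyx.le, hyl⟩)) (not_le.2 h4)

end Basic

section Limit

variable {l R : ℝ} {ψ ρ : ℝ → ℝ}

/-- Uniformly bounded and uniformly Lipschitz functions on a compact interval have a uniformly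
convergent subsequence. -/
lemma exists_subseq_tendstoUniformlyOn (hlR : l ≤ R) {V : ℕ → ℝ → ℝ} {B D : ℝ}
    (hB : ∀ n, ∀ r ∈ Icc l R, |V n r| ≤ B)
    (hD : ∀ n, ∀ r ∈ Icc l R, ∀ r' ∈ Icc l R, |V n r - V n r'| ≤ D * |r - r'|) :
    ∃ (σ : ℕ → ℕ) (v : ℝ → ℝ), StrictMono σ ∧ Continuous v ∧
      TendstoUniformlyOn (fun k => V (σ k)) v atTop (Icc l R) := by
  have hDn : (0 : ℝ) ≤ max D 0 := le_max_right _ _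
  have hlip (n : ℕ) : LipschitzWith (max D 0).toNNReal fun r : Icc l R => V n r := by
    refine LipschitzWith.of_dist_le_mul fun x y => ?_
    rw [Real.coe_toNNReal _ hDn, Real.dist_eq, Subtype.dist_eq, Real.dist_eq]
    exact (hD n x x.2 y y.2).trans (by gcongr; exact le_max_left _ _)
  let W (n : ℕ) : BoundedContinuousFunction (Icc l R) ℝ :=
    BoundedContinuousFunction.mkOfCompact ⟨fun r => V n r, (hlip n).continuous⟩
  have hcomp : IsCompact (closure (range W)) := by
    refine BoundedContinuousFunction.arzela_ascoli (Icc (-B) B) isCompact_Icc _ ?_ ?_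
    · rintro _ x ⟨n, rfl⟩
      exact abs_le.1 (hB n x x.2)
    · refine (LipschitzWith.uniformEquicontinuous _ (max D 0).toNNReal ?_).equicontinuous
      rintro ⟨_, n, rfl⟩
      exact hlip n
  obtain ⟨v, -, σ, hσ, hv⟩ := hcomp.tendsto_subseq fun n => subset_closure (mem_range_self n)
  refine ⟨σ, fun r => v (projIcc l R hlR r), hσ, v.continuous.comp continuous_projIcc, ?_⟩
  rw [BoundedContinuousFunction.tendsto_iff_tendstoUniformly] at hv
  rw [Metric.tendstoUniformlyOn_iff]
  rw [Metric.tendstoUniformly_iff] at hv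
  intro ε hε
  filter_upwards [hv ε hε] with k hk r hr
  have := hk ⟨r, hr⟩
  rw [projIcc_of_mem hlR hr]
  exact this

/-- Fluxes pass to the limit under bounded pointwise convergence of the forcing. -/
lemma tendsto_flux (hρ : Continuous ρ) {h : ℕ → ℝ → ℝ} {g : ℝ → ℝ} {K : ℝ}
    (hh : ∀ n, Continuous (h n)) (hK : ∀ n, ∀ r ∈ Icc l R, |h n r| ≤ K)
    (hlim : ∀ r ∈ Icc l R, Tendsto (fun n => h n r) atTop (𝓝 (g r))) :
    ∀ r ∈ Icc l R, Tendsto (fun n => flux l ρ (h n) r) atTop (𝓝 (flux l ρ g r)) := by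
  intro r hr
  have hsub : ∀ t ∈ uIoc l r, t ∈ Icc l R := fun t ht => by
    rw [uIoc_of_le hr.1] at ht
    exact ⟨ht.1.le, ht.2.trans hr.2⟩
  refine intervalIntegral.tendsto_integral_filter_of_dominated_convergence (fun t => |ρ t| * K)
    (.of_forall fun n => (hρ.mul (hh n)).aestronglyMeasurable)
    (.of_forall fun n => .of_forall fun t ht => ?_)
    ((hρ.abs.mul continuous_const).intervalIntegrable _ _)
    (.of_forall fun t ht => (hlim t (hsub t ht)).const_mul _)
  rw [Real.norm_eq_abs, abs_mul]
  exact mul_le_mul_of_nonneg_left (hK n t (hsub t ht)) (abs_nonneg _)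

/-- Profiles pass to the limit under bounded pointwise convergence of the forcing. -/
lemma tendsto_profile (hψ : Continuous ψ) (hψm : StrictMono ψ)
    (hρ : Continuous ρ) (hρpos : ∀ t, 0 < ρ t) {c : ℕ → ℝ} {d : ℝ} {h : ℕ → ℝ → ℝ}
    {g : ℝ → ℝ} {K : ℝ} (hh : ∀ n, Continuous (h n)) (hK : ∀ n, ∀ r ∈ Icc l R, |h n r| ≤ K)
    (hc : Tendsto c atTop (𝓝 d))
    (hlim : ∀ r ∈ Icc l R, Tendsto (fun n => h n r) atTop (𝓝 (g r))) :
    ∀ r ∈ Icc l R,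
      Tendsto (fun n => profile l ψ ρ (c n) (h n) r) atTop (𝓝 (profile l ψ ρ d g r)) := by
  intro r hr
  have hsub : ∀ t ∈ uIoc l r, t ∈ Icc l R := fun t ht => by
    rw [uIoc_of_le hr.1] at ht
    exact ⟨ht.1.le, ht.2.trans hr.2⟩
  have hlR : l ≤ R := hr.1.trans hr.2
  have hK0 : 0 ≤ K := (abs_nonneg _).trans (hK 0 r hr)
  set F := flux l ρ (fun _ => K) R
  have hF (n : ℕ) := abs_flux_le_of_abs_le hρ hρpos (hh n) hK0 (hK n)
  refine hc.add (intervalIntegral.tendsto_integral_filter_of_dominated_convergence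
    (fun t => max |ψ (-(F / ρ t))| |ψ (F / ρ t)|)
    (.of_forall fun n => (continuous_slope hψ hρ hρpos (hh n)).aestronglyMeasurable)
    (.of_forall fun n => .of_forall fun t ht => ?_) ?_
    (.of_forall fun t ht => ?_))
  · have h1 : |flux l ρ (h n) t / ρ t| ≤ F / ρ t := by
      rw [abs_div, abs_of_pos (hρpos t)]
      exact div_le_div_of_nonneg_right (hF n t (hsub t ht)) (hρpos t).le
    rw [abs_le] at h1
    exact abs_le_max_abs_abs (hψm.monotone h1.1) (hψm.monotone h1.2)
  · have h1 : Continuous fun t => F / ρ t := continuous_const.div hρ fun t => (hρpos t).ne'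
    exact ((hψ.comp h1.neg).abs.max (hψ.comp h1).abs).intervalIntegrable _ _
  · exact (hψ.tendsto _).comp ((tendsto_flux hρ hh hK hlim t (hsub t ht)).div_const _)

end Limit

/-- `v` solves `(ρ ψ⁻¹(v'))' = ρ f(r, v)` on `[l, R]` with Neumann boundary conditions. -/
structure NeumannSol (l R : ℝ) (ψ ρ : ℝ → ℝ) (f : ℝ → ℝ → ℝ) (v : ℝ → ℝ) : Prop where
  cont : Continuous v
  eq_profile : ∀ r ∈ Icc l R, v r = profile l ψ ρ (v l) (fun τ => f τ (v τ)) r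
  flux_eq_zero : flux l ρ (fun τ => f τ (v τ)) R = 0

section Delay

variable {l R : ℝ} {ψ ρ : ℝ → ℝ} {f : ℝ → ℝ → ℝ}

/-- The forcing `f(r, u(r - δ))`, with the argument `r - δ` truncated at `l`. -/
def delayed (l δ : ℝ) (f : ℝ → ℝ → ℝ) (u : ℝ → ℝ) (τ : ℝ) : ℝ := f τ (u (max l (τ - δ)))

lemma continuous_delayed {δ : ℝ} {u : ℝ → ℝ} (hf : Continuous f.uncurry) (hu : Continuous u) :
    Continuous (delayed l δ f u) :=
  hf.comp (continuous_id.prodMk (hu.comp (by fun_prop)))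

lemma continuous_delayed_family {δ : ℝ} {V : ℝ → ℝ → ℝ} (hf : Continuous f.uncurry)
    (hV : Continuous V.uncurry) : Continuous fun p : ℝ × ℝ => delayed l δ f (V p.1) p.2 := by
  have h : Continuous fun p : ℝ × ℝ => max l (p.2 - δ) := by fun_prop
  exact hf.comp (continuous_snd.prodMk (hV.comp (continuous_fst.prodMk h)))

lemma continuous_flux_delayed {δ : ℝ} {V : ℝ → ℝ → ℝ} (hρ : Continuous ρ)
    (hf : Continuous f.uncurry) (hV : Continuous V.uncurry) :
    Continuous fun p : ℝ × ℝ => flux l ρ (delayed l δ f (V p.1)) p.2 := by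
  refine intervalIntegral.continuous_parametric_intervalIntegral_of_continuous
    (f := fun (p : ℝ × ℝ) τ => ρ τ * delayed l δ f (V p.1) τ) ?_ continuous_snd
  exact (hρ.comp continuous_snd).mul ((continuous_delayed_family hf hV).comp
    ((continuous_fst.comp continuous_fst).prodMk continuous_snd))

lemma max_sub_mem_Icc {δ τ : ℝ} (hδ : 0 ≤ δ) (hτ : τ ∈ Icc l R) : max l (τ - δ) ∈ Icc l R :=
  ⟨le_max_left _ _, max_le (hτ.1.trans hτ.2) (by linarith [hτ.2])⟩

lemma delayed_profile_step {δ x c : ℝ} {u₁ u₂ : ℝ → ℝ}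
    (hx : l ≤ x) (h : EqOn u₁ u₂ (Icc l x)) {r : ℝ} (hr : r ∈ Icc l (x + δ)) :
    profile l ψ ρ c (delayed l δ f u₁) r = profile l ψ ρ c (delayed l δ f u₂) r := by
  refine profile_congr hr.1 fun τ hτ => ?_
  unfold delayed
  rw [h ⟨le_max_left _ _, max_le hx (by linarith [hτ.2, hr.2])⟩]

/-- Delayed initial value problems have at most one solution. -/
lemma delayed_unique {δ c : ℝ} (hδ : 0 < δ) {u₁ u₂ : ℝ → ℝ}
    (h₁ : ∀ r ∈ Icc l R, u₁ r = profile l ψ ρ c (delayed l δ f u₁) r)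
    (h₂ : ∀ r ∈ Icc l R, u₂ r = profile l ψ ρ c (delayed l δ f u₂) r) :
    EqOn u₁ u₂ (Icc l R) := by
  have key (k : ℕ) : ∀ r ∈ Icc l R, r ≤ l + k * δ → u₁ r = u₂ r := by
    induction k with
    | zero =>
      intro r hr hrk
      have : r = l := le_antisymm (by simpa using hrk) hr.1
      subst this
      rw [h₁ r hr, h₂ r hr]
      simp
    | succ k ih =>
      intro r hr hrk
      rw [h₁ r hr, h₂ r hr]
      refine profile_congr hr.1 fun τ hτ => ?_
      have hk : (0 : ℝ) ≤ k * δ := by positivity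
      push_cast at hrk
      unfold delayed
      rw [ih _ (max_sub_mem_Icc hδ.le ⟨hτ.1, hτ.2.trans hr.2⟩)
        (max_le (by linarith) (by linarith [hτ.2]))]
  intro r hr
  obtain ⟨k, hk⟩ := exists_nat_ge ((r - l) / δ)
  rw [div_le_iff₀ hδ] at hk
  exact key k r hr (by linarith)

/-- Delayed initial value problems are solvable, continuously in the initial value. -/
lemma exists_delayed (hψ : Continuous ψ) (hρ : Continuous ρ) (hρpos : ∀ t, 0 < ρ t)
    (hf : Continuous f.uncurry) {δ : ℝ} (hδ : 0 < δ) :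
    ∃ V : ℝ → ℝ → ℝ, Continuous V.uncurry ∧
      ∀ c, ∀ r ∈ Icc l R, V c r = profile l ψ ρ c (delayed l δ f (V c)) r := by
  let Φ (U : ℝ → ℝ → ℝ) (c r : ℝ) : ℝ := profile l ψ ρ c (delayed l δ f (U c)) r
  let U (k : ℕ) : ℝ → ℝ → ℝ := Φ^[k] fun c _ => c
  have hsucc (k : ℕ) (c r : ℝ) : U (k + 1) c r = profile l ψ ρ c (delayed l δ f (U k c)) r := by
    simp only [U, Function.iterate_succ_apply']
    rfl
  have hcont (k : ℕ) : Continuous (U k).uncurry := by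
    induction k with
    | zero => exact continuous_fst
    | succ k ih =>
      have h1 := continuous_flux_delayed (l := l) (δ := δ) hρ hf ih
      have h2 : Continuous fun p : ℝ × ℝ =>
          ψ (flux l ρ (delayed l δ f (U k p.1)) p.2 / ρ p.2) :=
        hψ.comp (h1.div (hρ.comp continuous_snd) fun p => (hρpos p.2).ne')
      have h3 : (U (k + 1)).uncurry =
          fun p : ℝ × ℝ => profile l ψ ρ p.1 (delayed l δ f (U k p.1)) p.2 :=
        funext fun p => hsucc k p.1 p.2
      rw [h3]
      refine continuous_fst.add
        (intervalIntegral.continuous_parametric_intervalIntegral_of_continuous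
          (f := fun (p : ℝ × ℝ) t => ψ (flux l ρ (delayed l δ f (U k p.1)) t / ρ t)) ?_
          continuous_snd)
      exact h2.comp ((continuous_fst.comp continuous_fst).prodMk continuous_snd)
  have hstab (c : ℝ) (k : ℕ) : EqOn (U (k + 1) c) (U k c) (Icc l (l + k * δ)) := by
    induction k with
    | zero =>
      intro r hr
      have : r = l := le_antisymm (by simpa using hr.2) hr.1
      subst this
      rw [hsucc, profile_self]
      rfl
    | succ k ih =>
      intro r hr
      have hk : (0 : ℝ) ≤ k * δ := by positivity
      rw [hsucc, hsucc]
      refine delayed_profile_step (by linarith) ih ?_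
      have := hr.2
      push_cast at this
      exact ⟨hr.1, by linarith⟩
  obtain ⟨k, hk⟩ := exists_nat_ge ((R - l) / δ)
  rw [div_le_iff₀ hδ] at hk
  refine ⟨U k, hcont k, fun c r hr => ?_⟩
  rw [← hsucc, hstab c k ⟨hr.1, by linarith [hr.2]⟩]

/-- Solutions of delayed problems with vanishing total flux accumulate, as the delay tends to
zero, at solutions of the Neumann problem. -/
lemma exists_neumannSol_of_delayed (hlR : l ≤ R) (hψ : Continuous ψ) (hψm : StrictMono ψ)
    (hρ : Continuous ρ) (hρpos : ∀ t, 0 < ρ t) (hf : Continuous f.uncurry)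
    {K C : ℝ} (hK : ∀ r u, |f r u| ≤ K) {δ c : ℕ → ℝ} {V : ℕ → ℝ → ℝ}
    (hδ : ∀ n, 0 ≤ δ n) (hδ0 : Tendsto δ atTop (𝓝 0)) (hc : ∀ n, |c n| ≤ C)
    (hVc : ∀ n, Continuous (V n))
    (hV : ∀ n, ∀ r ∈ Icc l R, V n r = profile l ψ ρ (c n) (delayed l (δ n) f (V n)) r)
    (hV0 : ∀ n, flux l ρ (delayed l (δ n) f (V n)) R = 0) :
    ∃ (σ : ℕ → ℕ) (v : ℝ → ℝ), StrictMono σ ∧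
      TendstoUniformlyOn (fun k => V (σ k)) v atTop (Icc l R) ∧ NeumannSol l R ψ ρ f v := by
  have hK0 : 0 ≤ K := (abs_nonneg _).trans (hK 0 0)
  have hdc (n : ℕ) : Continuous (delayed l (δ n) f (V n)) := continuous_delayed hf (hVc n)
  obtain ⟨D, hD0, hD⟩ := exists_lipschitz_profile hlR hψ hψm hρ hρpos (flux l ρ (fun _ => K) R)
  have hlip (n : ℕ) : ∀ r ∈ Icc l R, ∀ r' ∈ Icc l R, |V n r - V n r'| ≤ D * |r - r'| := by
    intro r hr r' hr'
    rw [hV n r hr, hV n r' hr']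
    exact hD _ _ (hdc n)
      (abs_flux_le_of_abs_le hρ hρpos (hdc n) hK0 fun _ _ => hK _ _) r hr r' hr'
  have hl : l ∈ Icc l R := left_mem_Icc.2 hlR
  have hVl (n : ℕ) : V n l = c n := by rw [hV n l hl, profile_self]
  have hbd (n : ℕ) : ∀ r ∈ Icc l R, |V n r| ≤ C + D * (R - l) := by
    intro r hr
    have h1 := hlip n r hr l hl
    have h2 : D * |r - l| ≤ D * (R - l) := by
      rw [abs_of_nonneg (sub_nonneg.2 hr.1)]
      gcongr
      exact hr.2
    have h3 := hc n
    rw [← hVl n] at h3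
    have h4 := abs_sub_abs_le_abs_sub (V n r) (V n l)
    linarith
  obtain ⟨σ, v, hσ, hvc, hv⟩ := exists_subseq_tendstoUniformlyOn hlR hbd hlip
  refine ⟨σ, v, hσ, hv, ?_⟩
  have hlim : ∀ r ∈ Icc l R, Tendsto (fun k => delayed l (δ (σ k)) f (V (σ k)) r) atTop
      (𝓝 (f r (v r))) := by
    intro r hr
    have h1 : Tendsto (fun k => max l (r - δ (σ k))) atTop (𝓝[Icc l R] r) := by
      refine tendsto_nhdsWithin_iff.2 ⟨?_, .of_forall fun k => max_sub_mem_Icc (hδ _) hr⟩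
      have := (tendsto_const_nhds (x := l)).max
        ((tendsto_const_nhds (x := r)).sub (hδ0.comp hσ.tendsto_atTop))
      simpa [max_eq_right hr.1] using this
    have h2 := hv.tendsto_comp hvc.continuousWithinAt h1
    exact (hf.tendsto (r, v r)).comp ((tendsto_const_nhds (x := r)).prodMk_nhds h2)
  have hflux := tendsto_flux hρ (fun k => hdc (σ k)) (fun k r _ => hK _ _) hlim R
    (right_mem_Icc.2 hlR)
  have hcl : Tendsto (fun k => c (σ k)) atTop (𝓝 (v l)) := by
    simpa only [hVl] using hv.tendsto_at hl
  refine ⟨hvc, ?_, ?_⟩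
  · intro r hr
    refine tendsto_nhds_unique (hv.tendsto_at hr) ?_
    refine (tendsto_profile hψ hψm hρ hρpos (fun k => hdc (σ k)) (fun k r _ => hK _ _)
      hcl hlim r hr).congr fun k => ?_
    exact (hV (σ k) r hr).symm
  · refine tendsto_nhds_unique hflux ?_
    simp [hV0]

end Delay

section TwoSolutions

variable {l R : ℝ} {ψ ρ : ℝ → ℝ} {f : ℝ → ℝ → ℝ}

lemma exists_last_zero {T : ℝ → ℝ} (hT : Continuous T) {a b : ℝ} (ha : ∀ x ≤ a, T x < 0)
    (hb : ∀ x, b ≤ x → 0 < T x) :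
    ∃ c ∈ Ioo a b, T c = 0 ∧ ∀ x, c < x → 0 < T x := by
  have hne : ({x | T x ≤ 0} : Set ℝ).Nonempty := ⟨a, (ha a le_rfl).le⟩
  have hbdd : BddAbove {x | T x ≤ 0} :=
    ⟨b, fun x hx => le_of_not_ge fun hbx => (hb x hbx).not_ge hx⟩
  have hmem : T (sSup {x | T x ≤ 0}) ≤ 0 :=
    (isClosed_le hT continuous_const).csSup_mem hne hbdd
  have hafter : ∀ x, sSup {x | T x ≤ 0} < x → 0 < T x := fun x hx =>
    not_le.1 fun h => (le_csSup hbdd h).not_gt hx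
  have hzero : T (sSup {x | T x ≤ 0}) = 0 := by
    refine le_antisymm hmem ?_
    refine ge_of_tendsto (hT.continuousAt.tendsto.mono_left
      (nhdsWithin_le_nhds (s := Ioi (sSup {x | T x ≤ 0})))) ?_
    filter_upwards [self_mem_nhdsWithin] with x hx using (hafter x hx).le
  refine ⟨_, ⟨?_, ?_⟩, hzero, hafter⟩
  · exact not_le.1 fun h => (ha _ h).ne hzero
  · exact not_le.1 fun h => (hb _ h).ne' hzero

/-- The nonlinearity `f` frozen above the barrier `β`. -/
def frozenAbove (f : ℝ → ℝ → ℝ) (β : ℝ → ℝ) (r u : ℝ) : ℝ := f r (min u (β r))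

lemma continuous_frozenAbove {β : ℝ → ℝ} (hf : Continuous f.uncurry) (hβ : Continuous β) :
    Continuous (frozenAbove f β).uncurry :=
  hf.comp (continuous_fst.prodMk (continuous_snd.min (hβ.comp continuous_fst)))

/-- The last zero of the shooting map of the frozen problem, if its trajectory stays below the
barrier, is followed by a zero of the original shooting map whose trajectory crosses the
barrier. -/
lemma exists_crossing_zero (hlR : l ≤ R) (hρ : Continuous ρ) (hf : Continuous f.uncurry)
    {β : ℝ → ℝ} (hβ : Continuous β) {δ : ℝ} (hδ : 0 < δ) {V U : ℝ → ℝ → ℝ}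
    (hVc : Continuous V.uncurry) (hUc : Continuous U.uncurry)
    (hV : ∀ c, ∀ r ∈ Icc l R, V c r = profile l ψ ρ c (delayed l δ f (V c)) r)
    (hU : ∀ c, ∀ r ∈ Icc l R, U c r = profile l ψ ρ c (delayed l δ (frozenAbove f β) (U c)) r)
    {c M : ℝ} (hcM : c < M)
    (hlast : ∀ x, c < x → 0 < flux l ρ (delayed l δ (frozenAbove f β) (U x)) R)
    (hbelow : ∀ τ ∈ Icc l R, U c (max l (τ - δ)) < β τ)
    (hM : flux l ρ (delayed l δ f (V M)) R < 0) :
    ∃ x ∈ Ioo c M, flux l ρ (delayed l δ f (V x)) R = 0 ∧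
      ∃ τ ∈ Icc l R, β τ < V x (max l (τ - δ)) := by
  have hcongr {W : ℝ → ℝ} (hW : ∀ τ ∈ Icc l R, W (max l (τ - δ)) ≤ β τ) :
      EqOn (delayed l δ (frozenAbove f β) W) (delayed l δ f W) (Icc l R) := by
    intro τ hτ
    simp only [delayed, frozenAbove, min_eq_left (hW τ hτ)]
  have hfluxeq {x : ℝ} (hEq : EqOn (U x) (V x) (Icc l R)) (g : ℝ → ℝ → ℝ) :
      flux l ρ (delayed l δ g (U x)) R = flux l ρ (delayed l δ g (V x)) R := by
    refine flux_congr hlR fun τ hτ => ?_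
    simp only [delayed, hEq (max_sub_mem_Icc hδ.le hτ)]
  have hUV {x : ℝ} (hx : ∀ τ ∈ Icc l R, U x (max l (τ - δ)) ≤ β τ) :
      flux l ρ (delayed l δ f (V x)) R = flux l ρ (delayed l δ (frozenAbove f β) (U x)) R := by
    have hEq : EqOn (U x) (V x) (Icc l R) := by
      refine delayed_unique (f := f) hδ (fun r hr => ?_) (hV x)
      rw [hU x r hr]
      exact profile_congr hr.1 ((hcongr hx).mono (Icc_subset_Icc_right hr.2))
    rw [flux_congr hlR (hcongr hx), hfluxeq hEq]
  have hVU {x : ℝ} (hx : ∀ τ ∈ Icc l R, V x (max l (τ - δ)) ≤ β τ) :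
      flux l ρ (delayed l δ f (V x)) R = flux l ρ (delayed l δ (frozenAbove f β) (U x)) R := by
    have hEq : EqOn (U x) (V x) (Icc l R) := by
      refine delayed_unique (f := frozenAbove f β) hδ (hU x) (fun r hr => ?_)
      rw [hV x r hr]
      exact (profile_congr hr.1 ((hcongr hx).mono (Icc_subset_Icc_right hr.2))).symm
    rw [← flux_congr hlR (hcongr hx), hfluxeq hEq]
  have hopen : ∀ᶠ x in 𝓝 c, ∀ τ ∈ Icc l R, U x (max l (τ - δ)) < β τ := by
    refine isCompact_Icc.eventually_forall_of_forall_eventually fun τ hτ => ?_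
    have h0 : Continuous fun z : ℝ × ℝ => max l (z.2 - δ) := by fun_prop
    have h1 : Continuous fun z : ℝ × ℝ => U z.1 (max l (z.2 - δ)) :=
      hUc.comp (continuous_fst.prodMk h0)
    exact h1.continuousAt.eventually_lt (hβ.comp continuous_snd).continuousAt (hbelow τ hτ)
  obtain ⟨y, hy, hcy, hyM⟩ := ((hopen.filter_mono (nhdsWithin_le_nhds (s := Ioi c))).and
    (Ioo_mem_nhdsGT hcM)).exists
  have hy0 := hlast y hcy
  rw [← hUV fun τ hτ => (hy τ hτ).le] at hy0
  have hTc : Continuous fun x => flux l ρ (delayed l δ f (V x)) R :=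
    (continuous_flux_delayed hρ hf hVc).comp (continuous_id.prodMk continuous_const)
  obtain ⟨x, hx, hx0⟩ := intermediate_value_Ioo' hyM.le hTc.continuousOn ⟨hM, hy0⟩
  refine ⟨x, ⟨hcy.trans hx.1, hx.2⟩, hx0, ?_⟩
  by_contra! hcon
  exact (hlast x (hcy.trans hx.1)).ne' ((hVU hcon).symm.trans hx0)

/-- A strict upper solution `β` separates two solutions of the Neumann problem, provided that
trajectories starting far away have negative total flux. -/
theorem exists_two_neumannSol (hlR : l < R) (hψ : Continuous ψ) (hψm : StrictMono ψ)
    (hρ : Continuous ρ) (hρpos : ∀ t, 0 < ρ t) (hf : Continuous f.uncurry)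
    {K E M d : ℝ} (hK : ∀ r u, |f r u| ≤ K) {b : ℝ → ℝ} (hb : Continuous b)
    (hb0 : flux l ρ b R = 0)
    (hbf : ∀ r ∈ Icc l R, b r < f r (profile l ψ ρ d b r))
    (hE : ∀ c (u : ℝ → ℝ), Continuous u → 0 ≤ flux l ρ (fun τ => f τ (u τ)) R →
      ∀ r ∈ Icc l R, |profile l ψ ρ c (fun τ => f τ (u τ)) r - c| ≤ E)
    (hM : ∀ c (u : ℝ → ℝ), Continuous u → M ≤ |c| → (∀ r ∈ Icc l R, |u r - c| ≤ E) →
      flux l ρ (fun τ => f τ (u τ)) R < 0)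
    (hβM : ∀ r ∈ Icc l R, |profile l ψ ρ d b r| + E < M) :
    ∃ v₁ v₂ : ℝ → ℝ, NeumannSol l R ψ ρ f v₁ ∧ NeumannSol l R ψ ρ f v₂ ∧
      ∃ r ∈ Icc l R, v₁ r ≠ v₂ r := by
  set β : ℝ → ℝ := profile l ψ ρ d b with hβ
  have hβc : Continuous β := continuous_profile hψ hρ hρpos hb
  have hl : l ∈ Icc l R := left_mem_Icc.2 hlR.le
  have hfrc : Continuous (frozenAbove f β).uncurry := continuous_frozenAbove hf hβc
  have hK0 : 0 ≤ K := (abs_nonneg _).trans (hK 0 0)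
  have hKfr : ∀ r u, |frozenAbove f β r u| ≤ K := fun r u => hK _ _
  let δ : ℕ → ℝ := fun n => 1 / ((n : ℝ) + 1)
  have hδ (n : ℕ) : 0 < δ n := Nat.one_div_pos_of_nat
  have hδ0 : Tendsto δ atTop (𝓝 0) := tendsto_one_div_add_atTop_nhds_zero_nat
  choose V hVc hV using fun n => exists_delayed (l := l) (R := R) hψ hρ hρpos hf (hδ n)
  choose U hUc hU using fun n => exists_delayed (l := l) (R := R) hψ hρ hρpos hfrc (hδ n)
  have hVc' (n : ℕ) (c : ℝ) : Continuous (V n c) := (hVc n).uncurry_left c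
  have hUc' (n : ℕ) (c : ℝ) : Continuous (U n c) := (hUc n).uncurry_left c
  have hmaxc (n : ℕ) : Continuous fun τ => max l (τ - δ n) := by fun_prop
  have hE0 : 0 ≤ M - E := by linarith [hβM l hl, abs_nonneg (β l)]
  -- shooting from far away gives a negative total flux
  have hVneg (n : ℕ) (c : ℝ) (hc : M ≤ |c|) : flux l ρ (delayed l (δ n) f (V n c)) R < 0 := by
    by_contra! hcon
    have hu := (hVc' n c).comp (hmaxc n)
    refine (hM c _ hu hc fun r hr => ?_).not_ge hcon
    have hr' := max_sub_mem_Icc (hδ n).le hr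
    have := hE c _ hu hcon _ hr'
    rwa [Function.comp_apply, hV n c _ hr']
  have hUneg (n : ℕ) (c : ℝ) (hc : c ≤ -M) :
      flux l ρ (delayed l (δ n) (frozenAbove f β) (U n c)) R < 0 := by
    by_contra! hcon
    have hu := (hUc' n c).comp (hmaxc n)
    have hu' : Continuous fun τ => min (U n c (max l (τ - δ n))) (β τ) := hu.min hβc
    have hnear : ∀ r ∈ Icc l R, |U n c (max l (r - δ n)) - c| ≤ E := fun r hr => by
      have hr' := max_sub_mem_Icc (hδ n).le hr
      rw [hU n c _ hr']
      exact hE c _ hu' hcon _ hr'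
    refine (hM c _ hu' (le_abs.2 (Or.inr (by linarith))) fun r hr => ?_).not_ge hcon
    rw [min_eq_left]
    · exact hnear r hr
    · have h1 := (abs_le.1 (hnear r hr)).2
      have h2 := hβM r hr
      have h3 := neg_abs_le (β r)
      linarith
  obtain ⟨D, hD0, hD⟩ := exists_lipschitz_profile hlR.le hψ hψm hρ hρpos
    (flux l ρ (fun _ => K) R)
  have hUpos (n : ℕ) (c : ℝ) (hc : M - E + D * (R - l) ≤ c) :
      0 < flux l ρ (delayed l (δ n) (frozenAbove f β) (U n c)) R := by
    have hdc : Continuous (delayed l (δ n) (frozenAbove f β) (U n c)) :=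
      continuous_delayed hfrc (hUc' n c)
    rw [← hb0]
    refine flux_lt_flux hρ hρpos hb hdc hlR fun τ hτ => ?_
    have hr' := max_sub_mem_Icc (hδ n).le hτ
    have h1 := hD c _ hdc (abs_flux_le_of_abs_le hρ hρpos hdc hK0 fun _ _ => hKfr _ _) _ hr' l hl
    rw [← hU n c _ hr', profile_self, abs_of_nonneg (sub_nonneg.2 hr'.1)] at h1
    have h2 : D * (max l (τ - δ n) - l) ≤ D * (R - l) := by gcongr; exact hr'.2
    have h3 := (abs_le.1 (h1.trans h2)).1
    have h4 := hβM τ hτ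
    have h5 := le_abs_self (β τ)
    have h6 : β τ ≤ U n c (max l (τ - δ n)) := by linarith
    simp only [delayed, frozenAbove, min_eq_right h6]
    exact hbf τ hτ
  have hUcont (n : ℕ) :
      Continuous fun c => flux l ρ (delayed l (δ n) (frozenAbove f β) (U n c)) R :=
    (continuous_flux_delayed hρ hfrc (hUc n)).comp (continuous_id.prodMk continuous_const)
  choose c hc hc0 hclast using fun n => exists_last_zero (hUcont n) (hUneg n) (hUpos n)
  obtain ⟨σ, v₁, hσ, hv₁, hsol⟩ := exists_neumannSol_of_delayed hlR.le hψ hψm hρ hρpos hfrc hKfr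
    (C := max M (M - E + D * (R - l))) (V := fun n => U n (c n)) (fun n => (hδ n).le) hδ0
    (fun n => abs_le.2 ⟨by linarith [(hc n).1, le_max_left M (M - E + D * (R - l))],
      (hc n).2.le.trans (le_max_right _ _)⟩)
    (fun n => hUc' n _) (fun n => hU n _) hc0
  have hv₁c := hsol.cont
  have hv₁β : ∀ r ∈ Icc l R, v₁ r < β r := by
    have hcont : Continuous fun τ => frozenAbove f β τ (v₁ τ) :=
      hfrc.comp (continuous_id.prodMk hv₁c)
    intro r hr
    rw [hsol.eq_profile r hr]
    refine profile_lt_of_forcing_lt hlR hψ hψm hρ hρpos hcont hb hsol.flux_eq_zero hb0 ?_ r hr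
    intro t ht hle
    rw [← hsol.eq_profile t ht] at hle
    simp only [frozenAbove, min_eq_right (show β t ≤ v₁ t from hle)]
    exact hbf t ht
  have hfr : EqOn (fun τ => frozenAbove f β τ (v₁ τ)) (fun τ => f τ (v₁ τ)) (Icc l R) :=
    fun τ hτ => by simp only [frozenAbove, min_eq_left (hv₁β τ hτ).le]
  have hsol₁ : NeumannSol l R ψ ρ f v₁ := by
    refine ⟨hv₁c, fun r hr => ?_, ?_⟩
    · rw [hsol.eq_profile r hr]
      exact profile_congr hr.1 (hfr.mono (Icc_subset_Icc_right hr.2))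
    · rw [← flux_congr hlR.le hfr, hsol.flux_eq_zero]
  have hδσ : Tendsto (fun k => δ (σ k)) atTop (𝓝 0) := hδ0.comp hσ.tendsto_atTop
  have hbelow : ∀ᶠ k in atTop, ∀ τ ∈ Icc l R,
      U (σ k) (c (σ k)) (max l (τ - δ (σ k))) < β τ := by
    obtain ⟨x, hx, hmin⟩ := isCompact_Icc.exists_isMinOn (nonempty_Icc.2 hlR.le)
      (hβc.sub hv₁c).continuousOn
    have hε : 0 < (β x - v₁ x) / 2 := half_pos (sub_pos.2 (hv₁β x hx))
    obtain ⟨η, hη, huc⟩ := Metric.uniformContinuousOn_iff.1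
      (isCompact_Icc.uniformContinuousOn_of_continuous hv₁c.continuousOn) _ hε
    filter_upwards [Metric.tendstoUniformlyOn_iff.1 hv₁ _ hε, hδσ.eventually (gt_mem_nhds hη)]
      with k hk hkη τ hτ
    have hτ' := max_sub_mem_Icc (hδ (σ k)).le hτ
    have h1 := hk _ hτ'
    have h2 := huc _ hτ' _ hτ (by
      rw [Real.dist_eq, abs_lt]
      have := hδ (σ k)
      constructor
      · linarith [le_max_right l (τ - δ (σ k))]
      · linarith [max_le hτ.1 (show τ - δ (σ k) ≤ τ by linarith)])
    rw [Real.dist_eq] at h1 h2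
    have h3 := (abs_lt.1 h1).1
    have h4 := (abs_lt.1 h2).2
    have h5 : β x - v₁ x ≤ β τ - v₁ τ := hmin hτ
    linarith
  obtain ⟨k₀, hk₀⟩ := eventually_atTop.1 hbelow
  have hcross (k : ℕ) : ∃ x ∈ Ioo (c (σ (k + k₀))) M,
      flux l ρ (delayed l (δ (σ (k + k₀))) f (V (σ (k + k₀)) x)) R = 0 ∧
      ∃ τ ∈ Icc l R, β τ < V (σ (k + k₀)) x (max l (τ - δ (σ (k + k₀)))) := by
    have hlow := hk₀ (k + k₀) (Nat.le_add_left _ _)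
    refine exists_crossing_zero hlR.le hρ hf hβc (hδ _) (hVc _) (hUc _) (hV _) (hU _) ?_
      (hclast _) hlow (hVneg _ M (le_abs_self M))
    have h1 := hlow l hl
    rw [max_eq_left (by linarith [hδ (σ (k + k₀))]), hU _ _ l hl, profile_self] at h1
    by_contra! hMc
    have hMabs : M ≤ |c (σ (k + k₀))| := hMc.trans (le_abs_self _)
    have h2 := hβM l hl
    have h3 := le_abs_self (β l)
    have h4 : 0 ≤ E := by
      have := hE (c (σ (k + k₀))) v₁ hv₁c hsol₁.flux_eq_zero.ge l hl
      simpa using this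
    linarith
  choose x hx hx0 τ hτ hτβ using hcross
  have hδ' : Tendsto (fun k => δ (σ (k + k₀))) atTop (𝓝 0) :=
    hδσ.comp (tendsto_add_atTop_nat k₀)
  obtain ⟨κ, v₂, hκ, hv₂, hsol₂⟩ := exists_neumannSol_of_delayed hlR.le hψ hψm hρ hρpos hf hK
    (C := M) (V := fun k => V (σ (k + k₀)) (x k)) (fun k => (hδ (σ (k + k₀))).le) hδ'
    (fun k => abs_le.2 ⟨((hc _).1.trans (hx k).1).le, (hx k).2.le⟩)
    (fun k => hVc' _ _) (fun k => hV _ _) hx0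
  obtain ⟨t, ht, ι, hι, hlim⟩ := isCompact_Icc.tendsto_subseq fun k => hτ (κ k)
  refine ⟨v₁, v₂, hsol₁, hsol₂, t, ht, ne_of_lt ((hv₁β t ht).trans_le ?_)⟩
  have hδι : Tendsto (fun j => δ (σ (κ (ι j) + k₀))) atTop (𝓝 0) :=
    hδ'.comp (hκ.comp hι).tendsto_atTop
  have hpt : Tendsto (fun j => max l (τ (κ (ι j)) - δ (σ (κ (ι j) + k₀)))) atTop
      (𝓝[Icc l R] t) := by
    refine tendsto_nhdsWithin_iff.2 ⟨?_, .of_forall fun j => max_sub_mem_Icc (hδ _).le (hτ _)⟩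
    have := (tendsto_const_nhds (x := l)).max (hlim.sub hδι)
    simpa [max_eq_right ht.1] using this
  have hv₂ι : TendstoUniformlyOn (fun j => V (σ (κ (ι j) + k₀)) (x (κ (ι j)))) v₂ atTop
      (Icc l R) := fun u hu => hι.tendsto_atTop.eventually (hv₂ u hu)
  refine le_of_tendsto_of_tendsto ((hβc.tendsto t).comp hlim)
    (hv₂ι.tendsto_comp hsol₂.cont.continuousWithinAt hpt) (.of_forall fun j => ?_)
  exact (hτβ (κ (ι j))).le

end TwoSolutions

section Coercive

variable {l R A S m : ℝ} {ψ ρ a q : ℝ → ℝ}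

/-- A continuous coercive function is bounded below. -/
lemma exists_lower_bound_of_coercive (hq : Continuous q) (hq_top : Tendsto q atTop atTop)
    (hq_bot : Tendsto q atBot atTop) : ∃ m, ∀ u, m ≤ q u := by
  obtain ⟨x, hx⟩ := hq.exists_forall_le (by
    rw [cocompact_eq_atBot_atTop]
    exact hq_bot.sup hq_top)
  exact ⟨q x, hx⟩

/-- A coercive function exceeds any level outside a bounded interval. -/
lemma exists_le_of_coercive (hq_top : Tendsto q atTop atTop) (hq_bot : Tendsto q atBot atTop)
    (B : ℝ) : ∃ M, ∀ u, M ≤ |u| → B ≤ q u := by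
  obtain ⟨x, hx⟩ := eventually_atTop.1 (hq_top.eventually_ge_atTop B)
  obtain ⟨y, hy⟩ := eventually_atBot.1 (hq_bot.eventually_ge_atTop B)
  refine ⟨max x (-y), fun u hu => ?_⟩
  rcases le_abs.1 hu with h | h
  · exact hx u ((le_max_left _ _).trans h)
  · exact hy u (by linarith [le_max_right x (-y)])

/-- Bound on the oscillation of the profiles with nonnegative total flux. -/
lemma exists_oscillation_bound (hlR : l < R) (hψ : Continuous ψ) (hψm : StrictMono ψ)
    (hρ : Continuous ρ) (hρpos : ∀ t, 0 < ρ t) (ha : Continuous a) (ha0 : ∀ r, 0 ≤ a r)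
    (haA : ∀ r, a r ≤ A) (S m : ℝ) :
    ∃ E, 0 ≤ E ∧ ∀ Q : ℝ → ℝ, Continuous Q → (∀ u, m ≤ Q u) → ∀ s ≤ S, ∀ c (u : ℝ → ℝ),
      Continuous u → 0 ≤ flux l ρ (fun τ => s - a τ * Q (u τ)) R →
      ∀ r ∈ Icc l R, |profile l ψ ρ c (fun τ => s - a τ * Q (u τ)) r - c| ≤ E := by
  obtain ⟨D, hD0, hD⟩ := exists_lipschitz_profile hlR.le hψ hψm hρ hρpos
    (flux l ρ (fun _ => |S| + A * |m|) R)
  refine ⟨D * (R - l), mul_nonneg hD0 (sub_nonneg.2 hlR.le), ?_⟩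
  intro Q hQ hm s hs c u hu hflux r hr
  have hc : Continuous fun τ => s - a τ * Q (u τ) :=
    continuous_const.sub (ha.mul (hQ.comp hu))
  have hA : 0 ≤ A := (ha0 0).trans (haA 0)
  have h1 := hD c _ hc (abs_flux_le_of_le hρ hρpos hc (by positivity) (fun t _ => ?_) hflux)
    r hr l (left_mem_Icc.2 hlR.le)
  · rw [profile_self, abs_of_nonneg (sub_nonneg.2 hr.1)] at h1
    exact h1.trans (mul_le_mul_of_nonneg_left (by linarith [hr.2]) hD0)
  · have h2 : -(A * |m|) ≤ a t * Q (u t) := by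
      calc -(A * |m|) ≤ -(a t * |m|) :=
            neg_le_neg (mul_le_mul_of_nonneg_right (haA t) (abs_nonneg m))
        _ = a t * -|m| := by ring
        _ ≤ a t * Q (u t) :=
            mul_le_mul_of_nonneg_left ((neg_abs_le m).trans (hm _)) (ha0 t)
    linarith [le_abs_self S]

lemma flux_const_sub_mul (hρ : Continuous ρ) (ha : Continuous a) (s B : ℝ) :
    flux l ρ (fun τ => s - a τ * B) R = s * flux l ρ (fun _ => 1) R - B * flux l ρ a R := by
  have h1 : Continuous fun τ => s * (ρ τ * 1) := by fun_prop
  have h2 : Continuous fun τ => B * (ρ τ * a τ) := by fun_prop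
  simp only [flux]
  rw [← intervalIntegral.integral_const_mul, ← intervalIntegral.integral_const_mul,
    ← intervalIntegral.integral_sub (h1.intervalIntegrable _ _) (h2.intervalIntegrable _ _)]
  exact intervalIntegral.integral_congr fun τ _ => by ring

lemma flux_weight_pos (hlR : l < R) (hρ : Continuous ρ) (hρpos : ∀ t, 0 < ρ t)
    (ha : Continuous a) (ha0 : ∀ r, 0 ≤ a r) (hpos : ∃ ξ ∈ Icc l R, 0 < a ξ) :
    0 < flux l ρ a R := by
  obtain ⟨ξ, hξ, hξ0⟩ := hpos
  exact intervalIntegral.integral_pos hlR (hρ.mul ha).continuousOn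
    (fun t _ => mul_nonneg (hρpos t).le (ha0 t)) ⟨ξ, hξ, mul_pos (hρpos ξ) hξ0⟩

/-- If the nonlinearity is large throughout, then the total flux is negative. -/
lemma exists_level (hlR : l < R) (hρ : Continuous ρ) (hρpos : ∀ t, 0 < ρ t)
    (ha : Continuous a) (ha0 : ∀ r, 0 ≤ a r) (hpos : ∃ ξ ∈ Icc l R, 0 < a ξ) (S : ℝ) :
    ∃ B, ∀ s ≤ S, ∀ g : ℝ → ℝ, Continuous g → (∀ r ∈ Icc l R, B ≤ g r) →
      flux l ρ (fun τ => s - a τ * g τ) R < 0 := by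
  have hI := flux_weight_pos hlR hρ hρpos ha ha0 hpos
  set I := flux l ρ a R
  set J := flux l ρ (fun _ => 1) R
  refine ⟨(S * J + 1) / I, fun s hs g hg hBg => ?_⟩
  have h1 : flux l ρ (fun τ => s - a τ * g τ) R ≤
      flux l ρ (fun τ => S - a τ * ((S * J + 1) / I)) R := by
    refine flux_mono hρ hρpos (continuous_const.sub (ha.mul hg))
      (continuous_const.sub (ha.mul continuous_const)) hlR.le fun t ht => ?_
    exact sub_le_sub hs (mul_le_mul_of_nonneg_left (hBg t ht) (ha0 t))
  rw [flux_const_sub_mul hρ ha, div_mul_cancel₀ _ hI.ne'] at h1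
  linarith

/-- The parameter `s` of a solvable problem is bounded below. -/
lemma le_of_neumannSol (hlR : l < R) (hρ : Continuous ρ) (hρpos : ∀ t, 0 < ρ t)
    (ha : Continuous a) (ha0 : ∀ r, 0 ≤ a r) (hq : Continuous q) (hm : ∀ u, m ≤ q u)
    {s : ℝ} {v : ℝ → ℝ} (hv : NeumannSol l R ψ ρ (fun r u => s - a r * q u) v) :
    m * flux l ρ a R / flux l ρ (fun _ => 1) R ≤ s := by
  have hJ : 0 < flux l ρ (fun _ => 1) R :=
    flux_weight_pos hlR hρ hρpos continuous_const (fun _ => zero_le_one)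
      ⟨l, left_mem_Icc.2 hlR.le, one_pos⟩
  rw [div_le_iff₀ hJ]
  have h1 : flux l ρ (fun τ => s - a τ * q (v τ)) R ≤ flux l ρ (fun τ => s - a τ * m) R := by
    refine flux_mono hρ hρpos (continuous_const.sub (ha.mul (hq.comp hv.cont)))
      (continuous_const.sub (ha.mul continuous_const)) hlR.le fun t _ => ?_
    exact sub_le_sub_left (mul_le_mul_of_nonneg_left (hm (v t)) (ha0 t)) s
  rw [hv.flux_eq_zero, flux_const_sub_mul hρ ha] at h1
  linarith

/-- A strict upper solution yields two solutions for a coercive nonlinearity. -/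
theorem exists_two_of_strict_upper (hlR : l < R) (hψ : Continuous ψ) (hψm : StrictMono ψ)
    (hρ : Continuous ρ) (hρpos : ∀ t, 0 < ρ t) (ha : Continuous a) (ha0 : ∀ r, 0 ≤ a r)
    (haA : ∀ r, a r ≤ A) (hpos : ∃ ξ ∈ Icc l R, 0 < a ξ) (hq : Continuous q)
    (hq_top : Tendsto q atTop atTop) (hq_bot : Tendsto q atBot atTop)
    {b : ℝ → ℝ} {d s : ℝ} (hb : Continuous b) (hb0 : flux l ρ b R = 0)
    (hbs : ∀ r ∈ Icc l R, b r < s - a r * q (profile l ψ ρ d b r)) :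
    ∃ v₁ v₂ : ℝ → ℝ, NeumannSol l R ψ ρ (fun r u => s - a r * q u) v₁ ∧
      NeumannSol l R ψ ρ (fun r u => s - a r * q u) v₂ ∧ ∃ r ∈ Icc l R, v₁ r ≠ v₂ r := by
  obtain ⟨m, hm⟩ := exists_lower_bound_of_coercive hq hq_top hq_bot
  obtain ⟨E, hE0, hE⟩ := exists_oscillation_bound hlR hψ hψm hρ hρpos ha ha0 haA s m
  obtain ⟨B, hB⟩ := exists_level hlR hρ hρpos ha ha0 hpos s
  obtain ⟨M₀, hM₀⟩ := exists_le_of_coercive hq_top hq_bot B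
  obtain ⟨C, hC⟩ := isCompact_Icc.exists_bound_of_continuousOn
    (continuous_profile (l := l) (c := d) hψ hρ hρpos hb).continuousOn (s := Icc l R)
  set M := max (M₀ + E) (C + E + 1)
  obtain ⟨L₀, hL₀⟩ := (isCompact_Icc (a := -(M + E)) (b := M + E)).exists_bound_of_continuousOn
    hq.continuousOn
  set L := max (max L₀ B) m
  set Q : ℝ → ℝ := fun u => min (q u) L with hQdef
  have hQ : Continuous Q := hq.min continuous_const
  have hQm : ∀ u, m ≤ Q u := fun u => le_min (hm u) (le_max_right _ _)
  have hQq : ∀ u, |u| ≤ M + E → Q u = q u := fun u hu =>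
    min_eq_left (((le_abs_self _).trans (hL₀ u (abs_le.1 hu))).trans
      ((le_max_left _ _).trans (le_max_left _ _)))
  have hQB : ∀ u, M₀ ≤ |u| → B ≤ Q u := fun u hu =>
    le_min (hM₀ u hu) ((le_max_right _ _).trans (le_max_left _ _))
  have hE' := hE Q hQ hQm s le_rfl
  have hM : ∀ c (u : ℝ → ℝ), Continuous u → M ≤ |c| → (∀ r ∈ Icc l R, |u r - c| ≤ E) →
      flux l ρ (fun τ => s - a τ * Q (u τ)) R < 0 := by
    intro c u hu hc hnear
    refine hB s le_rfl _ (hQ.comp hu) fun r hr => hQB _ ?_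
    have h1 := abs_sub_abs_le_abs_sub c (u r)
    rw [abs_sub_comm] at h1
    linarith [hnear r hr, le_max_left (M₀ + E) (C + E + 1)]
  have hβM : ∀ r ∈ Icc l R, |profile l ψ ρ d b r| + E < M := fun r hr => by
    have h1 := hC r hr
    rw [Real.norm_eq_abs] at h1
    linarith [le_max_right (M₀ + E) (C + E + 1)]
  have hf : Continuous (fun r u => s - a r * Q u : ℝ → ℝ → ℝ).uncurry :=
    continuous_const.sub ((ha.comp continuous_fst).mul (hQ.comp continuous_snd))
  have hfK : ∀ r u, |s - a r * Q u| ≤ |s| + A * max |m| |L| := fun r u => by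
    refine (abs_sub _ _).trans ?_
    rw [abs_mul, abs_of_nonneg (ha0 r)]
    have h1 : |Q u| ≤ max |m| |L| := abs_le_max_abs_abs (hQm u) (min_le_right _ _)
    have := mul_le_mul (haA r) h1 (abs_nonneg _) ((ha0 0).trans (haA 0))
    linarith
  obtain ⟨v₁, v₂, h₁, h₂, hne⟩ := exists_two_neumannSol hlR hψ hψm hρ hρpos hf hfK hb hb0
    (fun r hr => by
      have := hbs r hr
      rwa [← hQq _ (by linarith [hβM r hr])] at this) hE' hM hβM
  have htransfer {v : ℝ → ℝ} (hv : NeumannSol l R ψ ρ (fun r u => s - a r * Q u) v) :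
      NeumannSol l R ψ ρ (fun r u => s - a r * q u) v := by
    have hosc : ∀ r ∈ Icc l R, |v r - v l| ≤ E := fun r hr => by
      have h3 := hE' (v l) v hv.cont hv.flux_eq_zero.ge r hr
      rwa [← hv.eq_profile r hr] at h3
    have hvl : |v l| < M := by
      by_contra! hcon
      exact (hM (v l) v hv.cont hcon hosc).ne hv.flux_eq_zero
    have hEq : EqOn (fun τ => s - a τ * Q (v τ)) (fun τ => s - a τ * q (v τ)) (Icc l R) := by
      intro τ hτ
      have h4 := abs_sub_abs_le_abs_sub (v τ) (v l)
      simp only [hQq (v τ) (by linarith [hosc τ hτ])]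
    refine ⟨hv.cont, fun r hr => ?_, ?_⟩
    · rw [hv.eq_profile r hr]
      exact profile_congr hr.1 (hEq.mono (Icc_subset_Icc_right hr.2))
    · rw [← flux_congr hlR.le hEq, hv.flux_eq_zero]
  exact ⟨v₁, v₂, htransfer h₁, htransfer h₂, hne⟩

/-- The set of parameters for which the coercive problem is solvable is sequentially closed. -/
theorem exists_neumannSol_of_tendsto (hlR : l < R) (hψ : Continuous ψ) (hψm : StrictMono ψ)
    (hρ : Continuous ρ) (hρpos : ∀ t, 0 < ρ t) (ha : Continuous a) (ha0 : ∀ r, 0 ≤ a r)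
    (haA : ∀ r, a r ≤ A) (hpos : ∃ ξ ∈ Icc l R, 0 < a ξ) (hq : Continuous q)
    (hq_top : Tendsto q atTop atTop) (hq_bot : Tendsto q atBot atTop)
    {s : ℕ → ℝ} {s₀ : ℝ} (hs : Tendsto s atTop (𝓝 s₀)) {V : ℕ → ℝ → ℝ}
    (hV : ∀ n, NeumannSol l R ψ ρ (fun r u => s n - a r * q u) (V n)) :
    ∃ v, NeumannSol l R ψ ρ (fun r u => s₀ - a r * q u) v := by
  obtain ⟨S, hS⟩ := hs.abs.bddAbove_range
  have hsS (n : ℕ) : |s n| ≤ S := hS (mem_range_self n)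
  obtain ⟨m, hm⟩ := exists_lower_bound_of_coercive hq hq_top hq_bot
  obtain ⟨E, hE0, hE⟩ := exists_oscillation_bound hlR hψ hψm hρ hρpos ha ha0 haA S m
  obtain ⟨B, hB⟩ := exists_level hlR hρ hρpos ha ha0 hpos S
  obtain ⟨M₀, hM₀⟩ := exists_le_of_coercive hq_top hq_bot B
  have hl : l ∈ Icc l R := left_mem_Icc.2 hlR.le
  have hsS' (n : ℕ) : s n ≤ S := (le_abs_self _).trans (hsS n)
  have hosc (n : ℕ) : ∀ r ∈ Icc l R, |V n r - V n l| ≤ E := fun r hr => by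
    have h3 := hE q hq hm (s n) (hsS' n) (V n l) (V n) (hV n).cont (hV n).flux_eq_zero.ge r hr
    rwa [← (hV n).eq_profile r hr] at h3
  have hVl (n : ℕ) : |V n l| < M₀ + E := by
    by_contra! hcon
    refine (hB (s n) (hsS' n) _ (hq.comp (hV n).cont) fun r hr => hM₀ _ ?_).ne
      (hV n).flux_eq_zero
    have h1 := abs_sub_abs_le_abs_sub (V n l) (V n r)
    rw [abs_sub_comm] at h1
    linarith [hosc n r hr]
  have hbd (n : ℕ) : ∀ r ∈ Icc l R, |V n r| ≤ M₀ + E + E := fun r hr => by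
    have h4 := abs_sub_abs_le_abs_sub (V n r) (V n l)
    linarith [hosc n r hr, hVl n]
  obtain ⟨L, hL⟩ :=
    (isCompact_Icc (a := -(M₀ + E + E)) (b := M₀ + E + E)).exists_bound_of_continuousOn
    hq.continuousOn
  have hhc (n : ℕ) : Continuous fun τ => s n - a τ * q (V n τ) :=
    continuous_const.sub (ha.mul (hq.comp (hV n).cont))
  have hK (n : ℕ) : ∀ r ∈ Icc l R, |s n - a r * q (V n r)| ≤ S + A * L := fun r hr => by
    refine (abs_sub _ _).trans ?_
    rw [abs_mul, abs_of_nonneg (ha0 r)]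
    have := mul_le_mul (haA r) (hL _ (abs_le.1 (hbd n r hr))) (norm_nonneg _)
      ((ha0 0).trans (haA 0))
    rw [Real.norm_eq_abs] at this
    linarith [hsS n]
  have hK0 : 0 ≤ S + A * L := (abs_nonneg _).trans (hK 0 l hl)
  obtain ⟨D, hD0, hD⟩ := exists_lipschitz_profile hlR.le hψ hψm hρ hρpos
    (flux l ρ (fun _ => S + A * L) R)
  have hlip (n : ℕ) : ∀ r ∈ Icc l R, ∀ r' ∈ Icc l R, |V n r - V n r'| ≤ D * |r - r'| := by
    intro r hr r' hr'
    rw [(hV n).eq_profile r hr, (hV n).eq_profile r' hr']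
    exact hD _ _ (hhc n) (abs_flux_le_of_abs_le hρ hρpos (hhc n) hK0 (hK n)) r hr r' hr'
  obtain ⟨σ, v, hσ, hvc, hv⟩ := exists_subseq_tendstoUniformlyOn hlR.le hbd hlip
  have hlim : ∀ r ∈ Icc l R, Tendsto (fun k => s (σ k) - a r * q (V (σ k) r)) atTop
      (𝓝 (s₀ - a r * q (v r))) := fun r hr =>
    (hs.comp hσ.tendsto_atTop).sub
      (((hq.tendsto _).comp (hv.tendsto_at hr)).const_mul (a r))
  refine ⟨v, hvc, fun r hr => ?_, ?_⟩
  · refine tendsto_nhds_unique (hv.tendsto_at hr) ?_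
    refine (tendsto_profile hψ hψm hρ hρpos (fun k => hhc (σ k)) (fun k => hK (σ k))
      (hv.tendsto_at hl) hlim r hr).congr fun k => ?_
    exact ((hV (σ k)).eq_profile r hr).symm
  · refine tendsto_nhds_unique (tendsto_flux hρ (fun k => hhc (σ k)) (fun k => hK (σ k)) hlim R
      (right_mem_Icc.2 hlR.le)) ?_
    simp [fun n => (hV n).flux_eq_zero]

/-- The Ambrosetti–Prodi alternative for the one-dimensional weighted Neumann problem. -/
theorem ambrosettiProdi_neumannSol (hlR : l < R) (hψ : Continuous ψ) (hψm : StrictMono ψ)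
    (hρ : Continuous ρ) (hρpos : ∀ t, 0 < ρ t) (ha : Continuous a) (ha0 : ∀ r, 0 ≤ a r)
    (haA : ∀ r, a r ≤ A) (hpos : ∃ ξ ∈ Icc l R, 0 < a ξ) (hq : Continuous q)
    (hq_top : Tendsto q atTop atTop) (hq_bot : Tendsto q atBot atTop) (hψ0 : ψ 0 = 0) :
    ∃ s₀ : ℝ,
      (∀ s < s₀, ¬∃ v, NeumannSol l R ψ ρ (fun r u => s - a r * q u) v) ∧
      (∃ v, NeumannSol l R ψ ρ (fun r u => s₀ - a r * q u) v) ∧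
      ∀ s, s₀ < s → ∃ v₁ v₂ : ℝ → ℝ, NeumannSol l R ψ ρ (fun r u => s - a r * q u) v₁ ∧
        NeumannSol l R ψ ρ (fun r u => s - a r * q u) v₂ ∧ ∃ r ∈ Icc l R, v₁ r ≠ v₂ r := by
  obtain ⟨m, hm⟩ := exists_lower_bound_of_coercive hq hq_top hq_bot
  set T : Set ℝ := {s | ∃ v, NeumannSol l R ψ ρ (fun r u => s - a r * q u) v}
  have hbdd : BddBelow T :=
    ⟨_, fun s ⟨v, hv⟩ => le_of_neumannSol hlR hρ hρpos ha ha0 hq hm hv⟩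
  have hne : T.Nonempty := by
    obtain ⟨v, -, hv, -⟩ := exists_two_of_strict_upper (s := A * |q 0| + 1) (b := fun _ => 0)
      (d := 0) hlR hψ hψm hρ hρpos ha ha0 haA hpos hq hq_top hq_bot continuous_const
      (by simp [flux]) (fun r _ => by
        have h1 : profile l ψ ρ 0 (fun _ => 0) r = 0 := by simp [profile, flux, hψ0]
        rw [h1]
        have h2 := mul_le_mul_of_nonneg_left (le_abs_self (q 0)) (ha0 r)
        have h3 := mul_le_mul_of_nonneg_right (haA r) (abs_nonneg (q 0))
        linarith)
    exact ⟨_, v, hv⟩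
  obtain ⟨s, -, hs, hsmem⟩ := exists_seq_tendsto_sInf hne hbdd
  choose V hV using hsmem
  refine ⟨sInf T, fun s hs hsol => (csInf_le hbdd hsol).not_gt hs,
    exists_neumannSol_of_tendsto hlR hψ hψm hρ hρpos ha ha0 haA hpos hq hq_top hq_bot hs hV, ?_⟩
  intro s hs
  obtain ⟨t, ⟨v, hv⟩, hts⟩ := exists_lt_of_csInf_lt hne hs
  refine exists_two_of_strict_upper hlR hψ hψm hρ hρpos ha ha0 haA hpos hq hq_top hq_bot
    (b := fun τ => t - a τ * q (v τ)) (d := v l)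
    (continuous_const.sub (ha.mul (hq.comp hv.cont))) hv.flux_eq_zero fun r hr => ?_
  rw [← hv.eq_profile r hr]
  linarith

end Coercive

section Radial

variable {N : ℕ} {Ri Re : ℝ} {φ ψ a ρ a' q : ℝ → ℝ}

/-- Solutions of the weighted Neumann problem are radial profiles. -/
lemma NeumannSol.isRadialSol (hψ : Continuous ψ) (hρ : Continuous ρ)
    (hρpos : ∀ t, 0 < ρ t) (ha' : Continuous a') (hq : Continuous q)
    (hφψ : ∀ y, φ (ψ y) = y) (hψ0 : ψ 0 = 0)
    (hρeq : ∀ r ∈ Icc Ri Re, ρ r = r ^ (N - 1)) (haeq : ∀ r ∈ Icc Ri Re, a' r = a r)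
    {s : ℝ} {v : ℝ → ℝ} (hv : NeumannSol Ri Re ψ ρ (fun r u => s - a' r * q u) v) :
    IsRadialSol N Ri Re φ (fun r u => a r * q u) s v := by
  set h : ℝ → ℝ := fun τ => s - a' τ * q (v τ) with hh
  have hc : Continuous h := continuous_const.sub (ha'.mul (hq.comp hv.cont))
  refine ⟨fun r => ψ (flux Ri ρ h r / ρ r), fun r => ρ r * h r, fun r hr => ?_,
    (continuous_slope hψ hρ hρpos hc).continuousOn, by simp [hψ0], ?_,
    (hρ.mul hc).continuousOn.integrableOn_compact isCompact_Icc, fun r hr => ?_, ?_⟩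
  · exact (hasDerivAt_profile hψ hρ hρpos hc r).hasDerivWithinAt.congr hv.eq_profile
      (hv.eq_profile r hr)
  · have := hv.flux_eq_zero
    simp only [← hh] at this
    simp [this, hψ0]
  · rw [hφψ, hφψ, flux_self, ← hρeq r hr, mul_div_cancel₀ _ (hρpos r).ne', zero_div, mul_zero,
      zero_add]
    rfl
  · refine (ae_restrict_iff' measurableSet_Icc).2 (.of_forall fun r hr => ?_)
    simp only [hh, hρeq r hr, haeq r hr]
    ring

/-- Radial profiles solve the weighted Neumann problem. -/
lemma IsRadialSol.exists_neumannSol (hlR : Ri < Re) (hψ : Continuous ψ) (hρ : Continuous ρ)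
    (hρpos : ∀ t, 0 < ρ t) (ha' : Continuous a') (hq : Continuous q)
    (hψφ : ∀ x, ψ (φ x) = x) (hφ0 : φ 0 = 0)
    (hρeq : ∀ r ∈ Icc Ri Re, ρ r = r ^ (N - 1)) (haeq : ∀ r ∈ Icc Ri Re, a' r = a r)
    {s : ℝ} {v : ℝ → ℝ} (hv : IsRadialSol N Ri Re φ (fun r u => a r * q u) s v) :
    ∃ u, NeumannSol Ri Re ψ ρ (fun r u => s - a' r * q u) u := by
  obtain ⟨v', w, hderiv, hv'c, hv'l, hv'R, -, hflux, hae⟩ := hv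
  have hvc : ContinuousOn v (Icc Ri Re) := fun r hr => (hderiv r hr).continuousWithinAt
  set u : ℝ → ℝ := IccExtend hlR.le ((Icc Ri Re).domRestrict v) with hu
  have huc : Continuous u := (continuousOn_iff_continuous_domRestrict.1 hvc).Icc_extend'
  have huv : ∀ r ∈ Icc Ri Re, u r = v r := fun r hr => by
    rw [hu, IccExtend_of_mem _ _ hr, domRestrict_apply]
  set h : ℝ → ℝ := fun τ => s - a' τ * q (u τ) with hh
  have hc : Continuous h := continuous_const.sub (ha'.mul (hq.comp huc))
  have hw : ∀ r ∈ Icc Ri Re, ∫ τ in Ri..r, w τ = flux Ri ρ h r := by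
    intro r hr
    refine intervalIntegral.integral_congr_ae_restrict ?_
    rw [uIoc_of_le hr.1]
    have hsub : Ioc Ri r ⊆ Icc Ri Re := fun x hx => ⟨hx.1.le, hx.2.trans hr.2⟩
    filter_upwards [ae_restrict_of_ae_restrict_of_subset hsub hae,
      ae_restrict_mem measurableSet_Ioc] with x hx hmem
    rw [hh]
    simp only
    rw [huv x (hsub hmem), hρeq x (hsub hmem), haeq x (hsub hmem)]
    linarith
  have hv'eq : ∀ r ∈ Icc Ri Re, v' r = ψ (flux Ri ρ h r / ρ r) := by
    intro r hr
    have h1 := hflux r hr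
    rw [hv'l, hφ0, mul_zero, zero_add, hw r hr, ← hρeq r hr] at h1
    rw [← h1, mul_div_cancel_left₀ _ (hρpos r).ne', hψφ]
  refine ⟨u, huc, fun r hr => ?_, ?_⟩
  · have hl : Ri ∈ Icc Ri Re := left_mem_Icc.2 hlR.le
    rw [huv r hr, huv Ri hl]
    have hint : ∫ t in Ri..r, ψ (flux Ri ρ h t / ρ t) = v r - v Ri := by
      refine intervalIntegral.integral_eq_sub_of_hasDerivAt_of_le hr.1
        (hvc.mono (Icc_subset_Icc_right hr.2)) (fun t ht => ?_)
        ((continuous_slope hψ hρ hρpos hc).intervalIntegrable _ _)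
      have ht' : t ∈ Icc Ri Re := ⟨ht.1.le, ht.2.le.trans hr.2⟩
      rw [← hv'eq t ht']
      exact (hderiv t ht').hasDerivAt (Icc_mem_nhds ht.1 (ht.2.trans_le hr.2))
    change v r = v Ri + ∫ t in Ri..r, ψ (flux Ri ρ h t / ρ t)
    rw [hint]
    ring
  · have hR : Re ∈ Icc Ri Re := right_mem_Icc.2 hlR.le
    have h1 := hflux Re hR
    rw [hv'R, hv'l, hφ0, mul_zero, mul_zero, zero_add, hw Re hR] at h1
    exact h1.symm

end Radial

/-- Ambrosetti–Prodi alternative for radially symmetric solutions of the Neumann problem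
`∇·(A(|∇u|)∇u) + a(|x|)q(u) = s` on an annulus, with `a ≥ 0` not identically zero and
`q` coercive (`q(u) → +∞` as `|u| → ∞`). -/
theorem statement19
    (N : ℕ) (hN : 2 ≤ N) (Ri Re : ℝ) (hRi : 0 < Ri) (hRe : Ri < Re)
    (A φ : ℝ → ℝ)
    (hAcont : ContinuousOn A (Ioi 0)) (hApos : ∀ ξ ∈ Ioi (0:ℝ), 0 < A ξ)
    (hφdef : ∀ ξ : ℝ, ξ ≠ 0 → φ ξ = A |ξ| * ξ) (hφ0 : φ 0 = 0)
    (hφmono : StrictMono φ) (hφcont : Continuous φ)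
    (hφsurj : Function.Surjective φ)
    (a : ℝ → ℝ) (ha_cont : ContinuousOn a (Icc Ri Re))
    (ha_nonneg : ∀ r ∈ Icc Ri Re, 0 ≤ a r)
    (ha_pos : ∃ ξ₀ ∈ Icc Ri Re, 0 < a ξ₀)
    (q : ℝ → ℝ) (hq : Continuous q)
    (hq_top : Tendsto q atTop atTop) (hq_bot : Tendsto q atBot atTop) :
    ∃ s₀ : ℝ,
      (∀ s : ℝ, s < s₀ →
        ¬∃ v : ℝ → ℝ, IsRadialSol N Ri Re φ (fun r u => a r * q u) s v) ∧
      (∃ v : ℝ → ℝ, IsRadialSol N Ri Re φ (fun r u => a r * q u) s₀ v) ∧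
      (∀ s : ℝ, s₀ < s → ∃ v₁ v₂ : ℝ → ℝ,
        IsRadialSol N Ri Re φ (fun r u => a r * q u) s v₁ ∧
        IsRadialSol N Ri Re φ (fun r u => a r * q u) s v₂ ∧
        ∃ r ∈ Icc Ri Re, v₁ r ≠ v₂ r) := by
  obtain ⟨ψ, hψ, hψm, hφψ, hψφ⟩ : ∃ ψ : ℝ → ℝ, Continuous ψ ∧ StrictMono ψ ∧
      (∀ y, φ (ψ y) = y) ∧ ∀ x, ψ (φ x) = x := by
    let e := hφmono.orderIsoOfSurjective φ hφsurj
    exact ⟨e.symm, e.symm.continuous, e.symm.strictMono, e.apply_symm_apply, e.symm_apply_apply⟩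
  have hψ0 : ψ 0 = 0 := by
    have := hψφ 0
    rwa [hφ0] at this
  set a' : ℝ → ℝ := IccExtend hRe.le ((Icc Ri Re).domRestrict a) with ha'def
  have ha' : Continuous a' := (continuousOn_iff_continuous_domRestrict.1 ha_cont).Icc_extend'
  have haeq : ∀ r ∈ Icc Ri Re, a' r = a r := fun r hr => by
    rw [ha'def, IccExtend_of_mem _ _ hr, domRestrict_apply]
  have ha0 : ∀ r, 0 ≤ a' r := fun r => ha_nonneg _ (projIcc Ri Re hRe.le r).2
  obtain ⟨A', hA'⟩ := isCompact_Icc.exists_bound_of_continuousOn ha_cont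
  have haA : ∀ r, a' r ≤ A' := fun r =>
    (le_abs_self _).trans (hA' _ (projIcc Ri Re hRe.le r).2)
  obtain ⟨ξ, hξ, hξ0⟩ := ha_pos
  set ρ : ℝ → ℝ := fun t => (projIcc Ri Re hRe.le t : ℝ) ^ (N - 1) with hρdef
  have hρ : Continuous ρ := (continuous_subtype_val.comp continuous_projIcc).pow _
  have hρpos : ∀ t, 0 < ρ t := fun t => pow_pos (hRi.trans_le (projIcc Ri Re hRe.le t).2.1) _
  have hρeq : ∀ r ∈ Icc Ri Re, ρ r = r ^ (N - 1) := fun r hr => by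
    simp only [hρdef, projIcc_of_mem hRe.le hr]
  obtain ⟨s₀, hlow, ⟨v, hv⟩, hhigh⟩ := ambrosettiProdi_neumannSol hRe hψ hψm hρ hρpos ha' ha0 haA
    ⟨ξ, hξ, (haeq ξ hξ).symm ▸ hξ0⟩ hq hq_top hq_bot hψ0
  refine ⟨s₀, fun s hs ⟨v, hv⟩ => hlow s hs ?_, ⟨v, ?_⟩, fun s hs => ?_⟩
  · exact hv.exists_neumannSol hRe hψ hρ hρpos ha' hq hψφ hφ0 hρeq haeq
  · exact hv.isRadialSol hψ hρ hρpos ha' hq hφψ hψ0 hρeq haeq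
  · obtain ⟨v₁, v₂, h₁, h₂, hne⟩ := hhigh s hs
    exact ⟨v₁, v₂, h₁.isRadialSol hψ hρ hρpos ha' hq hφψ hψ0 hρeq haeq,
      h₂.isRadialSol hψ hρ hρpos ha' hq hφψ hψ0 hρeq haeq, hne⟩
end
end
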